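/- Assume f satisfies the basic assumptions and hypothesis (H). Then there exists a constant c₋* > 0 with the following property: for every g₀ ∈ ℝ, every u₀ ∈ H₋(g₀) with u₀(x) ≤ p(0,x) for all x ≥ g₀ and liminf as x → +∞ of (p(0,x) − u₀(x)) > 0, and every classical solution (u,g) of the half-line free boundary problem (1.11) with this initial data (u extended by 0 for x < g(t)) such that for every C ∈ ℝ, sup over x ≥ C of |u(nω,x) − p(0,x)| → 0 as n → ∞, one has: for every c < c₋*, sup over x ≥ −ct of |u(t,x) − p(t,x)| → 0 as t → ∞, and g(t)/t → −c₋* as t → ∞. -/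

import Mathlib

open Filter Topology Set

noncomputable section

/-- `u` solves `u_t = d u_xx + f(t,x,u)` classically at every point `(t,x)` of the set `s`:
the spatial function is twice differentiable there and the time derivative exists and
equals `d u_xx + f(t,x,u)`. -/
def SolvesPDE (d : ℝ) (f : ℝ → ℝ → ℝ → ℝ) (u : ℝ → ℝ → ℝ) (s : Set (ℝ × ℝ)) : Prop :=
  ∀ q ∈ s,
    DifferentiableAt ℝ (u q.1) q.2 ∧
    DifferentiableAt ℝ (deriv (u q.1)) q.2 ∧
    HasDerivAt (fun t => u t q.2)
      (d * deriv (deriv (u q.1)) q.2 + f q.1 q.2 (u q.1 q.2)) q.1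

/-- Basic assumptions on the reaction term `f(t,x,u)` (for `u ≥ 0`): continuity,
Hölder continuity of class `C^{α/2,α}` in `(t,x)` locally uniformly in `u`,
`C¹` in `u` uniformly in `(t,x)`, `f(t,x,0) = 0`, nonpositivity for large `u`,
and space-time periodicity. -/
structure BasicAssumptions (ω L : ℝ) (f : ℝ → ℝ → ℝ → ℝ) : Prop where
  cont : ContinuousOn (fun q : ℝ × ℝ × ℝ => f q.1 q.2.1 q.2.2) {q : ℝ × ℝ × ℝ | 0 ≤ q.2.2}
  holder : ∃ α ∈ Set.Ioo (0:ℝ) 1, ∀ R > 0, ∃ C > 0, ∀ t s x y u : ℝ,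
    0 ≤ u → u ≤ R → |f t x u - f s y u| ≤ C * (|t - s| ^ (α / 2) + |x - y| ^ α)
  c1 : ∃ fu : ℝ → ℝ → ℝ → ℝ,
    (∀ t x u : ℝ, 0 ≤ u → HasDerivWithinAt (fun w => f t x w) (fu t x u) (Set.Ici 0) u) ∧
    ∀ ε > 0, ∃ δ > 0, ∀ t x u v : ℝ, 0 ≤ u → 0 ≤ v → |u - v| ≤ δ →
      |fu t x u - fu t x v| ≤ ε
  zero : ∀ t x : ℝ, f t x 0 = 0
  neg_large : ∃ M > 0, ∀ t x u : ℝ, M ≤ u → f t x u ≤ 0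
  per_t : ∀ t x u : ℝ, 0 ≤ u → f (t + ω) x u = f t x u
  per_x : ∀ t x u : ℝ, 0 ≤ u → f t (x + L) u = f t x u

/-- A bounded classical solution of the Cauchy problem
`v_t = d v_xx + f(t,x,v)` on `(0,∞) × ℝ` with initial datum `v₀`. -/
structure IsCauchySolution (d : ℝ) (f : ℝ → ℝ → ℝ → ℝ) (v₀ : ℝ → ℝ) (v : ℝ → ℝ → ℝ) : Prop where
  init : ∀ x, v 0 x = v₀ x
  cont : ContinuousOn (fun q : ℝ × ℝ => v q.1 q.2) {q : ℝ × ℝ | 0 ≤ q.1}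
  pde : SolvesPDE d f v {q : ℝ × ℝ | 0 < q.1}
  bdd : ∃ C, ∀ t ≥ (0:ℝ), ∀ x, |v t x| ≤ C

/-- Hypothesis (H): `p` is the unique positive space-time periodic solution of
`p_t = d p_xx + f(t,x,p)`, and every bounded solution of the Cauchy problem with
initial datum bounded below by a positive constant converges to `p` uniformly. -/
structure HypH (d ω L : ℝ) (f : ℝ → ℝ → ℝ → ℝ) (p : ℝ → ℝ → ℝ) : Prop where
  pos : ∀ t x, 0 < p t x
  per_t : ∀ t x, p (t + ω) x = p t x
  per_x : ∀ t x, p t (x + L) = p t x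
  sol : SolvesPDE d f p Set.univ
  uniq : ∀ q : ℝ → ℝ → ℝ, (∀ t x, 0 < q t x) → (∀ t x, q (t + ω) x = q t x) →
    (∀ t x, q t (x + L) = q t x) → SolvesPDE d f q Set.univ → q = p
  conv : ∀ v₀ : ℝ → ℝ, Continuous v₀ → (∃ C, ∀ x, |v₀ x| ≤ C) →
    (∃ ε > 0, ∀ x, ε ≤ v₀ x) →
    ∀ v : ℝ → ℝ → ℝ, IsCauchySolution d f v₀ v →
    ∀ ε > 0, ∃ S, ∀ s ≥ S, ∀ t ≥ (0:ℝ), ∀ x : ℝ, |v (t + s) x - p (t + s) x| ≤ ε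

/-- The class `H₋(g₀)` of admissible initial data on `[g₀, ∞)`. -/
def memHminus (g₀ : ℝ) (φ : ℝ → ℝ) : Prop :=
  ContinuousOn φ (Set.Ici g₀) ∧ (∃ C, ∀ x ≥ g₀, |φ x| ≤ C) ∧ φ g₀ = 0 ∧ ∀ x > g₀, 0 < φ x

/-- A classical solution `(u, g)` of the half-line free boundary problem (1.11)
with Stefan constant `μ` and initial data `u₀ ∈ H₋(g₀)`, with `u` extended by `0`
for `x < g(t)`. -/
structure IsHalfFBPSolutionLeft (d μ : ℝ) (f : ℝ → ℝ → ℝ → ℝ) (g₀ : ℝ) (u₀ : ℝ → ℝ)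
    (u : ℝ → ℝ → ℝ) (g : ℝ → ℝ) : Prop where
  g_init : g 0 = g₀
  g_smooth : ContDiffOn ℝ 1 g (Set.Ici 0)
  bdd : ∃ C, ∀ t ≥ (0:ℝ), ∀ x, |u t x| ≤ C
  u_cont : ContinuousOn (fun q : ℝ × ℝ => u q.1 q.2) {q : ℝ × ℝ | 0 ≤ q.1 ∧ g q.1 ≤ q.2}
  pde : SolvesPDE d f u {q : ℝ × ℝ | 0 < q.1 ∧ g q.1 < q.2}
  bc : ∀ t > (0:ℝ), u t (g t) = 0
  stefan : ∀ t > (0:ℝ),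
    HasDerivAt g (-μ * derivWithin (u t) (Set.Ici (g t)) (g t)) t
  init : ∀ x ≥ g₀, u 0 x = u₀ x
  ext : ∀ t ≥ (0:ℝ), ∀ x : ℝ, x < g t → u t x = 0


noncomputable section

/-! ### Basic facts on `f` -/

lemma f_unif_bdd {ω L : ℝ} (hω : 0 < ω) (hL : 0 < L) {f : ℝ → ℝ → ℝ → ℝ}
    (hf : BasicAssumptions ω L f) {w : ℝ} (hw : 0 ≤ w) :
    ∃ B > 0, ∀ t x, |f t x w| ≤ B := by
  have hc : ContinuousOn (fun q : ℝ × ℝ => f q.1 q.2 w) (Icc 0 ω ×ˢ Icc 0 L) := by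
    have : (fun q : ℝ × ℝ => f q.1 q.2 w) =
      (fun q : ℝ × ℝ × ℝ => f q.1 q.2.1 q.2.2) ∘ (fun q : ℝ × ℝ => (q.1, q.2, w)) := rfl
    rw [this]
    apply hf.cont.comp (by fun_prop)
    intro q _
    exact hw
  obtain ⟨B, hB⟩ := (isCompact_Icc.prod isCompact_Icc).exists_bound_of_continuousOn hc
  refine ⟨max B 1, by positivity, fun t x => ?_⟩
  have pt : Function.Periodic (fun t => f t x w) ω := fun t => hf.per_t t x w hw
  obtain ⟨t', ht', e1⟩ := pt.exists_mem_Ico₀ hω t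
  have px : Function.Periodic (fun x => f t' x w) L := fun x => hf.per_x t' x w hw
  obtain ⟨x', hx', e2⟩ := px.exists_mem_Ico₀ hL x
  have := hB (t', x') ⟨⟨ht'.1, ht'.2.le⟩, ⟨hx'.1, hx'.2.le⟩⟩
  rw [show f t x w = f t' x w from e1, show f t' x w = f t' x' w from e2]
  exact le_trans this (le_max_left _ _)

lemma f_lip {ω L : ℝ} (hω : 0 < ω) (hL : 0 < L) {f : ℝ → ℝ → ℝ → ℝ}
    (hf : BasicAssumptions ω L f) (M : ℝ) :
    ∃ K > 0, ∀ t x u v, 0 ≤ u → u ≤ M → 0 ≤ v → v ≤ M →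
      |f t x u - f t x v| ≤ K * |u - v| := by
  obtain ⟨fu, hfu, hu⟩ := hf.c1
  obtain ⟨δ, hδ, hδ'⟩ := hu 1 one_pos
  obtain ⟨B, hB, hB'⟩ := f_unif_bdd hω hL hf hδ.le
  have h0 : ∀ t x, |fu t x 0| ≤ B / δ + 1 := by
    intro t x
    have hco : ContinuousOn (fun w => f t x w) (Icc 0 δ) := fun w hw =>
      ((hfu t x w hw.1).continuousWithinAt).mono (fun y hy => hy.1)
    obtain ⟨c, hc, e⟩ := exists_hasDerivAt_eq_slope (fun w => f t x w) (fun w => fu t x w) hδ hco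
      (fun w hw => (hfu t x w hw.1.le).hasDerivAt (Ici_mem_nhds hw.1))
    have h1 : |fu t x c| ≤ B / δ := by
      rw [e, hf.zero]
      simp only [sub_zero]
      rw [abs_div, abs_of_pos hδ]
      gcongr
      exact hB' t x
    have h2 := hδ' t x 0 c le_rfl hc.1.le (by
      rw [zero_sub, abs_neg, abs_of_pos hc.1]; exact hc.2.le)
    have := abs_sub_abs_le_abs_sub (fu t x 0) (fu t x c)
    linarith
  have hn : ∀ n : ℕ, ∀ t x u, 0 ≤ u → u ≤ n * δ → |fu t x u| ≤ B / δ + 1 + n := by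
    intro n
    induction n with
    | zero =>
      intro t x u h1 h2
      have : u = 0 := by simp at h2; linarith
      subst this
      simpa using h0 t x
    | succ n ih =>
      intro t x u h1 h2
      push_cast at h2 ⊢
      rcases le_total u δ with h | h
      · have h2 := hδ' t x u 0 h1 le_rfl (by rw [sub_zero, abs_of_nonneg h1]; exact h)
        have := abs_sub_abs_le_abs_sub (fu t x u) (fu t x 0)
        have := h0 t x
        have : (0:ℝ) ≤ n := by positivity
        linarith
      · have h3 := hδ' t x u (u - δ) h1 (by linarith) (by
          rw [show u - (u - δ) = δ by ring, abs_of_pos hδ])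
        have := abs_sub_abs_le_abs_sub (fu t x u) (fu t x (u - δ))
        have := ih t x (u - δ) (by linarith) (by linarith)
        linarith
  obtain ⟨n, hn'⟩ := exists_nat_ge (M / δ)
  have hMn : M ≤ n * δ := by rwa [div_le_iff₀ hδ] at hn'
  refine ⟨B / δ + 1 + n, by positivity, fun t x u v hu0 huM hv0 hvM => ?_⟩
  have := (convex_Icc (0:ℝ) M).norm_image_sub_le_of_norm_hasDerivWithin_le
    (f := fun w => f t x w) (f' := fun w => fu t x w) (C := B / δ + 1 + n)
    (fun w hw => (hfu t x w hw.1).mono (fun y hy => hy.1))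
    (fun w hw => hn n t x w hw.1 (hw.2.trans hMn)) ⟨hv0, hvM⟩ ⟨hu0, huM⟩
  simpa [Real.norm_eq_abs] using this

/-! ### Maximum principle tools -/

lemma second_deriv_nonneg {φ φ1 : ℝ → ℝ} {φ2 x : ℝ}
    (h1 : ∀ᶠ y in 𝓝 x, HasDerivAt φ (φ1 y) y) (h2 : HasDerivAt φ1 φ2 x)
    (hmin : ∀ᶠ y in 𝓝 x, φ x ≤ φ y) : 0 ≤ φ2 := by
  by_contra! hneg
  have e1 : deriv φ =ᶠ[𝓝 x] φ1 := h1.mono fun y hy => hy.deriv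
  have e2 : deriv (deriv φ) x = φ2 := by rw [e1.deriv_eq]; exact h2.deriv
  have hlm : IsLocalMin φ x := hmin
  have hmax := isLocalMax_of_deriv_deriv_neg (f := φ) (x₀ := x) (by rw [e2]; exact hneg)
    hlm.deriv_eq_zero h1.self_of_nhds.continuousAt
  have hconst : φ =ᶠ[𝓝 x] fun _ => φ x := by
    filter_upwards [hmin, hmax] with y a b
    exact le_antisymm b a
  have : deriv φ =ᶠ[𝓝 x] fun _ => 0 := by
    have := hconst.deriv
    simpa using this
  rw [this.deriv_eq] at e2
  simp at e2
  linarith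

lemma deriv_nonpos_of_past {φ : ℝ → ℝ} {a t : ℝ} (h : HasDerivAt φ a t)
    (hp : ∀ᶠ s in 𝓝[<] t, φ t ≤ φ s) : a ≤ 0 := by
  have h1 := h.hasDerivWithinAt (s := Iio t)
  have h2 := hasDerivWithinAt_iff_tendsto_slope.1 h1
  have : Iio t \ {t} = Iio t := by ext y; simp
  rw [this] at h2
  refine le_of_tendsto h2 ?_
  filter_upwards [hp, self_mem_nhdsWithin] with s hs hst
  rw [slope_def_field]
  have : s - t < 0 := sub_neg.2 hst
  exact div_nonpos_of_nonneg_of_nonpos (by linarith) this.le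

lemma master {E : Type*} [TopologicalSpace E] [T2Space E] {K : Set (ℝ × E)} (hK : IsCompact K)
    {h : ℝ → E → ℝ} (hc : ContinuousOn (fun q : ℝ × E => h q.1 q.2) K)
    (H : ∀ t z, (t, z) ∈ K → h t z ≤ 0 → (∀ᶠ z' in 𝓝 z, (t, z') ∈ K) ∧
      (∀ᶠ s in 𝓝[<] t, (s, z) ∈ K) ∧
      (h t z = 0 → (∀ᶠ z' in 𝓝 z, 0 ≤ h t z') → (∀ᶠ s in 𝓝[<] t, 0 < h s z) → False)) :
    ∀ t z, (t, z) ∈ K → 0 < h t z := by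
  intro t z htz
  by_contra! hneg
  set S := K ∩ (fun q : ℝ × E => h q.1 q.2) ⁻¹' Iic 0 with hS
  have hSc : IsCompact S := by
    have : IsClosed S := hc.preimage_isClosed_of_isClosed hK.isClosed isClosed_Iic
    exact hK.of_isClosed_subset this inter_subset_left
  obtain ⟨q, hqS, hq⟩ := hSc.exists_isMinOn ⟨(t, z), htz, hneg⟩ continuous_fst.continuousOn
  have hlt : ∀ s y, (s, y) ∈ K → s < q.1 → 0 < h s y := by
    intro s y hs hsq
    by_contra! hn
    have : q.1 ≤ s := hq (show (s, y) ∈ S from ⟨hs, hn⟩)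
    linarith
  have hge : ∀ y, (q.1, y) ∈ K → 0 ≤ h q.1 y := by
    intro y hy
    by_contra! hn
    obtain ⟨-, h2, -⟩ := H q.1 y hy hn.le
    have ht : Tendsto (fun s => h s y) (𝓝[<] q.1) (𝓝 (h q.1 y)) := by
      have : Tendsto (fun s : ℝ => (s, y)) (𝓝[<] q.1) (𝓝[K] (q.1, y)) := by
        apply tendsto_nhdsWithin_of_tendsto_nhds_of_eventually_within _ _ h2
        have : Continuous (fun s : ℝ => (s, y)) := by fun_prop
        exact (this.tendsto q.1).mono_left nhdsWithin_le_nhds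
      exact (hc (q.1, y) hy).tendsto.comp this
    have : 0 ≤ h q.1 y := by
      refine ge_of_tendsto ht ?_
      filter_upwards [h2, self_mem_nhdsWithin] with s a b
      exact (hlt s y a b).le
    linarith
  obtain ⟨a1, a2, a3⟩ := H q.1 q.2 hqS.1 hqS.2
  refine a3 (le_antisymm hqS.2 (hge q.2 hqS.1)) (a1.mono fun y hy => hge y hy) ?_
  filter_upwards [a2, self_mem_nhdsWithin] with s a b
  exact hlt s q.2 a b

/-- local classical solution at a point -/
def LocSol (d : ℝ) (f : ℝ → ℝ → ℝ → ℝ) (u : ℝ → ℝ → ℝ) (t x : ℝ) : Prop :=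
  (∀ᶠ y in 𝓝 x, DifferentiableAt ℝ (u t) y) ∧ DifferentiableAt ℝ (deriv (u t)) x ∧
    HasDerivAt (fun s => u s x) (d * deriv (deriv (u t)) x + f t x (u t x)) t

lemma SolvesPDE.locSol {d : ℝ} {f : ℝ → ℝ → ℝ → ℝ} {u : ℝ → ℝ → ℝ} {s : Set (ℝ × ℝ)}
    (h : SolvesPDE d f u s) {t x : ℝ} (hx : ∀ᶠ y in 𝓝 x, (t, y) ∈ s) : LocSol d f u t x :=
  ⟨hx.mono fun y hy => (h (t, y) hy).1, (h (t, x) hx.self_of_nhds).2.1,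
    (h (t, x) hx.self_of_nhds).2.2⟩

lemma locSol_zero {d : ℝ} {f : ℝ → ℝ → ℝ → ℝ} (h0 : ∀ t x, f t x 0 = 0) (t x : ℝ) :
    LocSol d f (fun _ _ => 0) t x := by
  refine ⟨Eventually.of_forall fun y => by fun_prop, ?_, ?_⟩
  · have : deriv (fun _ : ℝ => (0:ℝ)) = fun _ => 0 := by ext; simp
    rw [this]; fun_prop
  · have : deriv (fun _ : ℝ => (0:ℝ)) = fun _ => 0 := by ext; simp
    rw [this, h0]
    simpa using hasDerivAt_const t (0:ℝ)

lemma no_contact {d K : ℝ} (hd : 0 < d) {f : ℝ → ℝ → ℝ → ℝ} {u v E Ex : ℝ → ℝ → ℝ} {t x Et Exx : ℝ}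
    (hu : LocSol d f u t x) (hv : LocSol d f v t x)
    (hEt : HasDerivAt (fun s => E s x) Et t) (hEx : ∀ y, HasDerivAt (E t) (Ex t y) y)
    (hExx : HasDerivAt (Ex t) Exx x)
    (h0 : u t x - v t x + E t x = 0) (hmin : ∀ᶠ y in 𝓝 x, 0 ≤ u t y - v t y + E t y)
    (hpast : ∀ᶠ s in 𝓝[<] t, 0 < u s x - v s x + E s x)
    (lip : |f t x (u t x) - f t x (v t x)| ≤ K * |u t x - v t x|) :
    Et - d * Exx ≤ K * |E t x| := by
  have h2 : 0 ≤ deriv (deriv (u t)) x - deriv (deriv (v t)) x + Exx := by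
    apply second_deriv_nonneg (φ := fun y => u t y - v t y + E t y)
      (φ1 := fun y => deriv (u t) y - deriv (v t) y + Ex t y) (x := x)
    · filter_upwards [hu.1, hv.1] with y a b
      exact (a.hasDerivAt.sub b.hasDerivAt).add (hEx y)
    · exact (hu.2.1.hasDerivAt.sub hv.2.1.hasDerivAt).add hExx
    · rw [h0]; exact hmin
  have h1 := deriv_nonpos_of_past (φ := fun s => u s x - v s x + E s x)
    ((hu.2.2.sub hv.2.2).add hEt) (by
      rw [h0]; exact hpast.mono fun s hs => hs.le)
  have e : u t x - v t x = - E t x := by linarith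
  rw [e, abs_neg] at lip
  have := neg_le_of_abs_le lip
  have : 0 ≤ d * (deriv (deriv (u t)) x - deriv (deriv (v t)) x + Exx) := by positivity
  nlinarith

/-- comparison on a compact set -/
lemma comp_compact {d K : ℝ} (hd : 0 < d) {f : ℝ → ℝ → ℝ → ℝ} {u v E Ex Et Exx : ℝ → ℝ → ℝ}
    {S : Set (ℝ × ℝ)} (hS : IsCompact S)
    (hc : ContinuousOn (fun q : ℝ × ℝ => u q.1 q.2 - v q.1 q.2 + E q.1 q.2) S)
    (hEx : ∀ t y, HasDerivAt (E t) (Ex t y) y) (hExx : ∀ t y, HasDerivAt (Ex t) (Exx t y) y)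
    (H : ∀ t x, (t, x) ∈ S → u t x - v t x + E t x ≤ 0 →
      (∀ᶠ y in 𝓝 x, (t, y) ∈ S) ∧ (∀ᶠ s in 𝓝[<] t, (s, x) ∈ S) ∧
      HasDerivAt (fun s => E s x) (Et t x) t ∧
      (u t x - v t x + E t x = 0 → LocSol d f u t x ∧ LocSol d f v t x ∧
      |f t x (u t x) - f t x (v t x)| ≤ K * |u t x - v t x| ∧
      K * |E t x| < Et t x - d * Exx t x)) :
    ∀ t x, (t, x) ∈ S → 0 < u t x - v t x + E t x := by
  apply master hS (h := fun t x => u t x - v t x + E t x) hc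
  intro t x hx hle
  obtain ⟨a1, a2, a3, a4⟩ := H t x hx hle
  refine ⟨a1, a2, fun h0 hm hp => ?_⟩
  obtain ⟨b1, b2, b3, b4⟩ := a4 h0
  have := no_contact hd b1 b2 a3 (hEx t) (hExx t x) h0 hm hp b3
  linarith

/-- comparison on a strip -/
lemma comp_strip {d K : ℝ} (hd : 0 < d) {f : ℝ → ℝ → ℝ → ℝ} {u v E Ex Et Exx : ℝ → ℝ → ℝ}
    {T T' : ℝ} {γ₁ γ₂ : ℝ → ℝ} (h1 : ContinuousOn γ₁ (Icc T T')) (h2 : ContinuousOn γ₂ (Icc T T'))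
    (hc : ContinuousOn (fun q : ℝ × ℝ => u q.1 q.2 - v q.1 q.2 + E q.1 q.2)
      {q : ℝ × ℝ | q.1 ∈ Icc T T' ∧ γ₁ q.1 ≤ q.2 ∧ q.2 ≤ γ₂ q.1})
    (hEx : ∀ t y, HasDerivAt (E t) (Ex t y) y) (hExx : ∀ t y, HasDerivAt (Ex t) (Exx t y) y)
    (H : ∀ t ∈ Icc T T', ∀ x, γ₁ t ≤ x → x ≤ γ₂ t → u t x - v t x + E t x ≤ 0 →
      T < t ∧ γ₁ t < x ∧ x < γ₂ t ∧ HasDerivAt (fun s => E s x) (Et t x) t ∧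
      (u t x - v t x + E t x = 0 → LocSol d f u t x ∧ LocSol d f v t x ∧
      |f t x (u t x) - f t x (v t x)| ≤ K * |u t x - v t x| ∧
      K * |E t x| < Et t x - d * Exx t x)) :
    ∀ t ∈ Icc T T', ∀ x, γ₁ t ≤ x → x ≤ γ₂ t → 0 < u t x - v t x + E t x := by
  set S := {q : ℝ × ℝ | q.1 ∈ Icc T T' ∧ γ₁ q.1 ≤ q.2 ∧ q.2 ≤ γ₂ q.1} with hS
  have hbd1 := (isCompact_Icc (a := T) (b := T')).exists_bound_of_continuousOn h1
  have hbd2 := (isCompact_Icc (a := T) (b := T')).exists_bound_of_continuousOn h2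
  obtain ⟨C1, hC1⟩ := hbd1
  obtain ⟨C2, hC2⟩ := hbd2
  have hSK : IsCompact S := by
    have hsub : S ⊆ Icc T T' ×ˢ Icc (-C1) C2 := by
      rintro ⟨t, x⟩ ⟨ht, hx1, hx2⟩
      have a := (abs_le.1 (hC1 t ht)).1
      have b := (abs_le.1 (hC2 t ht)).2
      exact ⟨ht, by simp only at hx1; linarith, by simp only at hx2; linarith⟩
    refine (isCompact_Icc.prod isCompact_Icc).of_isClosed_subset ?_ hsub
    have hD : IsClosed (Icc T T' ×ˢ (univ : Set ℝ)) := isClosed_Icc.prod isClosed_univ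
    have c1 : ContinuousOn (fun q : ℝ × ℝ => q.2 - γ₁ q.1) (Icc T T' ×ˢ (univ : Set ℝ)) :=
      continuousOn_snd.sub (h1.comp continuousOn_fst fun q hq => hq.1)
    have c2 : ContinuousOn (fun q : ℝ × ℝ => γ₂ q.1 - q.2) (Icc T T' ×ˢ (univ : Set ℝ)) :=
      (h2.comp continuousOn_fst fun q hq => hq.1).sub continuousOn_snd
    have k1 := c1.preimage_isClosed_of_isClosed hD (isClosed_Ici (a := (0:ℝ)))
    have k2 := c2.preimage_isClosed_of_isClosed hD (isClosed_Ici (a := (0:ℝ)))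
    convert k1.inter k2 using 1
    ext ⟨t, x⟩
    simp only [hS, mem_setOf_eq, mem_inter_iff, mem_prod, mem_univ, and_true, mem_preimage, mem_Ici,
      sub_nonneg]
    tauto
  have := comp_compact (K := K) (f := f) (Et := Et) hd hSK hc hEx hExx ?_
  · intro t ht x hx1 hx2
    exact this t x ⟨ht, hx1, hx2⟩
  rintro t x ⟨ht, hx1, hx2⟩ hle
  obtain ⟨a1, a2, a3, a4, a5⟩ := H t ht x hx1 hx2 hle
  refine ⟨?_, ?_, a4, a5⟩
  · filter_upwards [Ioo_mem_nhds a2 a3] with y hy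
    exact ⟨ht, hy.1.le, hy.2.le⟩
  · have m1 : Ioo T t ∈ 𝓝[<] t := Ioo_mem_nhdsLT a1
    have e1 : ∀ᶠ s in 𝓝[<] t, γ₁ s < x := by
      have : Tendsto γ₁ (𝓝[Icc T T'] t) (𝓝 (γ₁ t)) := h1 t ht
      have l : 𝓝[<] t ≤ 𝓝[Icc T T'] t := by
        rw [← nhdsWithin_Ioo_eq_nhdsLT a1]
        exact nhdsWithin_mono _ fun s hs => ⟨hs.1.le, hs.2.le.trans ht.2⟩
      exact (this.mono_left l).eventually (gt_mem_nhds a2)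
    have e2 : ∀ᶠ s in 𝓝[<] t, x < γ₂ s := by
      have : Tendsto γ₂ (𝓝[Icc T T'] t) (𝓝 (γ₂ t)) := h2 t ht
      have l : 𝓝[<] t ≤ 𝓝[Icc T T'] t := by
        rw [← nhdsWithin_Ioo_eq_nhdsLT a1]
        exact nhdsWithin_mono _ fun s hs => ⟨hs.1.le, hs.2.le.trans ht.2⟩
      exact (this.mono_left l).eventually (lt_mem_nhds a3)
    filter_upwards [m1, e1, e2] with s b1 b2 b3
    exact ⟨⟨b1.1.le, b1.2.le.trans ht.2⟩, b2.le, b3.le⟩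
end

noncomputable section

/-- comparison on a half-infinite region: the barrier dominates far to the right -/
lemma comp_right {d K : ℝ} (hd : 0 < d) {f : ℝ → ℝ → ℝ → ℝ} {u v E Ex Et Exx : ℝ → ℝ → ℝ}
    {T T' X : ℝ} {γ : ℝ → ℝ} (h1 : ContinuousOn γ (Icc T T'))
    (hc : ContinuousOn (fun q : ℝ × ℝ => u q.1 q.2 - v q.1 q.2 + E q.1 q.2)
      {q : ℝ × ℝ | q.1 ∈ Icc T T' ∧ γ q.1 ≤ q.2})
    (hEx : ∀ t y, HasDerivAt (E t) (Ex t y) y) (hExx : ∀ t y, HasDerivAt (Ex t) (Exx t y) y)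
    (hX : ∀ t ∈ Icc T T', ∀ x, X ≤ x → γ t ≤ x → 0 < u t x - v t x + E t x)
    (H : ∀ t ∈ Icc T T', ∀ x, γ t ≤ x → u t x - v t x + E t x ≤ 0 →
      T < t ∧ γ t < x ∧ HasDerivAt (fun s => E s x) (Et t x) t ∧
      (u t x - v t x + E t x = 0 → LocSol d f u t x ∧ LocSol d f v t x ∧
      |f t x (u t x) - f t x (v t x)| ≤ K * |u t x - v t x| ∧
      K * |E t x| < Et t x - d * Exx t x)) :
    ∀ t ∈ Icc T T', ∀ x, γ t ≤ x → 0 < u t x - v t x + E t x := by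
  intro t ht x hx
  by_contra! hle
  have := comp_strip (K := K) (f := f) (Et := Et) (γ₂ := fun _ => max X x) hd h1
    continuousOn_const (hc.mono fun q hq => ⟨hq.1, hq.2.1⟩) hEx hExx ?_ t ht x hx (le_max_right _ _)
  · linarith
  intro s hs y hy1 hy2 hle
  obtain ⟨a1, a2, a3, a4⟩ := H s hs y hy1 hle
  refine ⟨a1, a2, ?_, a3, a4⟩
  by_contra! hn
  have := hX s hs y ((le_max_left _ _).trans hn) hy1
  linarith

set_option maxHeartbeats 1000000 in
/-- Hopf-type lower bound in a moving strip. -/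
lemma hopf {d K B l τ : ℝ} (hd : 0 < d) (hK : 0 ≤ K) (hB : 0 ≤ B) (hl : 0 < l) :
    ∃ c > 0, ∀ (f : ℝ → ℝ → ℝ → ℝ) (u v : ℝ → ℝ → ℝ) (T T' m : ℝ) (γ γ' : ℝ → ℝ),
      T' ≤ T + τ → 0 < m → ContinuousOn γ (Icc T T') →
      (∀ t ∈ Ioc T T', HasDerivAt γ (γ' t) t) → (∀ t ∈ Ioc T T', |γ' t| ≤ B) →
      ContinuousOn (fun q : ℝ × ℝ => u q.1 q.2 - v q.1 q.2)
        {q : ℝ × ℝ | q.1 ∈ Icc T T' ∧ γ q.1 ≤ q.2 ∧ q.2 ≤ γ q.1 + l} →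
      (∀ t ∈ Icc T T', ∀ x, γ t ≤ x → x ≤ γ t + l → v t x ≤ u t x) →
      (∀ x, γ T ≤ x → x ≤ γ T + l → m ≤ u T x - v T x) →
      (∀ t ∈ Ioc T T', ∀ x, γ t < x → x < γ t + l → u t x - v t x < m →
        LocSol d f u t x ∧ LocSol d f v t x ∧
        |f t x (u t x) - f t x (v t x)| ≤ K * |u t x - v t x|) →
      ∀ t ∈ Icc T T', ∀ x, γ t ≤ x → x ≤ γ t + l →
        c * m * ((x - γ t) * (γ t + l - x)) ≤ u t x - v t x := by
  obtain ⟨A, hA, hAe⟩ : ∃ A > 0, d * (2 * A * l ^ 2 - 2) - B * l = 1 := by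
    refine ⟨((1 + B * l) / d + 2) / (2 * l ^ 2), by positivity, ?_⟩
    field_simp
    ring
  set lam := K + 12 * d * A + 2 * A * B * l with hlam
  set Pm := l ^ 2 / 4 + A * (l ^ 2 / 4) ^ 2 with hPm
  have hPm0 : 0 < Pm := by positivity
  refine ⟨Real.exp (-(lam * τ)) / Pm, by positivity, ?_⟩
  intro f u v T T' m γ γ' hT hm hγc hγd hγb hwc hw0 hwT hloc t ht x hx1 hx2
  set th : ℝ → ℝ → ℝ := fun t x => (x - γ t) * (γ t + l - x) with hth
  have hlam0 : 0 ≤ lam := by positivity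
  have hth0 : ∀ t x, γ t ≤ x → x ≤ γ t + l → 0 ≤ th t x := fun t x a b =>
    mul_nonneg (by linarith) (by linarith)
  have hthm : ∀ t x, th t x ≤ l ^ 2 / 4 := fun t x => by
    simp only [hth]; nlinarith [sq_nonneg (x - γ t - l / 2)]
  set m' := m / Pm with hm'
  have hm'0 : 0 < m' := by positivity
  set ex : ℝ → ℝ := fun t => Real.exp (-(lam * (t - T))) with hex
  have key : ∀ ε > 0, ∀ t ∈ Icc T T', ∀ x, γ t ≤ x → x ≤ γ t + l →
      0 < u t x - v t x + (-(m' * ex t * (th t x + A * th t x ^ 2)) + ε) := by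
    intro ε hε
    apply comp_strip (K := K) (f := f) (γ₁ := γ) (γ₂ := fun t => γ t + l) hd hγc (by fun_prop)
      (E := fun t x => -(m' * ex t * (th t x + A * th t x ^ 2)) + ε)
      (Ex := fun t x => -(m' * ex t * ((1 + 2 * A * th t x) * (2 * γ t + l - 2 * x))))
      (Exx := fun t x => -(m' * ex t * (2 * A * l ^ 2 - 2 - 12 * A * th t x)))
      (Et := fun t x => m' * ex t * (lam * (th t x + A * th t x ^ 2) +
        γ' t * ((1 + 2 * A * th t x) * (2 * γ t + l - 2 * x))))
    · apply hwc.add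
      have hg : ContinuousOn (fun q : ℝ × ℝ => γ q.1)
        {q : ℝ × ℝ | q.1 ∈ Icc T T' ∧ γ q.1 ≤ q.2 ∧ q.2 ≤ γ q.1 + l} :=
        hγc.comp continuousOn_fst fun q hq => hq.1
      generalize hG : (fun q : ℝ × ℝ => γ q.1) = G at hg
      have e : ∀ q : ℝ × ℝ, γ q.1 = G q := fun q => by rw [← hG]
      simp only [hth, hex, e] at hg ⊢
      fun_prop
    · intro t y
      have e : HasDerivAt (th t) (2 * γ t + l - 2 * y) y := by
        have := ((hasDerivAt_id y).sub_const (γ t)).mul ((hasDerivAt_id y).const_sub (γ t + l))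
        refine this.congr_deriv ?_
        simp; ring
      have := (((e.add ((e.pow 2).const_mul A)).const_mul (m' * ex t)).neg).add_const ε
      refine this.congr_deriv ?_
      simp only [Nat.cast_ofNat, show 2 - 1 = 1 from rfl, pow_one]; ring
    · intro t y
      have e : HasDerivAt (th t) (2 * γ t + l - 2 * y) y := by
        have := ((hasDerivAt_id y).sub_const (γ t)).mul ((hasDerivAt_id y).const_sub (γ t + l))
        refine this.congr_deriv ?_
        simp; ring
      have e2 : HasDerivAt (fun y => 2 * γ t + l - 2 * y) (-2) y := by
        have := ((hasDerivAt_id y).const_mul 2).const_sub (2 * γ t + l)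
        refine this.congr_deriv ?_
        simp
      have := (((((e.const_mul (2 * A)).const_add 1).mul e2)).const_mul (m' * ex t)).neg
      refine this.congr_deriv ?_
      simp only [hth]; ring
    · intro t ht x hx1 hx2 hle
      have hex0 : 0 < ex t := Real.exp_pos _
      have hex1 : ex t ≤ 1 := Real.exp_le_one_iff.2 (by nlinarith [ht.1])
      have hΨ0 : 0 ≤ th t x + A * th t x ^ 2 := by have := hth0 t x hx1 hx2; positivity
      have hΨ1 : th t x + A * th t x ^ 2 ≤ Pm := by
        have h0 := hth0 t x hx1 hx2
        have h1 := hthm t x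
        rw [hPm]; gcongr
      have hZm : m' * ex t * (th t x + A * th t x ^ 2) ≤ m := by
        calc m' * ex t * (th t x + A * th t x ^ 2) ≤ m' * 1 * Pm := by gcongr
          _ = m := by rw [hm']; field_simp
      have hw := hw0 t ht x hx1 hx2
      have tT : T < t := by
        rcases ht.1.lt_or_eq with h | h
        · exact h
        · subst h
          have := hwT x hx1 hx2
          linarith
      have xl : γ t < x := by
        rcases hx1.lt_or_eq with h | h
        · exact h
        · have : th t x = 0 := by simp only [hth]; rw [h]; ring
          rw [this] at hle; simp at hle; linarith
      have xr : x < γ t + l := by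
        rcases hx2.lt_or_eq with h | h
        · exact h
        · have : th t x = 0 := by simp only [hth]; rw [h]; ring
          rw [this] at hle; simp at hle; linarith
      refine ⟨tT, xl, xr, ?_, ?_⟩
      · have g1 := hγd t ⟨tT, ht.2⟩
        have e : HasDerivAt (fun s => th s x) (-γ' t * (2 * γ t + l - 2 * x)) t := by
          have := (g1.const_sub x).mul ((g1.add_const l).sub_const x)
          refine this.congr_deriv ?_
          ring
        have e3 : HasDerivAt ex (-lam * ex t) t := by
          have := ((((hasDerivAt_id t).sub_const T).const_mul lam).neg).exp
          refine this.congr_deriv ?_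
          simp [hex]; ring
        have := (((e3.const_mul m').mul (e.add ((e.pow 2).const_mul A))).neg).add_const ε
        refine this.congr_deriv ?_
        simp only [Nat.cast_ofNat, show 2 - 1 = 1 from rfl, pow_one, Pi.add_apply, Pi.pow_apply]
        ring
      · intro h0
        obtain ⟨b1, b2, b3⟩ := hloc t ⟨tT, ht.2⟩ x xl xr (by linarith)
        refine ⟨b1, b2, b3, ?_⟩
        have hE : |-(m' * ex t * (th t x + A * th t x ^ 2)) + ε| ≤
            m' * ex t * (th t x + A * th t x ^ 2) := by
          rw [abs_le]; constructor <;> linarith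
        have hth0' := hth0 t x hx1 hx2
        have hd1 : |2 * γ t + l - 2 * x| ≤ l := by rw [abs_le]; constructor <;> linarith
        have hd2 : |γ' t * ((1 + 2 * A * th t x) * (2 * γ t + l - 2 * x))| ≤
            B * ((1 + 2 * A * th t x) * l) := by
          rw [abs_mul, abs_mul, abs_of_nonneg (show 0 ≤ 1 + 2 * A * th t x by positivity)]
          have := hγb t ⟨tT, ht.2⟩
          gcongr
        have hd3 := neg_le_of_abs_le hd2
        have : m' * ex t * (K * (th t x + A * th t x ^ 2)) < m' * ex t *
            (lam * (th t x + A * th t x ^ 2) + γ' t * ((1 + 2 * A * th t x) * (2 * γ t + l - 2 * x))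
            + d * (2 * A * l ^ 2 - 2 - 12 * A * th t x)) := by
          apply mul_lt_mul_of_pos_left _ (by positivity)
          have h5 : 0 ≤ (12 * d * A + 2 * A * B * l) * (A * th t x ^ 2) := by positivity
          have h7 : lam * (th t x + A * th t x ^ 2) = K * (th t x + A * th t x ^ 2) +
            (12 * d * A + 2 * A * B * l) * th t x +
            (12 * d * A + 2 * A * B * l) * (A * th t x ^ 2) := by rw [hlam]; ring
          rw [h7]
          linarith
        have h6 : K * |-(m' * ex t * (th t x + A * th t x ^ 2)) + ε| ≤
          K * (m' * ex t * (th t x + A * th t x ^ 2)) := by gcongr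
        linarith
  have h1 : m' * ex t * (th t x + A * th t x ^ 2) ≤ u t x - v t x := by
    apply le_of_forall_pos_lt_add
    intro ε hε
    have := key ε hε t ht x hx1 hx2
    linarith
  refine le_trans ?_ h1
  have h0 := hth0 t x hx1 hx2
  have h2 : Real.exp (-(lam * τ)) ≤ ex t := Real.exp_le_exp.2 (by
    have := ht.2; nlinarith)
  calc Real.exp (-(lam * τ)) / Pm * m * ((x - γ t) * (γ t + l - x))
      = m' * Real.exp (-(lam * τ)) * th t x := by rw [hm']; simp only [hth]; ring
    _ ≤ m' * ex t * (th t x + A * th t x ^ 2) := by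
      gcongr
      have : 0 ≤ A * th t x ^ 2 := by positivity
      linarith
end

noncomputable section

lemma quasi_add_nat {φ : ℝ → ℝ} {C r : ℝ} (hC : 0 ≤ C)
    (h : ∀ x y, 0 < x → 0 < y → x + y ≤ r → |φ (x + y) - φ x - φ y| ≤ C * (x ^ 2 + y ^ 2))
    {x : ℝ} (hx : 0 < x) : ∀ n : ℕ, 1 ≤ n → n * x ≤ r →
      |φ (n * x) - n * φ x| ≤ 3 * C * (n ^ 2 * x ^ 2) := by
  intro n
  induction n using Nat.strong_induction_on with
  | _ n ih =>
    intro hn hr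
    rcases Nat.even_or_odd' n with ⟨m, hm | hm⟩
    · have hm1 : 1 ≤ m := by omega
      have hmr : (1:ℝ) ≤ m := by exact_mod_cast hm1
      have e : (n:ℝ) = 2 * m := by rw [hm]; push_cast; ring
      rw [e] at hr ⊢
      have i1 := ih m (by omega) hm1 (by nlinarith)
      have i2 := h (m * x) (m * x) (by positivity) (by positivity) (by linarith)
      rw [show m * x + m * x = 2 * m * x by ring] at i2
      have : φ (2 * m * x) - 2 * m * φ x = (φ (2 * m * x) - φ (m * x) - φ (m * x)) +
        2 * (φ (m * x) - m * φ x) := by ring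
      rw [this]
      refine (abs_add_le _ _).trans ?_
      rw [abs_mul, abs_two]
      have : 0 ≤ C * (m * x) ^ 2 := by positivity
      nlinarith
    · rcases Nat.eq_zero_or_pos m with h0 | hm1
      · subst h0
        simp at hm
        subst hm
        simp
        positivity
      have hmr : (1:ℝ) ≤ m := by exact_mod_cast hm1
      have e : (n:ℝ) = 2 * m + 1 := by rw [hm]; push_cast; ring
      rw [e] at hr ⊢
      have i1 := ih m (by omega) hm1 (by nlinarith)
      have i3 := ih (m + 1) (by omega) (by omega) (by push_cast; nlinarith)
      push_cast at i3
      have i2 := h (m * x) ((m + 1) * x) (by positivity) (by positivity) (by linarith)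
      rw [show m * x + (m + 1) * x = (2 * m + 1) * x by ring] at i2
      have : φ ((2 * m + 1) * x) - (2 * m + 1) * φ x =
        (φ ((2 * m + 1) * x) - φ (m * x) - φ ((m + 1) * x)) +
        ((φ (m * x) - m * φ x) + (φ ((m + 1) * x) - (m + 1) * φ x)) := by ring
      rw [this]
      refine (abs_add_le _ _).trans ((add_le_add_right (abs_add_le _ _) _).trans ?_)
      have h5 : 0 ≤ C * x ^ 2 * (4 * m ^ 2 + 4 * m - 1) :=
        mul_nonneg (by positivity) (by nlinarith)
      nlinarith

lemma quasi_add {φ : ℝ → ℝ} {C r : ℝ} (hr : 0 < r) (hC : 0 ≤ C)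
    (h : ∀ x y, 0 < x → 0 < y → x + y ≤ r → |φ (x + y) - φ x - φ y| ≤ C * (x ^ 2 + y ^ 2))
    (h0 : Tendsto φ (𝓝[>] 0) (𝓝 0)) : ∃ a, Tendsto (fun x => φ x / x) (𝓝[>] 0) (𝓝 a) := by
  have hsmall : ∀ ε > 0, ∃ δ > 0, ∀ x, 0 < x → x < δ → |φ x| ≤ ε := by
    intro ε hε
    have : ∀ᶠ x in 𝓝[>] (0:ℝ), |φ x| < ε := by
      have := h0.eventually (Metric.ball_mem_nhds (0:ℝ) hε)
      filter_upwards [this] with x hx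
      simpa using hx
    obtain ⟨δ, hδ, hs⟩ := mem_nhdsGT_iff_exists_Ioo_subset.1 this
    exact ⟨δ, hδ, fun x a b => (hs ⟨a, b⟩).le⟩
  -- main comparison
  have main : ∀ X, 0 < X → X ≤ r → ∀ ε > 0, ∃ δ > 0, ∀ x, 0 < x → x < δ →
      ∃ n : ℝ, 0 < n ∧ n * x ≤ X ∧ X - x ≤ n * x ∧ |φ X - n * φ x| ≤ 5 * C * X ^ 2 + ε := by
    intro X hX hXr ε hε
    obtain ⟨δ, hδ, hs⟩ := hsmall ε hε
    refine ⟨min δ X, by positivity, fun x hx hxd => ?_⟩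
    have hxX : x < X := hxd.trans_le (min_le_right _ _)
    set n := ⌊X / x⌋₊ with hn
    have n1 : 1 ≤ n := Nat.le_floor (by rw [le_div_iff₀ hx]; simpa using hxX.le)
    have a1 : (n:ℝ) * x ≤ X := by
      have := Nat.floor_le (show 0 ≤ X / x by positivity)
      rwa [le_div_iff₀ hx] at this
    have a2 : X < (n + 1) * x := by
      have := Nat.lt_floor_add_one (X / x)
      rwa [div_lt_iff₀ hx] at this
    have n0 : (0:ℝ) < n := by exact_mod_cast n1
    refine ⟨n, n0, a1, by nlinarith, ?_⟩
    have b1 := quasi_add_nat hC h hx n n1 (a1.trans hXr)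
    have b2 : 3 * C * (n ^ 2 * x ^ 2) ≤ 3 * C * X ^ 2 := by
      rw [← mul_pow]; gcongr
    rcases a1.lt_or_eq with hlt | heq
    · have c1 := h (n * x) (X - n * x) (by positivity) (by linarith) (by linarith)
      rw [show n * x + (X - n * x) = X by ring] at c1
      have c2 := hs (X - n * x) (by linarith) (by
        have := hxd.trans_le (min_le_left δ X); linarith)
      have c3 : C * ((n * x) ^ 2 + (X - n * x) ^ 2) ≤ C * (2 * X ^ 2) := by
        gcongr
        have : 0 ≤ n * x := by positivity
        nlinarith
      have e : φ X - n * φ x = (φ X - φ (n * x) - φ (X - n * x)) + (φ (X - n * x) +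
        (φ (n * x) - n * φ x)) := by ring
      rw [e]
      refine (abs_add_le _ _).trans ((add_le_add_right (abs_add_le _ _) _).trans ?_)
      linarith
    · rw [heq] at b1
      have : 0 ≤ C * X ^ 2 := by positivity
      linarith
  obtain ⟨δ1, hδ1, hs1⟩ := main r hr le_rfl 1 one_pos
  set Q := (|φ r| + 5 * C * r ^ 2 + 1) / (r / 2) with hQ
  have hQ0 : 0 ≤ Q := by positivity
  have hbd : ∀ x, 0 < x → x < min δ1 (r / 2) → |φ x / x| ≤ Q := by
    intro x hx hxd
    obtain ⟨n, n0, n1, n2, n3⟩ := hs1 x hx (hxd.trans_le (min_le_left _ _))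
    have hx2 := hxd.trans_le (min_le_right δ1 (r / 2))
    have : n * |φ x| ≤ |φ r| + 5 * C * r ^ 2 + 1 := by
      have := abs_sub_abs_le_abs_sub (n * φ x) (φ r)
      rw [abs_sub_comm, abs_mul, abs_of_pos n0] at this
      linarith
    rw [abs_div, abs_of_pos hx, div_le_iff₀ hx, hQ]
    have h3 : (r / 2) * |φ x| ≤ (n * x) * |φ x| := by
      gcongr; linarith
    rw [div_mul_eq_mul_div, le_div_iff₀ (by positivity)]
    nlinarith
  have hcau : ∀ ε > 0, ∃ δ > 0, ∃ A : ℝ, ∀ x, 0 < x → x < δ → |φ x / x - A| ≤ ε := by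
    intro ε hε
    set X := min r (ε / (3 * (5 * C + 1))) with hX
    have hX0 : 0 < X := by positivity
    have hXe : 5 * C * X ≤ ε / 3 := by
      have : X ≤ ε / (3 * (5 * C + 1)) := min_le_right _ _
      calc 5 * C * X ≤ (5 * C + 1) * (ε / (3 * (5 * C + 1))) := by gcongr; linarith
        _ = ε / 3 := by field_simp
    obtain ⟨δ, hδ, hs⟩ := main X hX0 (min_le_left _ _) (ε / 3 * X) (by positivity)
    refine ⟨min (min δ (min δ1 (r / 2))) (ε * X / (3 * (Q + 1))), by positivity, φ X / X,
      fun x hx hxd => ?_⟩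
    have d1 := hxd.trans_le ((min_le_left _ _).trans (min_le_left _ _))
    have d2 := hxd.trans_le ((min_le_left _ _).trans (min_le_right _ _))
    have d3 := hxd.trans_le (min_le_right _ _)
    obtain ⟨n, n0, n1, n2, n3⟩ := hs x hx d1
    have q := hbd x hx d2
    have e : φ x / x - φ X / X = ((X - n * x) * (φ x / x) - (φ X - n * φ x)) / X := by
      field_simp; ring
    rw [e, abs_div, abs_of_pos hX0, div_le_iff₀ hX0]
    refine (abs_sub _ _).trans ?_
    rw [abs_mul, abs_of_nonneg (by linarith : 0 ≤ X - n * x)]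
    have : (X - n * x) * |φ x / x| ≤ x * Q := by gcongr; linarith
    have h4 : x * Q ≤ ε / 3 * X := by
      rw [lt_div_iff₀ (by positivity)] at d3
      nlinarith
    nlinarith
  have : Cauchy (map (fun x => φ x / x) (𝓝[>] 0)) := by
    rw [Metric.cauchy_iff]
    refine ⟨inferInstance, fun ε hε => ?_⟩
    obtain ⟨δ, hδ, A, hA⟩ := hcau (ε / 3) (by positivity)
    refine ⟨(fun x => φ x / x) '' Ioo 0 δ, image_mem_map (Ioo_mem_nhdsGT hδ), ?_⟩
    rintro _ ⟨x, hx, rfl⟩ _ ⟨y, hy, rfl⟩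
    have h1 := hA x hx.1 hx.2
    have h2 := hA y hy.1 hy.2
    rw [Real.dist_eq]
    have := abs_sub_le (φ x / x) A (φ y / y)
    rw [abs_sub_comm A] at this
    linarith
  exact cauchy_map_iff_exists_tendsto.1 this
end

noncomputable section

lemma LocSol.affine {d : ℝ} {f : ℝ → ℝ → ℝ → ℝ} {u : ℝ → ℝ → ℝ} {t z : ℝ}
    (h : LocSol d f u t z) (b κ q0 : ℝ) (e : b + κ * q0 = z) :
    (∀ᶠ q in 𝓝 q0, HasDerivAt (fun q => u t (b + κ * q)) (κ * deriv (u t) (b + κ * q)) q) ∧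
    HasDerivAt (fun q => κ * deriv (u t) (b + κ * q)) (κ * (κ * deriv (deriv (u t)) z)) q0 := by
  subst e
  have haff : ∀ q, HasDerivAt (fun q => b + κ * q) κ q := fun q => by
    simpa using ((hasDerivAt_id q).const_mul κ).const_add b
  constructor
  · have hc : Tendsto (fun q => b + κ * q) (𝓝 q0) (𝓝 (b + κ * q0)) :=
      (haff q0).continuousAt.tendsto
    filter_upwards [hc.eventually h.1] with q hq
    have := hq.hasDerivAt.comp q (haff q)
    refine this.congr_deriv (by ring)
  · have := (h.2.1.hasDerivAt.comp q0 (haff q0)).const_mul κ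
    refine this.congr_deriv (by ring)

set_option maxHeartbeats 1000000 in
lemma flat_diff {d B M T t0 a X : ℝ} (hd : 0 < d) (hT : T < t0) (hX : a < X)
    {f : ℝ → ℝ → ℝ → ℝ} {u : ℝ → ℝ → ℝ}
    (hc : ContinuousOn (fun q : ℝ × ℝ => u q.1 q.2) (Icc T t0 ×ˢ Icc a X))
    (h0 : ∀ t ∈ Icc T t0, u t a = 0) (hb : ∀ t ∈ Icc T t0, ∀ x ∈ Icc a X, |u t x| ≤ M)
    (hsol : ∀ t ∈ Ioc T t0, ∀ x ∈ Ioo a X, LocSol d f u t x ∧ |f t x (u t x)| ≤ B) :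
    ∃ D, Tendsto (fun y => u t0 (a + y) / y) (𝓝[>] 0) (𝓝 D) := by
  have hM : 0 ≤ M := (abs_nonneg _).trans (hb t0 ⟨hT.le, le_rfl⟩ a ⟨le_rfl, hX.le⟩)
  set r := (X - a) / 2 with hr
  have hr0 : 0 < r := by rw [hr]; linarith
  set P := 3 * M / (t0 - T) with hP
  have htT : 0 < t0 - T := by linarith
  have hP0 : 0 ≤ P := by positivity
  set A := 6 * M / r ^ 2 with hA
  have hA0 : 0 ≤ A := by positivity
  set N := 4 * A + (3 * |B| + P + 1) / d with hN
  have hN0 : 0 ≤ N := by positivity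
  set W : ℝ → ℝ × ℝ → ℝ := fun t z => u t (a + z.1 + z.2) - u t (a + z.1) - u t (a + z.2) with hW
  set K : Set (ℝ × (ℝ × ℝ)) :=
    Icc T t0 ×ˢ {z : ℝ × ℝ | 0 ≤ z.1 ∧ 0 ≤ z.2 ∧ z.1 + z.2 ≤ r} with hKdef
  have hKc : IsCompact K := by
    apply isCompact_Icc.prod
    have hsub : {z : ℝ × ℝ | 0 ≤ z.1 ∧ 0 ≤ z.2 ∧ z.1 + z.2 ≤ r} ⊆ Icc 0 r ×ˢ Icc 0 r := by
      rintro ⟨x, y⟩ ⟨h1, h2, h3⟩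
      simp only at h1 h2 h3
      exact ⟨⟨h1, by linarith⟩, ⟨h2, by linarith⟩⟩
    refine (isCompact_Icc.prod isCompact_Icc).of_isClosed_subset ?_ hsub
    exact (isClosed_le continuous_const continuous_fst).inter
      ((isClosed_le continuous_const continuous_snd).inter
        (isClosed_le (continuous_fst.add continuous_snd) continuous_const))
  have hWc : ContinuousOn (fun q : ℝ × (ℝ × ℝ) => W q.1 q.2) K := by
    have k : ∀ g : ℝ × ℝ → ℝ, Continuous g →
        (∀ z : ℝ × ℝ, 0 ≤ z.1 ∧ 0 ≤ z.2 ∧ z.1 + z.2 ≤ r → g z ∈ Icc a X) →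
        ContinuousOn (fun q : ℝ × (ℝ × ℝ) => u q.1 (g q.2)) K := by
      intro g hg hm
      have e : (fun q : ℝ × (ℝ × ℝ) => u q.1 (g q.2)) =
        (fun q : ℝ × ℝ => u q.1 q.2) ∘ (fun q : ℝ × (ℝ × ℝ) => (q.1, g q.2)) := rfl
      rw [e]
      apply hc.comp (by fun_prop)
      rintro ⟨t, z⟩ hq
      exact ⟨hq.1, hm z hq.2⟩
    refine ((k (fun z => a + z.1 + z.2) (by fun_prop) ?_).sub
      (k (fun z => a + z.1) (by fun_prop) ?_)).sub (k (fun z => a + z.2) (by fun_prop) ?_) <;>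
    · rintro ⟨x, y⟩ ⟨h1, h2, h3⟩
      simp only at h1 h2 h3 ⊢
      constructor <;> linarith
  have key : ∀ s : ℝ, (s = 1 ∨ s = -1) → ∀ ε > 0, ∀ t z, (t, z) ∈ K →
      0 < s * W t z + (A * (z.1 ^ 2 + z.2 ^ 2) + N * (z.1 * z.2) + P * (t0 - t) + ε) := by
    intro s hs ε hε
    have hs1 : |s| = 1 := by rcases hs with h | h <;> rw [h] <;> simp
    apply master hKc (h := fun t z => s * W t z +
      (A * (z.1 ^ 2 + z.2 ^ 2) + N * (z.1 * z.2) + P * (t0 - t) + ε))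
    · apply (hWc.const_smul s).add
      fun_prop
    · rintro t ⟨x, y⟩ ⟨ht, hx0, hy0, hxy⟩ hle
      simp only at hx0 hy0 hxy hle ht
      have hW3 : |W t (x, y)| ≤ 3 * M := by
        have b1 := hb t ht (a + x + y) ⟨by linarith, by linarith⟩
        have b2 := hb t ht (a + x) ⟨by linarith, by linarith⟩
        have b3 := hb t ht (a + y) ⟨by linarith, by linarith⟩
        simp only [hW]
        have c1 := abs_sub (u t (a + x + y) - u t (a + x)) (u t (a + y))
        have c2 := abs_sub (u t (a + x + y)) (u t (a + x))
        linarith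
      have hsW : -(3 * M) ≤ s * W t (x, y) := by
        apply neg_le_of_abs_le; rw [abs_mul, hs1, one_mul]; exact hW3
      have q1 : 0 ≤ A * (x ^ 2 + y ^ 2) := by positivity
      have q2 : 0 ≤ N * (x * y) := by positivity
      have q3 : 0 ≤ P * (t0 - t) := mul_nonneg hP0 (by linarith [ht.2])
      have tT : T < t := by
        rcases ht.1.lt_or_eq with h | h
        · exact h
        · have : P * (t0 - t) = 3 * M := by rw [← h, hP]; field_simp
          linarith
      have x0 : 0 < x := by
        rcases hx0.lt_or_eq with h | h
        · exact h
        · have : W t (x, y) = 0 := by simp [hW, ← h, h0 t ht]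
          rw [this] at hle; simp at hle; linarith
      have y0 : 0 < y := by
        rcases hy0.lt_or_eq with h | h
        · exact h
        · have : W t (x, y) = 0 := by simp [hW, ← h, h0 t ht]
          rw [this] at hle; simp at hle; linarith
      have xyr : x + y < r := by
        rcases hxy.lt_or_eq with h | h
        · exact h
        · have : 3 * M ≤ A * (x ^ 2 + y ^ 2) := by
            have : r ^ 2 ≤ 2 * (x ^ 2 + y ^ 2) := by rw [← h]; nlinarith [sq_nonneg (x - y)]
            calc 3 * M = A * (r ^ 2 / 2) := by rw [hA]; field_simp; ring
              _ ≤ _ := by gcongr; linarith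
          linarith
      have hnb : ∀ᶠ z : ℝ × ℝ in 𝓝 (x, y), 0 ≤ z.1 ∧ 0 ≤ z.2 ∧ z.1 + z.2 ≤ r := by
        have e1 : ∀ᶠ z : ℝ × ℝ in 𝓝 (x, y), 0 < z.1 :=
          continuous_fst.continuousAt.eventually (lt_mem_nhds x0)
        have e2 : ∀ᶠ z : ℝ × ℝ in 𝓝 (x, y), 0 < z.2 :=
          continuous_snd.continuousAt.eventually (lt_mem_nhds y0)
        have e3 : ∀ᶠ z : ℝ × ℝ in 𝓝 (x, y), z.1 + z.2 < r :=
          (show Continuous fun z : ℝ × ℝ => z.1 + z.2 by fun_prop).continuousAt.eventually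
            (gt_mem_nhds xyr)
        filter_upwards [e1, e2, e3] with z a b c using ⟨a.le, b.le, c.le⟩
      refine ⟨hnb.mono fun z hz => ⟨ht, hz⟩, ?_, ?_⟩
      · filter_upwards [Ioo_mem_nhdsLT tT] with q hq
        exact ⟨⟨hq.1.le, hq.2.le.trans ht.2⟩, hx0, hy0, hxy⟩
      intro he hmin hpast
      simp only at he hmin hpast
      obtain ⟨l1, f1⟩ := hsol t ⟨tT, ht.2⟩ (a + x + y) ⟨by linarith, by linarith⟩
      obtain ⟨l2, f2⟩ := hsol t ⟨tT, ht.2⟩ (a + x) ⟨by linarith, by linarith⟩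
      obtain ⟨l3, f3⟩ := hsol t ⟨tT, ht.2⟩ (a + y) ⟨by linarith, by linarith⟩
      -- time derivative
      have ht1 := deriv_nonpos_of_past (φ := fun q => s * W q (x, y) +
        (A * (x ^ 2 + y ^ 2) + N * (x * y) + P * (t0 - q) + ε))
        ((((l1.2.2.sub l2.2.2).sub l3.2.2).const_mul s).add
          ((((hasDerivAt_id t).const_sub t0).const_mul P).const_add
            (A * (x ^ 2 + y ^ 2) + N * (x * y)) |>.add_const ε))
        (by simp only [he]; exact hpast.mono fun q hq => hq.le)
      set k1 := deriv (deriv (u t)) (a + x + y)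
      set k2 := deriv (deriv (u t)) (a + x)
      set k3 := deriv (deriv (u t)) (a + y)
      -- direction e1
      have d1 : 0 ≤ s * (1 * (1 * k1) - 1 * (1 * k2)) + 2 * A := by
        obtain ⟨m1, m1'⟩ := l1.affine (a + y) 1 x (by ring)
        obtain ⟨m2, m2'⟩ := l2.affine a 1 x (by ring)
        apply second_deriv_nonneg (x := x) (φ := fun q => s * W t (q, y) +
          (A * (q ^ 2 + y ^ 2) + N * (q * y) + P * (t0 - t) + ε))
          (φ1 := fun q => s * (1 * deriv (u t) (a + y + 1 * q) - 1 * deriv (u t) (a + 1 * q)) +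
            (A * (2 * q) + N * y))
        · filter_upwards [m1, m2] with q c1 c2
          have c3 : HasDerivAt (fun q => A * (q ^ 2 + y ^ 2) + N * (q * y) + P * (t0 - t) + ε)
              (A * (2 * q) + N * y) q := by
            have := (((((hasDerivAt_id q).pow 2).add_const (y ^ 2)).const_mul A).add
              (((hasDerivAt_id q).mul_const y).const_mul N)).add_const (P * (t0 - t)) |>.add_const ε
            refine this.congr_deriv ?_
            simp
          have := (((c1.sub c2).sub_const (u t (a + y))).const_mul s).add c3
          refine this.congr_of_eventuallyEq (Eventually.of_forall fun q => ?_)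
          simp only [hW, Pi.add_apply, Pi.sub_apply]
          rw [show a + y + 1 * q = a + q + y by ring, one_mul]
        · have c3 : HasDerivAt (fun q => A * (2 * q) + N * y) (2 * A) x := by
            have := (((hasDerivAt_id x).const_mul 2).const_mul A).add_const (N * y)
            refine this.congr_deriv ?_
            simp; ring
          exact ((m1'.sub m2').const_mul s).add c3
        · rw [he]
          have : Tendsto (fun q : ℝ => (q, y)) (𝓝 x) (𝓝 (x, y)) :=
            (show Continuous fun q : ℝ => (q, y) by fun_prop).tendsto x
          exact this.eventually hmin
      -- direction e2
      have d2 : 0 ≤ s * (1 * (1 * k1) - 1 * (1 * k3)) + 2 * A := by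
        obtain ⟨m1, m1'⟩ := l1.affine (a + x) 1 y (by ring)
        obtain ⟨m2, m2'⟩ := l3.affine a 1 y (by ring)
        apply second_deriv_nonneg (x := y) (φ := fun q => s * W t (x, q) +
          (A * (x ^ 2 + q ^ 2) + N * (x * q) + P * (t0 - t) + ε))
          (φ1 := fun q => s * (1 * deriv (u t) (a + x + 1 * q) - 1 * deriv (u t) (a + 1 * q)) +
            (A * (2 * q) + N * x))
        · filter_upwards [m1, m2] with q c1 c2
          have c3 : HasDerivAt (fun q => A * (x ^ 2 + q ^ 2) + N * (x * q) + P * (t0 - t) + ε)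
              (A * (2 * q) + N * x) q := by
            have := (((((hasDerivAt_id q).pow 2).const_add (x ^ 2)).const_mul A).add
              (((hasDerivAt_id q).const_mul x).const_mul N)).add_const (P * (t0 - t)) |>.add_const ε
            refine this.congr_deriv ?_
            simp
          have := ((c1.sub_const (u t (a + x))).sub c2).const_mul s |>.add c3
          refine this.congr_of_eventuallyEq (Eventually.of_forall fun q => ?_)
          simp only [hW, Pi.add_apply, Pi.sub_apply]
          rw [show a + x + 1 * q = a + x + q by ring, one_mul]
        · have c3 : HasDerivAt (fun q => A * (2 * q) + N * x) (2 * A) y := by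
            have := (((hasDerivAt_id y).const_mul 2).const_mul A).add_const (N * x)
            refine this.congr_deriv ?_
            simp; ring
          exact ((m1'.sub m2').const_mul s).add c3
        · rw [he]
          have : Tendsto (fun q : ℝ => (x, q)) (𝓝 y) (𝓝 (x, y)) :=
            (show Continuous fun q : ℝ => (x, q) by fun_prop).tendsto y
          exact this.eventually hmin
      -- direction e1 - e2
      have d3 : 0 ≤ s * (-(1 * (1 * k2)) - (-1) * ((-1) * k3)) + (4 * A - 2 * N) := by
        obtain ⟨m1, m1'⟩ := l2.affine (a + x) 1 0 (by ring)
        obtain ⟨m2, m2'⟩ := l3.affine (a + y) (-1) 0 (by ring)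
        apply second_deriv_nonneg (x := (0:ℝ)) (φ := fun q => s * W t (x + q, y - q) +
          (A * ((x + q) ^ 2 + (y - q) ^ 2) + N * ((x + q) * (y - q)) + P * (t0 - t) + ε))
          (φ1 := fun q => s * (-(1 * deriv (u t) (a + x + 1 * q)) -
            (-1) * deriv (u t) (a + y + (-1) * q)) +
            (A * (2 * (x + q) - 2 * (y - q)) + N * (y - x - 2 * q)))
        · filter_upwards [m1, m2] with q c1 c2
          have b1 := (hasDerivAt_id q).const_add x
          have b2 := (hasDerivAt_id q).const_sub y
          have c3 : HasDerivAt (fun q => A * ((x + q) ^ 2 + (y - q) ^ 2) + N * ((x + q) * (y - q))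
              + P * (t0 - t) + ε)
              (A * (2 * (x + q) - 2 * (y - q)) + N * (y - x - 2 * q)) q := by
            have := ((((b1.pow 2).add (b2.pow 2)).const_mul A).add
              ((b1.mul b2).const_mul N)).add_const (P * (t0 - t)) |>.add_const ε
            refine this.congr_deriv ?_
            simp; ring
          have := ((c1.const_sub (u t (a + x + y))).sub c2).const_mul s |>.add c3
          refine this.congr_of_eventuallyEq (Eventually.of_forall fun q => ?_)
          simp only [hW, Pi.add_apply, Pi.sub_apply]
          rw [show a + (x + q) + (y - q) = a + x + y by ring,
            show a + x + 1 * q = a + (x + q) by ring, show a + y + -1 * q = a + (y - q) by ring]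
        · have c3 : HasDerivAt (fun q => A * (2 * (x + q) - 2 * (y - q)) + N * (y - x - 2 * q))
              (4 * A - 2 * N) 0 := by
            have b1 := ((hasDerivAt_id (0:ℝ)).const_add x).const_mul 2
            have b2 := ((hasDerivAt_id (0:ℝ)).const_sub y).const_mul 2
            have := ((b1.sub b2).const_mul A).add
              ((((hasDerivAt_id (0:ℝ)).const_mul 2).const_sub (y - x)).const_mul N)
            refine this.congr_deriv ?_
            simp; ring
          exact ((m1'.neg.sub m2').const_mul s).add c3
        · simp only [add_zero, sub_zero]
          rw [he]
          have : Tendsto (fun q : ℝ => (x + q, y - q)) (𝓝 0) (𝓝 (x, y)) := by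
            have := (show Continuous fun q : ℝ => (x + q, y - q) by fun_prop).tendsto 0
            simpa using this
          exact this.eventually hmin
      set F1 := f t (a + x + y) (u t (a + x + y))
      set F2 := f t (a + x) (u t (a + x))
      set F3 := f t (a + y) (u t (a + y))
      have hF : -(3 * |B|) ≤ s * (F1 - F2 - F3) := by
        apply neg_le_of_abs_le
        rw [abs_mul, hs1, one_mul]
        have c1 := abs_sub (F1 - F2) F3
        have c2 := abs_sub F1 F2
        have := le_abs_self B
        linarith
      have hdN : d * N = 4 * d * A + (3 * |B| + P + 1) := by rw [hN]; field_simp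
      have hdd : 0 ≤ d * (s * (k1 - k2 - k3) + 4 * A - N) := by
        apply mul_nonneg hd.le; linarith
      have e1 : s * (d * k1 + F1 - (d * k2 + F2) - (d * k3 + F3)) =
        d * (s * (k1 - k2 - k3)) + s * (F1 - F2 - F3) := by ring
      simp only [mul_neg, mul_one] at ht1
      linarith
  have hφ : ∀ x y, 0 < x → 0 < y → x + y ≤ r →
      |u t0 (a + (x + y)) - u t0 (a + x) - u t0 (a + y)| ≤ (A + N) * (x ^ 2 + y ^ 2) := by
    intro x y hx hy hxy
    have hmem : (t0, (x, y)) ∈ K := ⟨⟨hT.le, le_rfl⟩, hx.le, hy.le, hxy⟩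
    have hxy2 : N * (x * y) ≤ N * (x ^ 2 + y ^ 2) := by
      gcongr; nlinarith [sq_nonneg (x - y)]
    rw [← add_assoc]
    apply le_of_forall_pos_le_add
    intro ε hε
    have k1 := key 1 (Or.inl rfl) ε hε t0 _ hmem
    have k2 := key (-1) (Or.inr rfl) ε hε t0 _ hmem
    simp only [hW, sub_self, mul_zero, add_zero] at k1 k2
    rw [abs_le]
    constructor <;> linarith
  refine quasi_add (φ := fun y => u t0 (a + y)) hr0 (by positivity) hφ ?_
  have hcw : ContinuousWithinAt (fun q : ℝ × ℝ => u q.1 q.2) (Icc T t0 ×ˢ Icc a X) (t0, a) :=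
    hc _ ⟨⟨hT.le, le_rfl⟩, le_rfl, hX.le⟩
  have : Tendsto (fun y : ℝ => (t0, a + y)) (𝓝[>] 0) (𝓝[Icc T t0 ×ˢ Icc a X] (t0, a)) := by
    apply tendsto_nhdsWithin_of_tendsto_nhds_of_eventually_within
    · have := (show Continuous fun y : ℝ => (t0, a + y) by fun_prop).tendsto 0
      simp only [add_zero] at this
      exact this.mono_left nhdsWithin_le_nhds
    · filter_upwards [Ioo_mem_nhdsGT (show 0 < X - a by linarith)] with y hy
      exact ⟨⟨hT.le, le_rfl⟩, by linarith [hy.1], by linarith [hy.2]⟩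
  have h3 := hcw.tendsto.comp this
  simp only [h0 t0 ⟨hT.le, le_rfl⟩] at h3
  exact h3
end

noncomputable section

/-- the exponential barrier -/
def bar (Λ T x1 a b c η t x : ℝ) : ℝ :=
  (a + b * Real.exp (x - x1) + c * Real.exp (-(x - x1))) * Real.exp (Λ * (t - T))
    - η * Real.exp (-(Λ * (t - T)))

def barx (Λ T x1 b c t x : ℝ) : ℝ :=
  (b * Real.exp (x - x1) - c * Real.exp (-(x - x1))) * Real.exp (Λ * (t - T))

def barxx (Λ T x1 b c t x : ℝ) : ℝ :=
  (b * Real.exp (x - x1) + c * Real.exp (-(x - x1))) * Real.exp (Λ * (t - T))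

def bart (Λ T x1 a b c η t x : ℝ) : ℝ :=
  Λ * ((a + b * Real.exp (x - x1) + c * Real.exp (-(x - x1))) * Real.exp (Λ * (t - T)))
    + Λ * (η * Real.exp (-(Λ * (t - T))))

lemma bar_x (Λ T x1 a b c η t y : ℝ) :
    HasDerivAt (bar Λ T x1 a b c η t) (barx Λ T x1 b c t y) y := by
  unfold bar barx
  have h1 : HasDerivAt (fun y => Real.exp (y - x1)) (Real.exp (y - x1)) y := by
    simpa using ((hasDerivAt_id y).sub_const x1).exp
  have h2 : HasDerivAt (fun y => Real.exp (-(y - x1))) (-Real.exp (-(y - x1))) y := by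
    simpa using (((hasDerivAt_id y).sub_const x1).fun_neg).exp
  have := ((((h1.const_mul b).const_add a).add (h2.const_mul c)).mul_const
    (Real.exp (Λ * (t - T)))).sub_const (η * Real.exp (-(Λ * (t - T))))
  refine (this.congr_of_eventuallyEq (Eventually.of_forall fun q => ?_)).congr_deriv ?_
  · simp
  · ring

lemma bar_xx (Λ T x1 b c t y : ℝ) :
    HasDerivAt (barx Λ T x1 b c t) (barxx Λ T x1 b c t y) y := by
  unfold barx barxx
  have h1 : HasDerivAt (fun y => Real.exp (y - x1)) (Real.exp (y - x1)) y := by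
    simpa using ((hasDerivAt_id y).sub_const x1).exp
  have h2 : HasDerivAt (fun y => Real.exp (-(y - x1))) (-Real.exp (-(y - x1))) y := by
    simpa using (((hasDerivAt_id y).sub_const x1).fun_neg).exp
  have := (((h1.const_mul b)).sub (h2.const_mul c)).mul_const (Real.exp (Λ * (t - T)))
  refine (this.congr_of_eventuallyEq (Eventually.of_forall fun q => ?_)).congr_deriv ?_
  · simp
  · ring

lemma bar_t (Λ T x1 a b c η t x : ℝ) :
    HasDerivAt (fun s => bar Λ T x1 a b c η s x) (bart Λ T x1 a b c η t x) t := by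
  unfold bar bart
  have h1 : HasDerivAt (fun s => Real.exp (Λ * (s - T))) (Real.exp (Λ * (t - T)) * Λ) t := by
    simpa using (((hasDerivAt_id t).sub_const T).const_mul Λ).exp
  have h2 : HasDerivAt (fun s => Real.exp (-(Λ * (s - T)))) (Real.exp (-(Λ * (t - T))) * (-Λ)) t := by
    simpa using ((((hasDerivAt_id t).sub_const T).const_mul Λ).fun_neg).exp
  have := (h1.const_mul (a + b * Real.exp (x - x1) + c * Real.exp (-(x - x1)))).sub (h2.const_mul η)
  refine (this.congr_of_eventuallyEq (Eventually.of_forall fun q => ?_)).congr_deriv ?_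
  · simp
  · ring

lemma bar_cont (Λ T x1 a b c η : ℝ) :
    Continuous (fun q : ℝ × ℝ => bar Λ T x1 a b c η q.1 q.2) := by
  unfold bar; fun_prop

lemma bar_ineq {d K Λ T x1 a b c η t x : ℝ} (hd : 0 < d) (hK : 0 ≤ K) (hΛ : Λ = K + d + 1)
    (ha : 0 ≤ a) (hb : 0 ≤ b) (hc : 0 ≤ c) (hη : 0 ≤ η) (hpos : 0 < a + b + c + η) :
    K * |bar Λ T x1 a b c η t x| < bart Λ T x1 a b c η t x - d * barxx Λ T x1 b c t x := by
  unfold bar bart barxx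
  set e1 := Real.exp (x - x1)
  set e2 := Real.exp (-(x - x1))
  set e3 := Real.exp (Λ * (t - T))
  set e4 := Real.exp (-(Λ * (t - T)))
  have p1 : 0 < e1 := Real.exp_pos _
  have p2 : 0 < e2 := Real.exp_pos _
  have p3 : 0 < e3 := Real.exp_pos _
  have p4 : 0 < e4 := Real.exp_pos _
  have h1 : |(a + b * e1 + c * e2) * e3 - η * e4| ≤ (a + b * e1 + c * e2) * e3 + η * e4 := by
    rw [abs_le]
    have : 0 ≤ (a + b * e1 + c * e2) * e3 := by positivity
    have : 0 ≤ η * e4 := by positivity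
    constructor <;> linarith
  have h2 := mul_le_mul_of_nonneg_left h1 hK
  have h3 : 0 ≤ d * (a * e3) := by positivity
  have h4 : 0 ≤ d * (η * e4) := by positivity
  have h5 : 0 < (a + b * e1 + c * e2) * e3 + η * e4 := by
    rcases ha.lt_or_eq with h | h
    · positivity
    rcases hb.lt_or_eq with h' | h'
    · positivity
    rcases hc.lt_or_eq with h'' | h''
    · positivity
    have : 0 < η := by linarith
    positivity
  subst hΛ
  linarith [h2, h3, h4, h5]

lemma bar_eps (Λ T x1 a b c η t x : ℝ) : bar Λ T x1 a b c η t x =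
    bar Λ T x1 a 0 c η t x + b * Real.exp (x - x1) * Real.exp (Λ * (t - T)) := by
  unfold bar; ring

lemma bar_eps' (Λ T x1 a a' c η t x : ℝ) : bar Λ T x1 (a + a') 0 c η t x =
    bar Λ T x1 a 0 c η t x + a' * Real.exp (Λ * (t - T)) := by
  unfold bar; ring

lemma bar_strip {d K Λ T T' x1 a c η : ℝ} (hd : 0 < d) (hK : 0 ≤ K) (hΛ : Λ = K + d + 1)
    (ha : 0 ≤ a) (hc : 0 ≤ c) (hη : 0 ≤ η)
    {f : ℝ → ℝ → ℝ → ℝ} {u v : ℝ → ℝ → ℝ} {γ₁ γ₂ : ℝ → ℝ}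
    (h1 : ContinuousOn γ₁ (Icc T T')) (h2 : ContinuousOn γ₂ (Icc T T'))
    (hcont : ContinuousOn (fun q : ℝ × ℝ => u q.1 q.2 - v q.1 q.2)
      {q : ℝ × ℝ | q.1 ∈ Icc T T' ∧ γ₁ q.1 ≤ q.2 ∧ q.2 ≤ γ₂ q.1})
    (hbd : ∀ t ∈ Icc T T', ∀ x, γ₁ t ≤ x → x ≤ γ₂ t → (t = T ∨ x = γ₁ t ∨ x = γ₂ t) →
      0 ≤ u t x - v t x + bar Λ T x1 a 0 c η t x)
    (H : ∀ t ∈ Ioc T T', ∀ x, γ₁ t < x → x < γ₂ t → u t x - v t x + bar Λ T x1 a 0 c η t x < 0 →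
      LocSol d f u t x ∧ LocSol d f v t x ∧
      |f t x (u t x) - f t x (v t x)| ≤ K * |u t x - v t x|) :
    ∀ t ∈ Icc T T', ∀ x, γ₁ t ≤ x → x ≤ γ₂ t → 0 ≤ u t x - v t x + bar Λ T x1 a 0 c η t x := by
  have key : ∀ ε > 0, ∀ t ∈ Icc T T', ∀ x, γ₁ t ≤ x → x ≤ γ₂ t →
      0 < u t x - v t x + bar Λ T x1 (a + ε) 0 c η t x := by
    intro ε hε
    apply comp_strip (K := K) (f := f) hd h1 h2 (E := bar Λ T x1 (a + ε) 0 c η)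
      (Ex := barx Λ T x1 0 c) (Exx := barxx Λ T x1 0 c) (Et := bart Λ T x1 (a + ε) 0 c η)
    · exact hcont.add (bar_cont _ _ _ _ _ _ _).continuousOn
    · intro t y; exact bar_x _ _ _ _ _ _ _ _ _
    · intro t y; exact bar_xx _ _ _ _ _ _ _
    · intro t ht x hx1 hx2 hle
      have he : 0 < ε * Real.exp (Λ * (t - T)) := by positivity
      have hlt : u t x - v t x + bar Λ T x1 a 0 c η t x < 0 := by
        rw [bar_eps'] at hle; linarith
      have hn : ¬ (t = T ∨ x = γ₁ t ∨ x = γ₂ t) := fun h => by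
        have := hbd t ht x hx1 hx2 h; linarith
      push Not at hn
      have k1 : T < t := lt_of_le_of_ne ht.1 (Ne.symm hn.1)
      have k2 : γ₁ t < x := lt_of_le_of_ne hx1 (Ne.symm hn.2.1)
      have k3 : x < γ₂ t := lt_of_le_of_ne hx2 hn.2.2
      refine ⟨k1, k2, k3, bar_t _ _ _ _ _ _ _ _ _, fun _ => ?_⟩
      obtain ⟨b1, b2, b3⟩ := H t ⟨k1, ht.2⟩ x k2 k3 hlt
      exact ⟨b1, b2, b3, bar_ineq hd hK hΛ (by linarith) le_rfl hc hη (by linarith)⟩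
  intro t ht x hx1 hx2
  by_contra! hn
  set q := u t x - v t x + bar Λ T x1 a 0 c η t x with hq
  have := key (-q / Real.exp (Λ * (t - T))) (div_pos (by linarith) (Real.exp_pos _)) t ht x hx1 hx2
  rw [bar_eps', div_mul_cancel₀ _ (Real.exp_pos _).ne'] at this
  linarith

lemma bar_right {d K Λ T T' x1 a c η C : ℝ} (hd : 0 < d) (hK : 0 ≤ K) (hΛ : Λ = K + d + 1)
    (ha : 0 ≤ a) (hc : 0 ≤ c) (hη : 0 ≤ η)
    {f : ℝ → ℝ → ℝ → ℝ} {u v : ℝ → ℝ → ℝ} {γ : ℝ → ℝ}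
    (h1 : ContinuousOn γ (Icc T T'))
    (hcont : ContinuousOn (fun q : ℝ × ℝ => u q.1 q.2 - v q.1 q.2)
      {q : ℝ × ℝ | q.1 ∈ Icc T T' ∧ γ q.1 ≤ q.2})
    (hC : ∀ t ∈ Icc T T', ∀ x, γ t ≤ x → -C ≤ u t x - v t x)
    (hbd : ∀ t ∈ Icc T T', ∀ x, γ t ≤ x → (t = T ∨ x = γ t) →
      0 ≤ u t x - v t x + bar Λ T x1 a 0 c η t x)
    (H : ∀ t ∈ Ioc T T', ∀ x, γ t < x → u t x - v t x + bar Λ T x1 a 0 c η t x < 0 →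
      LocSol d f u t x ∧ LocSol d f v t x ∧
      |f t x (u t x) - f t x (v t x)| ≤ K * |u t x - v t x|) :
    ∀ t ∈ Icc T T', ∀ x, γ t ≤ x → 0 ≤ u t x - v t x + bar Λ T x1 a 0 c η t x := by
  have hΛ0 : 0 < Λ := by rw [hΛ]; positivity
  have key : ∀ ε > 0, ∀ t ∈ Icc T T', ∀ x, γ t ≤ x →
      0 < u t x - v t x + bar Λ T x1 a ε c η t x := by
    intro ε hε
    apply comp_right (K := K) (f := f) hd h1 (E := bar Λ T x1 a ε c η)
      (Ex := barx Λ T x1 ε c) (Exx := barxx Λ T x1 ε c) (Et := bart Λ T x1 a ε c η)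
      (X := x1 + (|C| + η + 1) / ε)
    · exact hcont.add (bar_cont _ _ _ _ _ _ _).continuousOn
    · intro t y; exact bar_x _ _ _ _ _ _ _ _ _
    · intro t y; exact bar_xx _ _ _ _ _ _ _
    · intro t ht x hx hxg
      have h3 := hC t ht x hxg
      have e1 : (|C| + η + 1) / ε ≤ Real.exp (x - x1) := by
        have := Real.add_one_le_exp (x - x1); linarith
      have e1' : |C| + η + 1 ≤ ε * Real.exp (x - x1) := by
        rw [div_le_iff₀ hε] at e1; linarith
      have e2 : 1 ≤ Real.exp (Λ * (t - T)) := Real.one_le_exp (by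
        have := ht.1; exact mul_nonneg hΛ0.le (by linarith))
      have e3 : Real.exp (-(Λ * (t - T))) ≤ 1 := Real.exp_le_one_iff.2 (by
        have := ht.1; have := mul_nonneg hΛ0.le (sub_nonneg.2 this); linarith)
      unfold bar
      have k0 : 0 ≤ c * Real.exp (-(x - x1)) := by positivity
      have k1 : (|C| + η + 1) * 1 ≤ (a + ε * Real.exp (x - x1) + c * Real.exp (-(x - x1))) *
          Real.exp (Λ * (t - T)) := by
        apply mul_le_mul _ e2 zero_le_one (by positivity)
        linarith
      have k2 : η * Real.exp (-(Λ * (t - T))) ≤ η * 1 := by gcongr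
      have := le_abs_self C
      linarith
    · intro t ht x hx1 hle
      have he : 0 < ε * Real.exp (x - x1) * Real.exp (Λ * (t - T)) := by positivity
      have hlt : u t x - v t x + bar Λ T x1 a 0 c η t x < 0 := by
        rw [bar_eps] at hle; linarith
      have hn : ¬ (t = T ∨ x = γ t) := fun h => by
        have := hbd t ht x hx1 h; linarith
      push Not at hn
      have k1 : T < t := lt_of_le_of_ne ht.1 (Ne.symm hn.1)
      have k2 : γ t < x := lt_of_le_of_ne hx1 (Ne.symm hn.2)
      refine ⟨k1, k2, bar_t _ _ _ _ _ _ _ _ _, fun _ => ?_⟩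
      obtain ⟨b1, b2, b3⟩ := H t ⟨k1, ht.2⟩ x k2 hlt
      exact ⟨b1, b2, b3, bar_ineq hd hK hΛ ha hε.le hc hη (by linarith)⟩
  intro t ht x hx1
  by_contra! hn
  set q := u t x - v t x + bar Λ T x1 a 0 c η t x with hq
  have hp : 0 < Real.exp (x - x1) * Real.exp (Λ * (t - T)) := by positivity
  have := key (-q / (Real.exp (x - x1) * Real.exp (Λ * (t - T)))) (div_pos (by linarith) hp) t ht x hx1
  rw [bar_eps, mul_assoc, div_mul_cancel₀ _ hp.ne'] at this
  linarith
end

noncomputable section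

lemma bar_strip' {d K Λ T T' x1 a b c η : ℝ} (hd : 0 < d) (hK : 0 ≤ K) (hΛ : Λ = K + d + 1)
    (ha : 0 ≤ a) (hb : 0 ≤ b) (hc : 0 ≤ c) (hη : 0 ≤ η) (hpos : 0 < a + b + c + η)
    {f : ℝ → ℝ → ℝ → ℝ} {u v : ℝ → ℝ → ℝ} {γ₁ γ₂ : ℝ → ℝ}
    (h1 : ContinuousOn γ₁ (Icc T T')) (h2 : ContinuousOn γ₂ (Icc T T'))
    (hcont : ContinuousOn (fun q : ℝ × ℝ => u q.1 q.2 - v q.1 q.2)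
      {q : ℝ × ℝ | q.1 ∈ Icc T T' ∧ γ₁ q.1 ≤ q.2 ∧ q.2 ≤ γ₂ q.1})
    (hbd : ∀ t ∈ Icc T T', ∀ x, γ₁ t ≤ x → x ≤ γ₂ t → (t = T ∨ x = γ₁ t ∨ x = γ₂ t) →
      0 < u t x - v t x + bar Λ T x1 a b c η t x)
    (H : ∀ t ∈ Ioc T T', ∀ x, γ₁ t < x → x < γ₂ t → u t x - v t x + bar Λ T x1 a b c η t x = 0 →
      LocSol d f u t x ∧ LocSol d f v t x ∧
      |f t x (u t x) - f t x (v t x)| ≤ K * |u t x - v t x|) :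
    ∀ t ∈ Icc T T', ∀ x, γ₁ t ≤ x → x ≤ γ₂ t → 0 < u t x - v t x + bar Λ T x1 a b c η t x := by
  apply comp_strip (K := K) (f := f) hd h1 h2 (E := bar Λ T x1 a b c η)
    (Ex := barx Λ T x1 b c) (Exx := barxx Λ T x1 b c) (Et := bart Λ T x1 a b c η)
  · exact hcont.add (bar_cont _ _ _ _ _ _ _).continuousOn
  · intro t y; exact bar_x _ _ _ _ _ _ _ _ _
  · intro t y; exact bar_xx _ _ _ _ _ _ _
  · intro t ht x hx1 hx2 hle
    have hn : ¬ (t = T ∨ x = γ₁ t ∨ x = γ₂ t) := fun h => by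
      have := hbd t ht x hx1 hx2 h; linarith
    push Not at hn
    have k1 : T < t := lt_of_le_of_ne ht.1 (Ne.symm hn.1)
    have k2 : γ₁ t < x := lt_of_le_of_ne hx1 (Ne.symm hn.2.1)
    have k3 : x < γ₂ t := lt_of_le_of_ne hx2 hn.2.2
    refine ⟨k1, k2, k3, bar_t _ _ _ _ _ _ _ _ _, fun h0 => ?_⟩
    obtain ⟨b1, b2, b3⟩ := H t ⟨k1, ht.2⟩ x k2 k3 h0
    exact ⟨b1, b2, b3, bar_ineq hd hK hΛ ha hb hc hη hpos⟩

/-- working form of a solution of the free boundary problem -/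
structure FB (d μ M K : ℝ) (f : ℝ → ℝ → ℝ → ℝ) (u : ℝ → ℝ → ℝ) (g : ℝ → ℝ) : Prop where
  hd : 0 < d
  hμ : 0 < μ
  hK : 0 < K
  hM : 0 < M
  zero : ∀ t x, f t x 0 = 0
  lip : ∀ t x a b, 0 ≤ a → a ≤ M → 0 ≤ b → b ≤ M → |f t x a - f t x b| ≤ K * |a - b|
  gc : ContinuousOn g (Ici 0)
  uc : ContinuousOn (fun q : ℝ × ℝ => u q.1 q.2) {q : ℝ × ℝ | 0 ≤ q.1 ∧ g q.1 ≤ q.2}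
  bc : ∀ t ≥ 0, u t (g t) = 0
  le : ∀ t ≥ 0, ∀ x, |u t x| ≤ M
  sol : ∀ t > 0, ∀ x, g t < x → LocSol d f u t x
  st : ∀ t > 0, HasDerivAt g (-μ * derivWithin (u t) (Ici (g t)) (g t)) t
  gc1 : ContinuousOn (fun t => -μ * derivWithin (u t) (Ici (g t)) (g t)) (Ioi 0)
  ext : ∀ t ≥ 0, ∀ x, x < g t → u t x = 0

variable {d μ M K : ℝ} {f : ℝ → ℝ → ℝ → ℝ} {u : ℝ → ℝ → ℝ} {g : ℝ → ℝ}

lemma FB.cont_line (h : FB d μ M K f u g) {x : ℝ} {S : Set ℝ} (hS : ∀ t ∈ S, 0 ≤ t ∧ g t ≤ x) :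
    ContinuousOn (fun t => u t x) S :=
  h.uc.comp (f := fun t => ((t, x) : ℝ × ℝ)) (by fun_prop) hS

lemma FB.cont_slice (h : FB d μ M K f u g) {t : ℝ} (ht : 0 ≤ t) :
    ContinuousOn (u t) (Ici (g t)) :=
  h.uc.comp (f := fun x => ((t, x) : ℝ × ℝ)) (by fun_prop) (fun _ hx => ⟨ht, hx⟩)

lemma FB.lip0 (h : FB d μ M K f u g) {t x : ℝ} (ht : 0 ≤ t) (hu : 0 ≤ u t x) :
    |f t x (u t x) - f t x 0| ≤ K * |u t x - 0| :=
  h.lip t x _ _ hu (abs_le.1 (h.le t ht x)).2 le_rfl h.hM.le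

lemma FB.rect (h : FB d μ M K f u g) {s t a X : ℝ} (hs : 0 ≤ s)
    (hg : ∀ τ ∈ Icc s t, g τ ≤ a) (h1 : ∀ τ ∈ Icc s t, 0 < u τ a) (h2 : ∀ τ ∈ Icc s t, 0 < u τ X)
    (haX : a ≤ X) (hb : ∀ x ∈ Icc a X, 0 < u s x) :
    ∀ τ ∈ Icc s t, ∀ x ∈ Icc a X, 0 < u τ x := by
  intro τ0 hτ0 x0 hx0
  have hst : s ≤ t := hτ0.1.trans hτ0.2
  obtain ⟨η1, hη1, k1⟩ := (isCompact_Icc (a := s) (b := t)).exists_forall_le'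
    (h.cont_line (x := a) fun τ hτ => ⟨hs.trans hτ.1, hg τ hτ⟩) h1
  obtain ⟨η2, hη2, k2⟩ := (isCompact_Icc (a := s) (b := t)).exists_forall_le'
    (h.cont_line (x := X) fun τ hτ => ⟨hs.trans hτ.1, (hg τ hτ).trans haX⟩) h2
  obtain ⟨η3, hη3, k3⟩ := (isCompact_Icc (a := a) (b := X)).exists_forall_le'
    ((h.cont_slice hs).mono fun x hx => (hg s ⟨le_rfl, hst⟩).trans hx.1) hb
  set η := min η1 (min η2 η3) / 2 with hη
  have hm1 : min η1 (min η2 η3) ≤ η1 := min_le_left _ _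
  have hm2 : min η1 (min η2 η3) ≤ η2 := (min_le_right _ _).trans (min_le_left _ _)
  have hm3 : min η1 (min η2 η3) ≤ η3 := (min_le_right _ _).trans (min_le_right _ _)
  have hm0 : 0 < min η1 (min η2 η3) := lt_min hη1 (lt_min hη2 hη3)
  have hη0 : 0 < η := by positivity
  have hd := h.hd
  have hK := h.hK
  have hΛ0 : 0 < K + d + 1 := by positivity
  have e3 : ∀ τ ∈ Icc s t, η * Real.exp (-((K + d + 1) * (τ - s))) ≤ η := by
    intro τ hτ
    have : Real.exp (-((K + d + 1) * (τ - s))) ≤ 1 := Real.exp_le_one_iff.2 (by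
      have := mul_nonneg hΛ0.le (sub_nonneg.2 hτ.1); linarith)
    nlinarith
  have := bar_strip' (u := u) (v := fun _ _ => 0) (f := f) (T := s) (T' := t) (x1 := 0) (a := 0)
    (b := 0) (c := 0) (η := η)
    (γ₁ := fun _ => a) (γ₂ := fun _ => X) hd hK.le rfl le_rfl le_rfl le_rfl hη0.le (by linarith)
    continuousOn_const continuousOn_const ?_ ?_ ?_ τ0 hτ0 x0 hx0.1 hx0.2
  · simp only [bar] at this
    have : 0 < η * Real.exp (-((K + d + 1) * (τ0 - s))) := by positivity
    linarith
  · simp only [sub_zero]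
    exact h.uc.mono fun q hq => ⟨hs.trans hq.1.1, (hg _ hq.1).trans hq.2.1⟩
  · intro τ hτ x hx1 hx2 hor
    have := e3 τ hτ
    simp only [bar]
    have hu : 2 * η ≤ u τ x := by
      rcases hor with h' | h' | h'
      · subst h'; have := k3 x ⟨hx1, hx2⟩; linarith
      · subst h'; have := k1 τ hτ; linarith
      · subst h'; have := k2 τ hτ; linarith
    linarith
  · intro τ hτ x hx1 hx2 h0
    have hp : 0 < η * Real.exp (-((K + d + 1) * (τ - s))) := by positivity
    simp only [bar] at h0
    have hτ0 : 0 < τ := lt_of_le_of_lt hs hτ.1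
    exact ⟨h.sol τ hτ0 x (lt_of_le_of_lt (hg τ ⟨hτ.1.le, hτ.2⟩) hx1), locSol_zero h.zero _ _,
      h.lip0 hτ0.le (by linarith)⟩

/-- left monotonicity: nonpositive points force nonpositivity to their left -/
lemma FB.propV (h : FB d μ M K f u g) {t1 t2 X : ℝ} (ht1 : 0 ≤ t1)
    (hg : ∀ τ ∈ Icc t1 t2, g τ < X) (hX : ∀ τ ∈ Icc t1 t2, 0 < u τ X)
    (hP : ∀ a y, g t1 < a → a < y → y < X → 0 < u t1 a → 0 < u t1 y) :
    ∀ τ ∈ Icc t1 t2, ∀ a y, g τ < a → a < y → y < X → 0 < u τ a → 0 < u τ y := by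
  have hd := h.hd
  have hK := h.hK
  have hgc : ContinuousOn g (Icc t1 t2) := h.gc.mono fun τ hτ => ht1.trans hτ.1
  obtain ⟨C, hC⟩ := (isCompact_Icc (a := t1) (b := t2)).exists_bound_of_continuousOn hgc
  -- the compact set
  set Z : Set (ℝ × ℝ × ℝ) := {q | q.1 ∈ Icc t1 t2 ∧ g q.1 ≤ q.2.1 ∧ q.2.1 ≤ q.2.2 ∧ q.2.2 ≤ X ∧
    u q.1 q.2.2 ≤ 0} with hZ
  have hZc : IsCompact Z := by
    set Y : Set (ℝ × ℝ × ℝ) := {q | q.1 ∈ Icc t1 t2 ∧ g q.1 ≤ q.2.1 ∧ q.2.1 ≤ q.2.2 ∧ q.2.2 ≤ X}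
      with hY
    have hYcl : IsClosed Y := by
      have c1 : ContinuousOn (fun q : ℝ × ℝ × ℝ => q.2.1 - g q.1) (Icc t1 t2 ×ˢ univ) :=
        (by fun_prop : ContinuousOn (fun q : ℝ × ℝ × ℝ => q.2.1) _).sub
          (hgc.comp continuousOn_fst fun q hq => hq.1)
      have k1 := c1.preimage_isClosed_of_isClosed (isClosed_Icc.prod isClosed_univ)
        (isClosed_Ici (a := (0:ℝ)))
      have k2 : IsClosed {q : ℝ × ℝ × ℝ | q.2.1 ≤ q.2.2} := isClosed_le (by fun_prop) (by fun_prop)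
      have k3 : IsClosed {q : ℝ × ℝ × ℝ | q.2.2 ≤ X} := isClosed_le (by fun_prop) (by fun_prop)
      convert (k1.inter k2).inter k3 using 1
      ext q
      simp only [hY, Set.mem_ofPred_eq, mem_inter_iff, mem_prod, mem_univ, mem_preimage, mem_Ici]
      constructor
      · rintro ⟨a, b, c, e⟩; exact ⟨⟨⟨⟨a, trivial⟩, by linarith⟩, c⟩, e⟩
      · rintro ⟨⟨⟨⟨a, -⟩, b⟩, c⟩, e⟩; exact ⟨a, by linarith, c, e⟩
    have hYc : IsCompact Y := by
      refine ((isCompact_Icc (a := t1) (b := t2)).prod ((isCompact_Icc (a := -C) (b := X)).prod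
        (isCompact_Icc (a := -C) (b := X)))).of_isClosed_subset hYcl ?_
      rintro ⟨τ, x, x'⟩ ⟨a, b, c, e⟩
      have := (abs_le.1 (hC τ a)).1
      simp only at b c e
      exact ⟨a, ⟨by simp only; linarith, by simp only; linarith⟩,
        ⟨by simp only; linarith, by simp only; linarith⟩⟩
    have c4 : ContinuousOn (fun q : ℝ × ℝ × ℝ => u q.1 q.2.2) Y :=
      h.uc.comp (f := fun q : ℝ × ℝ × ℝ => ((q.1, q.2.2) : ℝ × ℝ)) (by fun_prop)
        fun q hq => ⟨ht1.trans hq.1.1, hq.2.1.trans hq.2.2.1⟩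
    have : Z = Y ∩ (fun q : ℝ × ℝ × ℝ => u q.1 q.2.2) ⁻¹' Iic 0 := by
      ext q
      simp only [hZ, hY, Set.mem_ofPred_eq, mem_inter_iff, mem_preimage, mem_Iic]
      tauto
    rw [this]
    exact hYc.of_isClosed_subset (c4.preimage_isClosed_of_isClosed hYcl isClosed_Iic)
      inter_subset_left
  set S : Set (ℝ × ℝ) := (fun q : ℝ × ℝ × ℝ => (q.1, q.2.1)) '' Z with hS
  have hSc : IsCompact S := hZc.image (by fun_prop)
  have hSm : ∀ τ x, (τ, x) ∈ S ↔ τ ∈ Icc t1 t2 ∧ g τ ≤ x ∧ ∃ x', x ≤ x' ∧ x' ≤ X ∧ u τ x' ≤ 0 := by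
    intro τ x
    constructor
    · rintro ⟨⟨τ', x', x''⟩, ⟨a, b, c, e, k⟩, heq⟩
      simp only [Prod.mk.injEq] at heq
      obtain ⟨rfl, rfl⟩ := heq
      exact ⟨a, b, x'', c, e, k⟩
    · rintro ⟨a, b, x', c, e, k⟩
      exact ⟨(τ, x, x'), ⟨a, b, c, e, k⟩, rfl⟩
  have key : ∀ ε > 0, ∀ τ x, (τ, x) ∈ S →
      0 < 0 - u τ x + bar (K + d + 1) t1 0 ε 0 0 0 τ x := by
    intro ε hε
    apply comp_compact (K := K) (f := f) (u := fun _ _ => 0) (v := u)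
      (E := bar (K + d + 1) t1 0 ε 0 0 0)
      (Ex := barx (K + d + 1) t1 0 0 0) (Exx := barxx (K + d + 1) t1 0 0 0)
      (Et := bart (K + d + 1) t1 0 ε 0 0 0) hd hSc
    · refine ContinuousOn.add (continuousOn_const.sub ?_) (bar_cont _ _ _ _ _ _ _).continuousOn
      refine h.uc.mono ?_
      rintro ⟨τ, x⟩ hq
      obtain ⟨a, b, -⟩ := (hSm τ x).1 hq
      exact ⟨ht1.trans a.1, b⟩
    · intro t y; exact bar_x _ _ _ _ _ _ _ _ _
    · intro t y; exact bar_xx _ _ _ _ _ _ _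
    · intro τ x hx hle
      obtain ⟨a, b, x', c, e, k⟩ := (hSm τ x).1 hx
      have hup : 0 < u τ x := by
        have : 0 < bar (K + d + 1) t1 0 ε 0 0 0 τ x := by unfold bar; simp; positivity
        linarith
      have b' : g τ < x := lt_of_le_of_ne b fun h' => by
        rw [← h', h.bc τ (ht1.trans a.1)] at hup; exact lt_irrefl _ hup
      have c' : x < x' := lt_of_le_of_ne c fun h' => by rw [← h'] at k; linarith
      have e' : x' < X := lt_of_le_of_ne e fun h' => by rw [h'] at k; linarith [hX τ a]
      have ht : t1 < τ := lt_of_le_of_ne a.1 fun h' => by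
        subst h'; linarith [hP x x' b' c' e' hup]
      have hτ0 : 0 < τ := lt_of_le_of_lt ht1 ht
      refine ⟨?_, ?_, bar_t _ _ _ _ _ _ _ _ _, fun _ => ⟨locSol_zero h.zero _ _, h.sol τ hτ0 x b', ?_,
        bar_ineq hd hK.le rfl hε.le le_rfl le_rfl le_rfl (by linarith)⟩⟩
      · filter_upwards [Ioo_mem_nhds b' c'] with y hy
        exact (hSm τ y).2 ⟨a, hy.1.le, x', hy.2.le, e, k⟩
      · -- past
        have n1 : ∀ᶠ s in 𝓝[<] τ, s ∈ Ioo t1 τ := Ioo_mem_nhdsLT ht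
        have gA : ContinuousAt g τ := h.gc.continuousAt (Ici_mem_nhds hτ0)
        have n2 : ∀ᶠ s in 𝓝 τ, g s < x := gA.eventually (Iio_mem_nhds b')
        have n3 : ∀ᶠ s in 𝓝 τ, 0 < u s x := by
          have : ContinuousOn (fun s => u s x) {s | 0 ≤ s ∧ g s ≤ x} := h.cont_line fun s hs => hs
          have hm : {s | 0 ≤ s ∧ g s ≤ x} ∈ 𝓝 τ := by
            filter_upwards [Ici_mem_nhds hτ0, n2] with s h1 h2
            exact ⟨h1, h2.le⟩
          exact (this.continuousAt hm).eventually (Ioi_mem_nhds hup)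
        obtain ⟨r, hr, hrr⟩ := Metric.eventually_nhds_iff.1 (n2.and n3)
        have n4 : ∀ᶠ s in 𝓝[<] τ, s ∈ Ioo (τ - r) τ := Ioo_mem_nhdsLT (by linarith)
        filter_upwards [n1, n4] with s hs1 hs2
        by_contra hn
        have hpos : ∀ y ∈ Icc x X, 0 < u s y := by
          intro y hy
          by_contra! hy'
          refine hn ((hSm s x).2 ⟨⟨hs1.1.le, hs1.2.le.trans a.2⟩, ?_, y, hy.1, hy.2, hy'⟩)
          exact (hrr (by rw [Real.dist_eq, abs_lt]; constructor <;> linarith [hs2.1, hs2.2])).1.le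
        have hw : ∀ σ ∈ Icc s τ, g σ < x ∧ 0 < u σ x := fun σ hσ =>
          hrr (by rw [Real.dist_eq, abs_lt]; constructor <;> linarith [hs2.1, hs2.2, hσ.1, hσ.2])
        have := h.rect (s := s) (t := τ) (a := x) (X := X) (ht1.trans hs1.1.le)
          (fun σ hσ => (hw σ hσ).1.le) (fun σ hσ => (hw σ hσ).2)
          (fun σ hσ => hX σ ⟨hs1.1.le.trans hσ.1, hσ.2.trans a.2⟩) (c.trans e) hpos τ
          ⟨hs1.2.le, le_rfl⟩ x' ⟨c, e⟩
        linarith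
      · have := h.lip0 hτ0.le hup.le
        rw [abs_sub_comm, abs_sub_comm (0:ℝ)]
        exact this
  intro τ hτ a y h1 h2 h3 h4
  by_contra! hn
  set q := u τ a with hq
  have := key (q / Real.exp ((K + d + 1) * (τ - t1))) (div_pos h4 (Real.exp_pos _)) τ a
    ((hSm τ a).2 ⟨hτ, h1.le, y, h2.le, h3.le, hn⟩)
  rw [show bar (K + d + 1) t1 0 (q / Real.exp ((K + d + 1) * (τ - t1))) 0 0 0 τ a = q by
    unfold bar; simp] at this
  linarith
end

noncomputable section
variable {d μ M K : ℝ} {f : ℝ → ℝ → ℝ → ℝ} {u : ℝ → ℝ → ℝ} {g : ℝ → ℝ}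

/-- right monotonicity -/
lemma FB.propR (h : FB d μ M K f u g) {t1 t2 X : ℝ} (ht1 : 0 ≤ t1)
    (hg : ∀ τ ∈ Icc t1 t2, g τ < X) (hX : ∀ τ ∈ Icc t1 t2, 0 < u τ X)
    (hP : ∀ x, X ≤ x → 0 < u t1 x) :
    ∀ τ ∈ Icc t1 t2, ∀ y a, X ≤ y → y ≤ a → u τ y ≤ 0 → u τ a ≤ 0 := by
  have hd := h.hd
  have hK := h.hK
  have hM := h.hM
  have key : ∀ ε > 0, ∀ X2, X + M / ε ≤ X2 → ∀ τ ∈ Icc t1 t2, ∀ y a, X ≤ y → y ≤ a → a ≤ X2 →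
      u τ y ≤ 0 → 0 < 0 - u τ a + bar (K + d + 1) t1 X 0 ε 0 0 τ a := by
    intro ε hε X2 hX2
    set Z : Set (ℝ × ℝ × ℝ) := {q | q.1 ∈ Icc t1 t2 ∧ X ≤ q.2.2 ∧ q.2.2 ≤ q.2.1 ∧ q.2.1 ≤ X2 ∧
      u q.1 q.2.2 ≤ 0} with hZ
    have hZc : IsCompact Z := by
      set Y : Set (ℝ × ℝ × ℝ) := {q | q.1 ∈ Icc t1 t2 ∧ X ≤ q.2.2 ∧ q.2.2 ≤ q.2.1 ∧ q.2.1 ≤ X2}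
        with hY
      have hYcl : IsClosed Y := by
        have k1 : IsClosed {q : ℝ × ℝ × ℝ | q.1 ∈ Icc t1 t2} := isClosed_Icc.preimage continuous_fst
        have k0 : IsClosed {q : ℝ × ℝ × ℝ | X ≤ q.2.2} := isClosed_le (by fun_prop) (by fun_prop)
        have k2 : IsClosed {q : ℝ × ℝ × ℝ | q.2.2 ≤ q.2.1} := isClosed_le (by fun_prop) (by fun_prop)
        have k3 : IsClosed {q : ℝ × ℝ × ℝ | q.2.1 ≤ X2} := isClosed_le (by fun_prop) (by fun_prop)
        exact k1.inter (k0.inter (k2.inter k3))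
      have hYc : IsCompact Y := by
        refine ((isCompact_Icc (a := t1) (b := t2)).prod ((isCompact_Icc (a := X) (b := X2)).prod
          (isCompact_Icc (a := X) (b := X2)))).of_isClosed_subset hYcl ?_
        rintro ⟨τ, x, x'⟩ ⟨a, b, c, e⟩
        simp only at b c e
        exact ⟨a, ⟨by simp only; linarith, by simp only; linarith⟩,
          ⟨by simp only; linarith, by simp only; linarith⟩⟩
      have c4 : ContinuousOn (fun q : ℝ × ℝ × ℝ => u q.1 q.2.2) Y :=
        h.uc.comp (f := fun q : ℝ × ℝ × ℝ => ((q.1, q.2.2) : ℝ × ℝ)) (by fun_prop)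
          fun q hq => ⟨ht1.trans hq.1.1, (hg _ hq.1).le.trans hq.2.1⟩
      have : Z = Y ∩ (fun q : ℝ × ℝ × ℝ => u q.1 q.2.2) ⁻¹' Iic 0 := by
        ext q
        simp only [hZ, hY, Set.mem_ofPred_eq, mem_inter_iff, mem_preimage, mem_Iic]
        tauto
      rw [this]
      exact hYc.of_isClosed_subset (c4.preimage_isClosed_of_isClosed hYcl isClosed_Iic)
        inter_subset_left
    set S : Set (ℝ × ℝ) := (fun q : ℝ × ℝ × ℝ => (q.1, q.2.1)) '' Z with hS
    have hSc : IsCompact S := hZc.image (by fun_prop)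
    have hSm : ∀ τ x, (τ, x) ∈ S ↔ τ ∈ Icc t1 t2 ∧ x ≤ X2 ∧ ∃ x', X ≤ x' ∧ x' ≤ x ∧ u τ x' ≤ 0 := by
      intro τ x
      constructor
      · rintro ⟨⟨τ', x', x''⟩, ⟨a, b, c, e, k⟩, heq⟩
        simp only [Prod.mk.injEq] at heq
        obtain ⟨rfl, rfl⟩ := heq
        exact ⟨a, e, x'', b, c, k⟩
      · rintro ⟨a, b, x', c, e, k⟩
        exact ⟨(τ, x, x'), ⟨a, c, e, b, k⟩, rfl⟩
    have hfin : ∀ τ x, (τ, x) ∈ S → 0 < 0 - u τ x + bar (K + d + 1) t1 X 0 ε 0 0 τ x := by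
      apply comp_compact (K := K) (f := f) (u := fun _ _ => 0) (v := u)
        (E := bar (K + d + 1) t1 X 0 ε 0 0)
        (Ex := barx (K + d + 1) t1 X ε 0) (Exx := barxx (K + d + 1) t1 X ε 0)
        (Et := bart (K + d + 1) t1 X 0 ε 0 0) hd hSc
      · refine ContinuousOn.add (continuousOn_const.sub ?_) (bar_cont _ _ _ _ _ _ _).continuousOn
        refine h.uc.mono ?_
        rintro ⟨τ, x⟩ hq
        obtain ⟨a, b, x', c, e, -⟩ := (hSm τ x).1 hq
        exact ⟨ht1.trans a.1, ((hg _ a).le.trans c).trans e⟩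
      · intro t y; exact bar_x _ _ _ _ _ _ _ _ _
      · intro t y; exact bar_xx _ _ _ _ _ _ _
      · intro τ x hx hle
        obtain ⟨a, b, x', c, e, k⟩ := (hSm τ x).1 hx
        have ebar : bar (K + d + 1) t1 X 0 ε 0 0 τ x =
          ε * Real.exp (x - X) * Real.exp ((K + d + 1) * (τ - t1)) := by unfold bar; ring
        have hup : 0 < u τ x := by
          have : 0 < bar (K + d + 1) t1 X 0 ε 0 0 τ x := by rw [ebar]; positivity
          linarith
        have c' : X < x' := lt_of_le_of_ne c fun h' => by rw [← h'] at k; linarith [hX τ a]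
        have e' : x' < x := lt_of_le_of_ne e fun h' => by rw [h'] at k; linarith
        have b' : x < X2 := lt_of_le_of_ne b fun h' => by
          have h1 : (x - X) + 1 ≤ Real.exp (x - X) := Real.add_one_le_exp _
          have h2 : 1 ≤ Real.exp ((K + d + 1) * (τ - t1)) := Real.one_le_exp (by
            exact mul_nonneg (by positivity) (by linarith [a.1]))
          have h3 : M / ε ≤ x - X := by linarith
          rw [div_le_iff₀ hε] at h3
          have h4 : M + ε ≤ ε * Real.exp (x - X) := by nlinarith
          have h5 : ε * Real.exp (x - X) * 1 ≤
            ε * Real.exp (x - X) * Real.exp ((K + d + 1) * (τ - t1)) := by gcongr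
          have := (abs_le.1 (h.le τ (ht1.trans a.1) x)).2
          linarith
        have ht : t1 < τ := lt_of_le_of_ne a.1 fun h' => by
          subst h'; linarith [hP x' c]
        have hτ0 : 0 < τ := lt_of_le_of_lt ht1 ht
        have hgx : g τ < x := (hg τ a).trans (c'.trans e')
        refine ⟨?_, ?_, bar_t _ _ _ _ _ _ _ _ _, fun _ => ⟨locSol_zero h.zero _ _, h.sol τ hτ0 x hgx, ?_,
          bar_ineq hd hK.le rfl le_rfl hε.le le_rfl le_rfl (by linarith)⟩⟩
        · filter_upwards [Ioo_mem_nhds e' b'] with y hy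
          exact (hSm τ y).2 ⟨a, hy.2.le, x', c, hy.1.le, k⟩
        · -- past
          have n1 : ∀ᶠ s in 𝓝[<] τ, s ∈ Ioo t1 τ := Ioo_mem_nhdsLT ht
          have gA : ContinuousAt g τ := h.gc.continuousAt (Ici_mem_nhds hτ0)
          have n2 : ∀ᶠ s in 𝓝 τ, g s < x := gA.eventually (Iio_mem_nhds hgx)
          have n3 : ∀ᶠ s in 𝓝 τ, 0 < u s x := by
            have : ContinuousOn (fun s => u s x) {s | 0 ≤ s ∧ g s ≤ x} := h.cont_line fun s hs => hs
            have hm : {s | 0 ≤ s ∧ g s ≤ x} ∈ 𝓝 τ := by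
              filter_upwards [Ici_mem_nhds hτ0, n2] with s h1 h2
              exact ⟨h1, h2.le⟩
            exact (this.continuousAt hm).eventually (Ioi_mem_nhds hup)
          obtain ⟨r, hr, hrr⟩ := Metric.eventually_nhds_iff.1 (n2.and n3)
          have n4 : ∀ᶠ s in 𝓝[<] τ, s ∈ Ioo (τ - r) τ := Ioo_mem_nhdsLT (by linarith)
          filter_upwards [n1, n4] with s hs1 hs2
          by_contra hn
          have hpos : ∀ y ∈ Icc X x, 0 < u s y := by
            intro y hy
            by_contra! hy'
            exact hn ((hSm s x).2 ⟨⟨hs1.1.le, hs1.2.le.trans a.2⟩, b, y, hy.1, hy.2, hy'⟩)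
          have hI : ∀ σ ∈ Icc s τ, σ ∈ Icc t1 t2 := fun σ hσ =>
            ⟨hs1.1.le.trans hσ.1, hσ.2.trans a.2⟩
          have hw : ∀ σ ∈ Icc s τ, g σ < x ∧ 0 < u σ x := fun σ hσ =>
            hrr (by rw [Real.dist_eq, abs_lt]; constructor <;> linarith [hs2.1, hs2.2, hσ.1, hσ.2])
          have := h.rect (s := s) (t := τ) (a := X) (X := x) (ht1.trans hs1.1.le)
            (fun σ hσ => (hg σ (hI σ hσ)).le) (fun σ hσ => hX σ (hI σ hσ))
            (fun σ hσ => (hw σ hσ).2) (c.trans e) hpos τ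
            ⟨hs1.2.le, le_rfl⟩ x' ⟨c, e⟩
          linarith
        · have := h.lip0 hτ0.le hup.le
          rw [abs_sub_comm, abs_sub_comm (0:ℝ)]
          exact this
    intro τ hτ y a h1 h2 h3 h4
    exact hfin τ a ((hSm τ a).2 ⟨hτ, h3, y, h1, h2, h4⟩)
  intro τ hτ y a h1 h2 h4
  by_contra! hn
  set q := u τ a with hq
  set e := Real.exp (a - X) * Real.exp ((K + d + 1) * (τ - t1)) with he
  have he0 : 0 < e := by positivity
  have := key (q / e) (div_pos hn he0) (max (X + M / (q / e)) a) (le_max_left _ _) τ hτ y a h1 h2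
    (le_max_right _ _) h4
  rw [show bar (K + d + 1) t1 X 0 (q / e) 0 0 τ a = q / e * e by
    unfold bar; rw [he]; ring, div_mul_cancel₀ _ he0.ne'] at this
  linarith

/-- if `u` is nonpositive on a half line then later it tends to a nonpositive value at infinity -/
lemma FB.far (h : FB d μ M K f u g) {t T X : ℝ} (ht : 0 ≤ t) (htT : t ≤ T)
    (hX : ∀ x ≥ X, u t x ≤ 0) {m C : ℝ} (hm : 0 < m) (hC : ∀ x ≥ C, m ≤ u T x) : False := by
  have hd := h.hd
  have hK := h.hK
  have hM := h.hM
  obtain ⟨G, hG⟩ := (isCompact_Icc (a := t) (b := T)).exists_bound_of_continuousOn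
    (h.gc.mono fun τ hτ => ht.trans hτ.1)
  set x1 := max X (G + 1) with hx1
  have hgx : ∀ τ ∈ Icc t T, g τ < x1 := fun τ hτ => by
    have := (abs_le.1 (hG τ hτ)).2; have := le_max_right X (G + 1); linarith
  have key := bar_right (u := fun _ _ => 0) (v := u) (f := f) (T := t) (T' := T) (x1 := x1) (a := 0)
    (c := M) (η := 0) (C := M) (γ := fun _ => x1) hd hK.le rfl le_rfl hM.le le_rfl continuousOn_const
    ?_ ?_ ?_ ?_ T ⟨htT, le_rfl⟩
  · set e := Real.exp ((K + d + 1) * (T - t)) with he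
    have he0 : 0 < e := Real.exp_pos _
    have h1 := key (max (max C x1) (x1 + M * e / m)) ((le_max_right _ _).trans (le_max_left _ _))
    set x := max (max C x1) (x1 + M * e / m) with hx
    have h2 := hC x ((le_max_left _ _).trans (le_max_left _ _))
    have h3 : x1 + M * e / m ≤ x := le_max_right _ _
    have h4 := Real.add_one_le_exp (x - x1)
    have h5 : M * e < m * Real.exp (x - x1) := by
      have : M * e / m < Real.exp (x - x1) := by linarith
      rwa [div_lt_iff₀' hm] at this
    simp only [bar] at h1
    have h6 : Real.exp (-(x - x1)) = (Real.exp (x - x1))⁻¹ := Real.exp_neg _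
    have h7 : m ≤ M * (Real.exp (x - x1))⁻¹ * e := by
      rw [← h6]; linarith
    have h8 : 0 < Real.exp (x - x1) := Real.exp_pos _
    have h9 : M * (Real.exp (x - x1))⁻¹ * e = M * e / Real.exp (x - x1) := by field_simp
    rw [h9, le_div_iff₀ h8] at h7
    linarith
  · refine continuousOn_const.sub (h.uc.mono fun q hq => ⟨ht.trans hq.1.1, (hgx _ hq.1).le.trans hq.2⟩)
  · intro τ hτ x _
    have := (abs_le.1 (h.le τ (ht.trans hτ.1) x)).2
    linarith
  · intro τ hτ x hx hor
    simp only [bar]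
    have hp : 0 < Real.exp ((K + d + 1) * (τ - t)) := Real.exp_pos _
    rcases hor with h' | h'
    · subst h'
      have := hX x ((le_max_left _ _).trans hx)
      have : 0 ≤ M * Real.exp (-(x - x1)) * Real.exp ((K + d + 1) * (τ - τ)) := by positivity
      linarith
    · subst h'
      have h1 : 1 ≤ Real.exp ((K + d + 1) * (τ - t)) := Real.one_le_exp (by
            exact mul_nonneg (by positivity) (by linarith [hτ.1]))
      have := (abs_le.1 (h.le τ (ht.trans hτ.1) x1)).2
      simp only [sub_self, neg_zero, Real.exp_zero]
      nlinarith
  · intro τ hτ x hx hlt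
    have hτ0 : 0 < τ := lt_of_le_of_lt ht hτ.1
    have hb : 0 ≤ bar (K + d + 1) t x1 0 0 M 0 τ x := by unfold bar; simp; positivity
    have hup : 0 < u τ x := by linarith
    refine ⟨locSol_zero h.zero _ _, h.sol τ hτ0 x ((hgx τ ⟨hτ.1.le, hτ.2⟩).trans hx), ?_⟩
    have := h.lip0 hτ0.le hup.le
    rw [abs_sub_comm, abs_sub_comm (0:ℝ)]
    exact this
end

noncomputable section
variable {d μ M K : ℝ} {f : ℝ → ℝ → ℝ → ℝ} {u : ℝ → ℝ → ℝ} {g : ℝ → ℝ}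

lemma real_ind {P : ℝ → Prop} {a : ℝ} (h0 : P a)
    (hr : ∀ t ≥ a, P t → ∃ δ > 0, ∀ s ∈ Icc t (t + δ), P s)
    (hl : ∀ t > a, (∀ s ∈ Ico a t, P s) → P t) : ∀ t ≥ a, P t := by
  by_contra! hn
  obtain ⟨t0, ht0, hn⟩ := hn
  set S := {t | a ≤ t ∧ ¬ P t} with hS
  have hbb : BddBelow S := ⟨a, fun t ht => ht.1⟩
  have hne : S.Nonempty := ⟨t0, ht0, hn⟩
  set c := sInf S with hc
  have hac : a ≤ c := le_csInf hne fun t ht => ht.1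
  have hlt : ∀ s ∈ Ico a c, P s := by
    intro s hs
    by_contra hP
    have : c ≤ s := csInf_le hbb ⟨hs.1, hP⟩
    linarith [hs.2]
  have hPc : P c := by
    rcases hac.lt_or_eq with h | h
    · exact hl c h hlt
    · rw [← h]; exact h0
  obtain ⟨δ, hδ, hδ'⟩ := hr c hac hPc
  obtain ⟨t, ht, htc⟩ := exists_lt_of_csInf_lt hne (show c < c + δ by linarith)
  exact ht.2 (hδ' t ⟨csInf_le hbb ht, htc.le⟩)

lemma slope_tendsto {φ : ℝ → ℝ} {a D : ℝ} (h : HasDerivWithinAt φ D (Ici a) a) :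
    Tendsto (slope φ a) (𝓝[>] a) (𝓝 D) := by
  have := hasDerivWithinAt_iff_tendsto_slope.1 h
  rwa [Ici_sdiff_left] at this

lemma derivWithin_ge {φ : ℝ → ℝ} {a D η r : ℝ} (h : HasDerivWithinAt φ D (Ici a) a)
    (hr : 0 < r) (hφ : φ a = 0) (hy : ∀ y ∈ Ioc 0 r, η * y ≤ φ (a + y)) : η ≤ D := by
  refine ge_of_tendsto (slope_tendsto h) ?_
  filter_upwards [Ioc_mem_nhdsGT (show a < a + r by linarith)] with x hx
  have := hy (x - a) ⟨by linarith [hx.1], by linarith [hx.2]⟩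
  rw [slope_def_field, hφ, sub_zero, le_div_iff₀ (by linarith [hx.1])]
  rwa [add_sub_cancel] at this

lemma pos_of_deriv {φ : ℝ → ℝ} {a : ℝ} (hφ : φ a = 0) (h : 0 < derivWithin φ (Ici a) a) :
    ∃ r > 0, ∀ x ∈ Ioo a (a + r), 0 < φ x := by
  have hd : DifferentiableWithinAt ℝ φ (Ici a) a := by
    by_contra hn
    rw [derivWithin_zero_of_not_differentiableWithinAt hn] at h
    exact lt_irrefl _ h
  have h1 := (slope_tendsto hd.hasDerivWithinAt).eventually (Ioi_mem_nhds h)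
  rw [eventually_iff, mem_nhdsGT_iff_exists_Ioo_subset] at h1
  obtain ⟨b, hb, hs⟩ := h1
  refine ⟨b - a, by linarith [mem_Ioi.1 hb], fun x hx => ?_⟩
  have : 0 < slope φ a x := hs ⟨hx.1, by linarith [hx.2]⟩
  rw [slope_def_field, hφ, sub_zero] at this
  by_contra! hn
  have := div_nonpos_of_nonpos_of_nonneg hn (show 0 ≤ x - a by linarith [hx.1])
  linarith

lemma hasDerivWithin_of_tendsto {φ : ℝ → ℝ} {a D : ℝ} (hφ : φ a = 0)
    (h : Tendsto (fun y => φ (a + y) / y) (𝓝[>] 0) (𝓝 D)) : HasDerivWithinAt φ D (Ici a) a := by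
  rw [hasDerivWithinAt_iff_tendsto_slope, Ici_sdiff_left]
  have h1 : Tendsto (fun x => x - a) (𝓝[>] a) (𝓝[>] 0) := by
    apply tendsto_nhdsWithin_of_tendsto_nhds_of_eventually_within
    · have : Continuous fun x : ℝ => x - a := by fun_prop
      have := (this.tendsto a).mono_left (nhdsWithin_le_nhds (s := Ioi a))
      simpa using this
    · filter_upwards [self_mem_nhdsWithin] with x hx
      exact sub_pos.2 (mem_Ioi.1 hx)
  refine (h.comp h1).congr fun x => ?_
  simp only [Function.comp, slope_def_field, hφ, sub_zero, add_sub_cancel]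

/-- linear growth at the free boundary -/
lemma FB.grow (h : FB d μ M K f u g) {T t0 : ℝ} (hT : 0 < T) (hTt : T < t0)
    (hA : ∀ t ∈ Icc T t0, ∀ x, g t < x → 0 < u t x) :
    ∃ η > 0, ∀ t ∈ Icc ((T + t0) / 2) t0, ∀ y ∈ Icc (0:ℝ) (1/2), η * y ≤ u t (g t + y) := by
  set G := fun t => -μ * derivWithin (u t) (Ici (g t)) (g t) with hG
  obtain ⟨B, hB⟩ := (isCompact_Icc (a := T) (b := t0)).exists_bound_of_continuousOn
    (h.gc1.mono fun t ht => lt_of_lt_of_le hT ht.1)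
  have hB0 : 0 ≤ B := (norm_nonneg _).trans (hB T ⟨le_rfl, hTt.le⟩)
  obtain ⟨c, hc, H⟩ := hopf (d := d) (K := K) (B := B + 1) (l := 1) (τ := t0 - T) h.hd h.hK.le
    (by positivity) one_pos
  set r := (t0 - T) / 2 with hr
  have hr0 : 0 < r := by rw [hr]; linarith
  obtain ⟨m, hm, hm'⟩ := (isCompact_Icc (a := g T + r) (b := g T + 2 * r + 1)).exists_forall_le'
    ((h.cont_slice hT.le).mono fun x hx => show g T ≤ x by linarith [hx.1])
    (a := 0) (fun x hx => hA T ⟨le_rfl, hTt.le⟩ x (by linarith [hx.1]))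
  refine ⟨c * m / 2, by positivity, fun t ht y hy => ?_⟩
  have htT : T < t := by linarith [ht.1]
  have hsub : ∀ s ∈ Icc T t, s ∈ Icc T t0 := fun s hs => ⟨hs.1, hs.2.trans ht.2⟩
  have hgc : ContinuousOn g (Icc T t) := h.gc.mono fun s hs => hT.le.trans hs.1
  have hge : ∀ s ∈ Icc T t, ∀ x, g s + (t - s) ≤ x → 0 ≤ u s x := by
    intro s hs x hx
    rcases (show g s ≤ x by linarith [hs.2]).lt_or_eq with h' | h'
    · exact (hA s (hsub s hs) x h').le
    · rw [← h', h.bc s (hT.le.trans hs.1)]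
  have := H f u (fun _ _ => 0) T t m (fun s => g s + (t - s)) (fun s => G s - 1)
    (by linarith [ht.2]) hm (by fun_prop) ?_ ?_ ?_ (fun s hs x hx _ => hge s hs x hx) ?_ ?_ t
    ⟨htT.le, le_rfl⟩ (g t + y) (by linarith [hy.1]) (by linarith [hy.2])
  · simp only [sub_zero, sub_self, add_zero] at this
    have e : c * m * ((g t + y - g t) * (g t + 1 - (g t + y))) = c * m * (y * (1 - y)) := by ring
    rw [e] at this
    have h2 : y * (1 / 2) ≤ y * (1 - y) := mul_le_mul_of_nonneg_left (by linarith [hy.2]) hy.1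
    have h3 : c * m * (y * (1 / 2)) ≤ c * m * (y * (1 - y)) := by gcongr
    linarith
  · intro s hs
    have h1 := h.st s (hT.trans hs.1)
    have h2 := h1.add ((hasDerivAt_id s).const_sub t)
    refine (h2.congr_of_eventuallyEq (Eventually.of_forall fun q => ?_)).congr_deriv ?_
    · simp
    · simp only [hG]; ring
  · intro s hs
    have := hB s (hsub s ⟨hs.1.le, hs.2⟩)
    rw [Real.norm_eq_abs] at this
    calc |G s - 1| ≤ |G s| + |1| := abs_sub _ _
      _ ≤ B + 1 := by rw [abs_one]; gcongr
  · simp only [sub_zero]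
    refine h.uc.mono fun q hq => ⟨hT.le.trans hq.1.1, ?_⟩
    have h1 := hq.2.1
    have h2 := hq.1.2
    linarith
  · intro x hx1 hx2
    rw [sub_zero]
    exact hm' x ⟨by linarith [ht.1], by linarith [ht.2]⟩
  · intro s hs x hx1 hx2 _
    have hs0 : 0 < s := hT.trans hs.1
    have hgx : g s < x := by linarith [hs.2]
    exact ⟨h.sol s hs0 x hgx, locSol_zero h.zero _ _, h.lip0 hs0.le
      (hA s (hsub s ⟨hs.1.le, hs.2⟩) x hgx).le⟩

lemma FB.diff (h : FB d μ M K f u g) {T t0 : ℝ} (hT : 0 < T) (hTt : T < t0)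
    (hA : ∀ t ∈ Icc T t0, ∀ x, g t < x → 0 < u t x) :
    0 < derivWithin (u t0) (Ici (g t0)) (g t0) := by
  have hμ := h.hμ
  obtain ⟨η, hη, hgr⟩ := h.grow hT hTt hA
  have t00 : 0 < t0 := hT.trans hTt
  have hDD : ∀ t ∈ Icc ((T + t0) / 2) t0, ∀ D, HasDerivWithinAt (u t) D (Ici (g t)) (g t) → η ≤ D := by
    intro t ht D hD
    exact derivWithin_ge hD (r := 1 / 2) (by norm_num) (h.bc t (by linarith [ht.1]))
      fun y hy => hgr t ht y ⟨hy.1.le, hy.2⟩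
  have hdich : ∀ t ∈ Icc ((T + t0) / 2) t0, derivWithin (u t) (Ici (g t)) (g t) = 0 ∨
      η ≤ derivWithin (u t) (Ici (g t)) (g t) := by
    intro t ht
    by_cases hd : DifferentiableWithinAt ℝ (u t) (Ici (g t)) (g t)
    · exact Or.inr (hDD t ht _ hd.hasDerivWithinAt)
    · exact Or.inl (derivWithin_zero_of_not_differentiableWithinAt hd)
  rcases hdich t0 ⟨by linarith, le_rfl⟩ with h0 | h0
  swap
  · linarith
  exfalso
  have hca := h.gc1.continuousAt (Ioi_mem_nhds t00)
  have hev : ∀ᶠ t in 𝓝 t0, -(μ * η) < -μ * derivWithin (u t) (Ici (g t)) (g t) := by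
    apply hca.eventually (Ioi_mem_nhds _)
    simp only [h0]
    simp; positivity
  obtain ⟨r, hr, hrr⟩ := Metric.eventually_nhds_iff.1 hev
  set T1 := max ((T + t0) / 2) (t0 - r / 2) with hT1
  have hT1a : (T + t0) / 2 ≤ T1 := le_max_left _ _
  have hT1b : t0 - r / 2 ≤ T1 := le_max_right _ _
  have hT1c : T1 < t0 := max_lt (by linarith) (by linarith)
  have hz : ∀ t ∈ Icc T1 t0, derivWithin (u t) (Ici (g t)) (g t) = 0 := by
    intro t ht
    have h1 := hrr (y := t) (by rw [Real.dist_eq, abs_lt]; constructor <;> linarith [ht.1, ht.2])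
    rcases hdich t ⟨hT1a.trans ht.1, ht.2⟩ with h' | h'
    · exact h'
    · nlinarith
  have hgc : ∀ t ∈ Icc T1 t0, g t = g T1 := by
    apply constant_of_has_deriv_right_zero (h.gc.mono fun s hs => show (0:ℝ) ≤ s by linarith [hs.1])
    intro t ht
    have h1 := h.st t (by linarith [ht.1])
    rw [hz t ⟨ht.1, ht.2.le⟩, mul_zero] at h1
    exact h1.hasDerivWithinAt
  have hgt : ∀ t ∈ Icc T1 t0, g t = g t0 := fun t ht => by
    rw [hgc t ht, hgc t0 ⟨hT1c.le, le_rfl⟩]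
  obtain ⟨D, hD⟩ := flat_diff (d := d) (B := K * M) (M := M) (T := T1) (t0 := t0) (a := g t0)
    (X := g t0 + 1) h.hd hT1c (by linarith) (f := f) (u := u)
    (h.uc.mono fun q hq => ⟨by linarith [hq.1.1], by rw [hgt _ hq.1]; exact hq.2.1⟩)
    (fun t ht => by rw [← hgt t ht]; exact h.bc t (by linarith [ht.1]))
    (fun t ht x _ => h.le t (by linarith [ht.1]) x)
    (fun t ht x hx => by
      have ht0 : 0 < t := by linarith [ht.1]
      have hgx : g t < x := by rw [hgt t ⟨ht.1.le, ht.2⟩]; exact hx.1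
      refine ⟨h.sol t ht0 x hgx, ?_⟩
      have h1 := hA t ⟨by linarith [ht.1], ht.2⟩ x hgx
      have h2 := h.lip0 ht0.le h1.le
      rw [h.zero, sub_zero, sub_zero] at h2
      have h3 := h.le t ht0.le x
      have := mul_le_mul_of_nonneg_left h3 h.hK.le
      linarith)
  have hw := hasDerivWithin_of_tendsto (φ := u t0) (h.bc t0 t00.le) hD
  have h1 := hDD t0 ⟨by linarith, le_rfl⟩ D hw
  have h2 := hw.derivWithin (uniqueDiffOn_Ici (g t0) (g t0) self_mem_Ici)
  rw [h0] at h2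
  linarith
end

noncomputable section
variable {d μ M K : ℝ} {f : ℝ → ℝ → ℝ → ℝ} {u : ℝ → ℝ → ℝ} {g : ℝ → ℝ}

/-- positivity set is an upper set -/
def Uq (u : ℝ → ℝ → ℝ) (g : ℝ → ℝ) (t : ℝ) : Prop :=
  ∀ a y, g t < a → a < y → 0 < u t a → 0 < u t y

lemma FB.uq_step (h : FB d μ M K f u g) (hfar : ∀ t ≥ 0, ∀ X, ∃ x ≥ X, 0 < u t x)
    {t1 t2 X : ℝ} (ht1 : 0 ≤ t1) (hg : ∀ τ ∈ Icc t1 t2, g τ < X) (hX : ∀ τ ∈ Icc t1 t2, 0 < u τ X)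
    (hU : Uq u g t1) : ∀ τ ∈ Icc t1 t2, Uq u g τ := by
  intro τ hτ a y h1 h2 h3
  have hI : t1 ∈ Icc t1 t2 := ⟨le_rfl, hτ.1.trans hτ.2⟩
  rcases lt_trichotomy y X with hy | hy | hy
  · exact h.propV ht1 hg hX (fun a y b1 b2 _ b3 => hU a y b1 b2 b3) τ hτ a y h1 h2 hy h3
  · rw [hy]; exact hX τ hτ
  · by_contra! hn
    have h4 := h.propR ht1 hg hX (fun x hx => by
      rcases hx.lt_or_eq with h' | h'
      · exact hU X x (hg t1 hI) h' (hX t1 hI)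
      · rw [← h']; exact hX t1 hI) τ hτ y
    obtain ⟨x, hx, hxp⟩ := hfar τ (ht1.trans hτ.1) y
    have := h4 x hy.le hx hn
    linarith

lemma FB.ev_line (h : FB d μ M K f u g) {t X : ℝ} (ht : 0 ≤ t) (hg : g t < X) (hX : 0 < u t X) :
    ∃ δ > 0, ∀ τ, 0 ≤ τ → |τ - t| ≤ δ → g τ < X ∧ 0 < u τ X := by
  have n2 : ∀ᶠ s in 𝓝[Ici 0] t, g s < X := (h.gc t ht).eventually (Iio_mem_nhds hg)
  have n3 : ∀ᶠ s in 𝓝[{s | 0 ≤ s ∧ g s ≤ X}] t, 0 < u s X := by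
    have : ContinuousOn (fun s => u s X) {s | 0 ≤ s ∧ g s ≤ X} := h.cont_line fun s hs => hs
    exact (this t ⟨ht, hg.le⟩).eventually (Ioi_mem_nhds hX)
  rw [eventually_nhdsWithin_iff] at n2 n3
  obtain ⟨r, hr, hrr⟩ := Metric.eventually_nhds_iff.1 (n2.and n3)
  refine ⟨r / 2, by positivity, fun τ h1 h2 => ?_⟩
  obtain ⟨k1, k2⟩ := hrr (y := τ) (by rw [Real.dist_eq]; linarith)
  exact ⟨k1 h1, k2 ⟨h1, (k1 h1).le⟩⟩

lemma FB.uq_all (h : FB d μ M K f u g) (hfar : ∀ t ≥ 0, ∀ X, ∃ x ≥ X, 0 < u t x)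
    (h0 : ∀ x, g 0 < x → 0 < u 0 x) : ∀ t ≥ 0, Uq u g t := by
  apply real_ind
  · intro a y h1 h2 _; exact h0 y (h1.trans h2)
  · intro t ht hU
    obtain ⟨X, hX, hXp⟩ := hfar t ht (g t + 1)
    obtain ⟨δ, hδ, H⟩ := h.ev_line ht (by linarith) hXp
    have hw : ∀ τ ∈ Icc t (t + δ), g τ < X ∧ 0 < u τ X := fun τ hτ =>
      H τ (le_trans ht hτ.1) (by rw [abs_le]; constructor <;> linarith [hτ.1, hτ.2])
    exact ⟨δ, hδ, h.uq_step hfar ht (fun τ hτ => (hw τ hτ).1) (fun τ hτ => (hw τ hτ).2) hU⟩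
  · intro t ht hU
    obtain ⟨X, hX, hXp⟩ := hfar t ht.le (g t + 1)
    obtain ⟨δ, hδ, H⟩ := h.ev_line ht.le (by linarith) hXp
    set s := max 0 (t - δ) with hs
    have hs0 : 0 ≤ s := le_max_left _ _
    have hs1 : t - δ ≤ s := le_max_right _ _
    have hs2 : s < t := max_lt ht (by linarith)
    have hw : ∀ τ ∈ Icc s t, g τ < X ∧ 0 < u τ X := fun τ hτ =>
      H τ (hs0.trans hτ.1) (by rw [abs_le]; constructor <;> linarith [hτ.1, hτ.2])
    exact h.uq_step hfar hs0 (fun τ hτ => (hw τ hτ).1) (fun τ hτ => (hw τ hτ).2) (hU s ⟨hs0, hs2⟩) t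
      ⟨hs2.le, le_rfl⟩

/-- positivity is preserved at the limit time -/
lemma FB.pos_limit (h : FB d μ M K f u g) (hfar : ∀ t ≥ 0, ∀ X, ∃ x ≥ X, 0 < u t x)
    {t0 t : ℝ} (ht0 : 0 ≤ t0) (ht : t0 < t) (hA : ∀ s ∈ Ico t0 t, ∀ x, g s < x → 0 < u s x) :
    ∀ x, g t < x → 0 < u t x := by
  intro x hx
  have htp : 0 < t := lt_of_le_of_lt ht0 ht
  set a := (g t + x) / 2 with ha
  have ha1 : g t < a := by rw [ha]; linarith
  have ha2 : a < x := by rw [ha]; linarith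
  have gA : ContinuousAt g t := h.gc.continuousAt (Ici_mem_nhds htp)
  obtain ⟨r, hr, hrr⟩ := Metric.eventually_nhds_iff.1 (gA.eventually (Iio_mem_nhds ha1))
  set s := max t0 (t - r / 2) with hs
  have hs0 : t0 ≤ s := le_max_left _ _
  have hs1 : t - r / 2 ≤ s := le_max_right _ _
  have hs2 : s < t := max_lt ht (by linarith)
  have hga : ∀ τ ∈ Icc s t, g τ < a := fun τ hτ =>
    hrr (by rw [Real.dist_eq, abs_lt]; constructor <;> linarith [hτ.1, hτ.2])
  set l := 2 * (x - a) with hl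
  have hl0 : 0 < l := by rw [hl]; linarith
  obtain ⟨c, hc, H⟩ := hopf (d := d) (K := K) (B := 0) (l := l) (τ := t - s) h.hd h.hK.le
    le_rfl hl0
  have hs00 : 0 ≤ s := ht0.trans hs0
  obtain ⟨m, hm, hm'⟩ := (isCompact_Icc (a := a) (b := a + l)).exists_forall_le'
    ((h.cont_slice hs00).mono fun x hx => ((hga s ⟨le_rfl, hs2.le⟩).le.trans hx.1))
    (a := 0) (fun x hx => hA s ⟨hs0, hs2⟩ x (lt_of_lt_of_le (hga s ⟨le_rfl, hs2.le⟩) hx.1))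
  have hge : ∀ τ ∈ Icc s t, ∀ y, a ≤ y → 0 ≤ u τ y := by
    intro τ hτ y hy
    have hlt : ∀ σ ∈ Ico s t, 0 < u σ y := fun σ hσ =>
      hA σ ⟨hs0.trans hσ.1, hσ.2⟩ y (lt_of_lt_of_le (hga σ ⟨hσ.1, hσ.2.le⟩) hy)
    rcases hτ.2.lt_or_eq with h' | h'
    · exact (hlt τ ⟨hτ.1, h'⟩).le
    · subst h'
      have hco : ContinuousOn (fun s => u s y) (Icc s τ) := h.cont_line fun σ hσ =>
        ⟨hs00.trans hσ.1, (hga σ hσ).le.trans hy⟩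
      have : Tendsto (fun s => u s y) (𝓝[<] τ) (𝓝 (u τ y)) := by
        have := (hco τ ⟨hτ.1, le_rfl⟩)
        refine this.tendsto.mono_left ?_
        rw [nhdsWithin_le_iff]
        exact mem_of_superset (Ioo_mem_nhdsLT hs2) fun z hz => ⟨hz.1.le, hz.2.le⟩
      refine ge_of_tendsto this ?_
      filter_upwards [Ioo_mem_nhdsLT hs2] with z hz
      exact (hlt z ⟨hz.1.le, hz.2⟩).le
  have := H f u (fun _ _ => 0) s t m (fun _ => a) (fun _ => 0) (by linarith) hm continuousOn_const
    (fun τ _ => hasDerivAt_const τ a) (fun _ _ => by simp) ?_ (fun τ hτ y hy _ => hge τ hτ y hy) ?_ ?_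
    t ⟨hs2.le, le_rfl⟩ x ha2.le (by rw [hl]; linarith)
  · have h2 : 0 < c * m * ((x - a) * (a + l - x)) := by
      have : 0 < a + l - x := by rw [hl]; linarith
      have : 0 < x - a := by linarith
      positivity
    linarith
  · simp only [sub_zero]
    exact h.uc.mono fun q hq => ⟨hs00.trans hq.1.1, (hga _ hq.1).le.trans hq.2.1⟩
  · intro y h1 h2; rw [sub_zero]; exact hm' y ⟨h1, h2⟩
  · intro τ hτ y h1 h2 _
    have hτ0 : 0 < τ := lt_of_le_of_lt hs00 hτ.1
    exact ⟨h.sol τ hτ0 y ((hga τ ⟨hτ.1.le, hτ.2⟩).trans h1), locSol_zero h.zero _ _,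
      h.lip0 hτ0.le (hge τ ⟨hτ.1.le, hτ.2⟩ y h1.le)⟩

lemma FB.positive (h : FB d μ M K f u g)
    (hlate : ∀ t, ∃ T ≥ t, ∃ m > 0, ∃ C, ∀ x ≥ C, m ≤ u T x)
    (h0 : ∀ x, g 0 < x → 0 < u 0 x) (hneg : ∃ t > 0, g t < g 0) :
    ∃ s0 > 0, ∀ t ≥ s0, (∀ x, g t < x → 0 < u t x) ∧
      0 < derivWithin (u t) (Ici (g t)) (g t) := by
  have hμ := h.hμ
  have hfar : ∀ t ≥ 0, ∀ X, ∃ x ≥ X, 0 < u t x := by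
    intro t ht X
    by_contra! hn
    obtain ⟨T, hT, m, hm, C, hC⟩ := hlate t
    exact h.far ht hT hn hm hC
  have hU := h.uq_all hfar h0
  have hA : ∀ t > 0, 0 < derivWithin (u t) (Ici (g t)) (g t) → ∀ x, g t < x → 0 < u t x := by
    intro t ht hD x hx
    obtain ⟨r, hr, hrr⟩ := pos_of_deriv (h.bc t ht.le) hD
    set a := g t + min r (x - g t) / 2 with ha
    have hmp : 0 < min r (x - g t) := lt_min hr (by linarith)
    have h1 := min_le_left r (x - g t)
    have h2 := min_le_right r (x - g t)
    exact hU t ht.le a x (by linarith) (by linarith) (hrr a ⟨by linarith, by linarith⟩)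
  obtain ⟨t, ht, hgt⟩ := hneg
  obtain ⟨s0, hs0, hder⟩ := exists_hasDerivAt_eq_slope g
    (fun t => -μ * derivWithin (u t) (Ici (g t)) (g t)) ht (h.gc.mono fun s hs => hs.1)
    (fun s hs => h.st s hs.1)
  have hD0 : 0 < derivWithin (u s0) (Ici (g s0)) (g s0) := by
    have : -μ * derivWithin (u s0) (Ici (g s0)) (g s0) < 0 := by
      rw [hder]; exact div_neg_of_neg_of_pos (by linarith) (by linarith)
    by_contra! hn
    nlinarith
  refine ⟨s0, hs0.1, ?_⟩
  apply real_ind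
  · exact ⟨hA s0 hs0.1 hD0, hD0⟩
  · intro t ht hP
    have ht0 : 0 < t := lt_of_lt_of_le hs0.1 ht
    have hca := h.gc1.continuousAt (Ioi_mem_nhds ht0)
    have hev := hca.eventually (eventually_lt_nhds (b := (0:ℝ)) (by have := hP.2; simp only; nlinarith))
    obtain ⟨r, hr, hrr⟩ := Metric.eventually_nhds_iff.1 hev
    refine ⟨r / 2, by positivity, fun s hs => ?_⟩
    have h1 : -μ * derivWithin (u s) (Ici (g s)) (g s) < 0 :=
      hrr (by rw [Real.dist_eq, abs_lt]; constructor <;> linarith [hs.1, hs.2])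
    have h2 : 0 < derivWithin (u s) (Ici (g s)) (g s) := by
      by_contra! hn
      nlinarith
    exact ⟨hA s (lt_of_lt_of_le ht0 hs.1) h2, h2⟩
  · intro t ht hP
    have ht' : s0 < t := ht
    have hs00 : 0 < s0 := hs0.1
    have h1 := h.pos_limit hfar hs0.1.le ht fun s hs => (hP s hs).1
    refine ⟨h1, h.diff (T := s0) hs0.1 ht fun s hs => ?_⟩
    rcases hs.2.lt_or_eq with h' | h'
    · exact (hP s ⟨hs.1, h'⟩).1
    · rw [h']; exact h1
end

noncomputable section

/-- admissible kernels -/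
def Kern (k : ℝ → ℝ) : Prop := Continuous k ∧ ∀ z, |k z| * (1 + |z|) ≤ 256 * Real.exp (-|z|)

def k0 (z : ℝ) : ℝ := Real.exp (-z^2)
def k1 (z : ℝ) : ℝ := 2 * z * Real.exp (-z^2)
def k2 (z : ℝ) : ℝ := (4 * z^2 - 2) * Real.exp (-z^2)

lemma kern_aux {k : ℝ → ℝ} (hk : Continuous k)
    (h : ∀ z, |k z| ≤ 4 * (1 + z^2) * Real.exp (-z^2)) : Kern k := by
  refine ⟨hk, fun z => ?_⟩
  have h1 : 1 + z^2 ≤ 4 * Real.exp (z^2/4) := by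
    have := Real.add_one_le_exp (z^2/4); linarith [sq_nonneg z]
  have h2 : 1 + |z| ≤ 2 * (1 + z^2) := by
    have := sq_abs z; nlinarith [sq_nonneg (|z| - 1), abs_nonneg z]
  have h3 : (1 + z^2)^2 ≤ 16 * Real.exp (z^2/2) := by
    calc (1 + z^2)^2 ≤ (4 * Real.exp (z^2/4))^2 := by gcongr
      _ = 16 * Real.exp (z^2/2) := by
        rw [mul_pow, ← Real.exp_nat_mul]; norm_num; ring
  have h4 : Real.exp (-(z^2/2)) ≤ 2 * Real.exp (-|z|) := by
    have e1 : Real.exp (1/2) ≤ 2 := by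
      have := Real.exp_one_lt_d9
      have h : Real.exp (1/2) ^ 2 = Real.exp 1 := by rw [← Real.exp_nat_mul]; norm_num
      nlinarith [Real.exp_pos (1/2)]
    calc Real.exp (-(z^2/2)) ≤ Real.exp (1/2 + -|z|) := by
          apply Real.exp_le_exp.2
          have := sq_abs z; nlinarith [sq_nonneg (|z| - 1)]
      _ = Real.exp (1/2) * Real.exp (-|z|) := Real.exp_add _ _
      _ ≤ _ := by gcongr
  calc |k z| * (1 + |z|) ≤ (4 * (1 + z^2) * Real.exp (-z^2)) * (2 * (1 + z^2)) := by
        gcongr; exact h z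
    _ = 8 * (1 + z^2)^2 * Real.exp (-z^2) := by ring
    _ ≤ 8 * (16 * Real.exp (z^2/2)) * Real.exp (-z^2) := by gcongr
    _ = 128 * Real.exp (-(z^2/2)) := by
        rw [show -(z^2/2) = z^2/2 + -z^2 by ring, Real.exp_add]; ring
    _ ≤ _ := by linarith

lemma kern0 : Kern k0 := by
  refine kern_aux (by unfold k0; fun_prop) fun z => ?_
  unfold k0; rw [abs_of_pos (Real.exp_pos _)]
  have := Real.exp_pos (-z^2); nlinarith [mul_nonneg (sq_nonneg z) this.le]
lemma kern1 : Kern k1 := by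
  refine kern_aux (by unfold k1; fun_prop) fun z => ?_
  unfold k1; rw [abs_mul, abs_of_pos (Real.exp_pos _)]
  gcongr
  rw [abs_le]; constructor <;> nlinarith [sq_nonneg (z-1), sq_nonneg (z+1)]
lemma kern2 : Kern k2 := by
  refine kern_aux (by unfold k2; fun_prop) fun z => ?_
  unfold k2; rw [abs_mul, abs_of_pos (Real.exp_pos _)]
  gcongr
  rw [abs_le]; constructor <;> nlinarith [sq_nonneg z]

lemma Kern.le {k : ℝ → ℝ} (h : Kern k) (z : ℝ) : |k z| ≤ 256 * Real.exp (-|z|) :=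
  le_trans (le_mul_of_one_le_right (abs_nonneg _) (by linarith [abs_nonneg z])) (h.2 z)

lemma Kern.le' {k : ℝ → ℝ} (h : Kern k) (z : ℝ) : |k z| * |z| ≤ 256 * Real.exp (-|z|) :=
  le_trans (by gcongr; linarith [abs_nonneg z]) (h.2 z)

lemma k0_deriv (z : ℝ) : HasDerivAt k0 (-k1 z) z := by
  unfold k0 k1
  have := ((hasDerivAt_id z).pow 2).neg.exp
  refine this.congr_deriv ?_
  simp; ring
lemma k1_deriv (z : ℝ) : HasDerivAt k1 (-k2 z) z := by
  have := ((hasDerivAt_id z).const_mul 2).mul (k0_deriv z)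
  refine (this.congr_of_eventuallyEq (Eventually.of_forall fun q => ?_)).congr_deriv ?_
  · simp [k0, k1]
  · simp [k0, k1, k2]; ring

lemma integrable_exp_abs : MeasureTheory.Integrable (fun z : ℝ => Real.exp (-|z|)) := by
  rw [← MeasureTheory.integrableOn_univ, ← Set.Iic_union_Ioi (a := (0:ℝ))]
  refine MeasureTheory.IntegrableOn.union ?_ ?_
  · refine (integrableOn_exp_Iic 0).congr_fun (fun z hz => ?_) measurableSet_Iic
    simp [abs_of_nonpos (show z ≤ 0 from hz)]
  · refine (integrableOn_exp_neg_Ioi 0).congr_fun (fun z hz => ?_) measurableSet_Ioi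
    simp [abs_of_pos (show 0 < z from hz)]

lemma integral_exp_abs : ∫ z : ℝ, Real.exp (-|z|) = 2 := by
  rw [← MeasureTheory.setIntegral_univ, ← Set.Iic_union_Ioi (a := (0:ℝ)),
    MeasureTheory.setIntegral_union (Set.Iic_disjoint_Ioi le_rfl) measurableSet_Ioi
      integrable_exp_abs.integrableOn integrable_exp_abs.integrableOn]
  rw [MeasureTheory.setIntegral_congr_fun (g := fun z => Real.exp z) measurableSet_Iic
    (fun z hz => by simp [abs_of_nonpos (show z ≤ 0 from hz)]),
    MeasureTheory.setIntegral_congr_fun (g := fun z => Real.exp (-z)) measurableSet_Ioi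
    (fun z hz => by simp [abs_of_pos (show 0 < z from hz)]),
    integral_exp_Iic, integral_exp_neg_Ioi]
  norm_num

lemma integral_k0 : ∫ z : ℝ, k0 z = √Real.pi := by
  have := integral_gaussian 1
  simpa [k0] using this

/-- smoothing operator -/
def W (k φ : ℝ → ℝ) (σ x : ℝ) : ℝ := ∫ z, φ (x + σ * z) * k z

lemma W_int {k φ : ℝ → ℝ} {B : ℝ} (hk : Kern k) (hφ : Continuous φ) (hB : ∀ x, |φ x| ≤ B) (σ x : ℝ) :
    MeasureTheory.Integrable (fun z => φ (x + σ * z) * k z) := by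
  refine (integrable_exp_abs.const_mul (B * 256)).mono'
    (Continuous.aestronglyMeasurable (by have := hk.1; fun_prop)) (Eventually.of_forall fun z => ?_)
  rw [Real.norm_eq_abs, abs_mul, mul_assoc]
  have := abs_nonneg (φ (x + σ * z))
  gcongr
  · linarith [hB (x + σ * z)]
  · exact hB _
  · exact hk.le z

lemma W_bound {k φ : ℝ → ℝ} {B : ℝ} (hk : Kern k) (hB : ∀ x, |φ x| ≤ B) (σ x : ℝ) :
    |W k φ σ x| ≤ 512 * B := by
  have h0 : 0 ≤ B := (abs_nonneg _).trans (hB 0)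
  have := MeasureTheory.norm_integral_le_of_norm_le (integrable_exp_abs.const_mul (B * 256))
    (f := fun z => φ (x + σ * z) * k z) (Eventually.of_forall fun z => by
      rw [Real.norm_eq_abs, abs_mul, mul_assoc]
      gcongr
      · exact hB _
      · exact hk.le z)
  rw [MeasureTheory.integral_const_mul, integral_exp_abs] at this
  rw [Real.norm_eq_abs] at this
  unfold W
  linarith

/-- W k0 has norm √π -/
lemma W0_bound {φ : ℝ → ℝ} {B : ℝ} (hB : ∀ x, |φ x| ≤ B) (σ x : ℝ) :
    |W k0 φ σ x| ≤ B * √Real.pi := by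
  have hi : MeasureTheory.Integrable k0 := by
    simpa [W] using W_int (φ := fun _ => 1) (B := 1) kern0 (by fun_prop) (by simp) 0 0
  have := MeasureTheory.norm_integral_le_of_norm_le (hi.const_mul B)
    (f := fun z => φ (x + σ * z) * k0 z) (Eventually.of_forall fun z => by
      have : 0 < k0 z := Real.exp_pos _
      rw [Real.norm_eq_abs, abs_mul, abs_of_pos this]
      gcongr
      exact hB _)
  rw [MeasureTheory.integral_const_mul, integral_k0] at this
  exact this

lemma W_cont {k : ℝ → ℝ} {F : ℝ → ℝ → ℝ} {B : ℝ} (hk : Kern k)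
    (hF : Continuous fun q : ℝ × ℝ => F q.1 q.2) (hB : ∀ s x, |F s x| ≤ B) :
    Continuous fun q : ℝ × ℝ × ℝ => W k (F q.1) q.2.1 q.2.2 := by
  have h0 : 0 ≤ B := (abs_nonneg _).trans (hB 0 0)
  refine MeasureTheory.continuous_of_dominated (bound := fun z => B * 256 * Real.exp (-|z|)) ?_ ?_ ?_ ?_
  · intro q
    have : Continuous (F q.1) := hF.comp (by fun_prop : Continuous fun x : ℝ => (q.1, x))
    have := hk.1
    exact Continuous.aestronglyMeasurable (by fun_prop)
  · intro q
    refine Eventually.of_forall fun z => ?_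
    rw [Real.norm_eq_abs, abs_mul, mul_assoc]
    gcongr
    · exact hB _ _
    · exact hk.le z
  · exact integrable_exp_abs.const_mul _
  · refine Eventually.of_forall fun z => ?_
    exact (hF.comp (by fun_prop : Continuous fun q : ℝ × ℝ × ℝ => (q.1, q.2.2 + q.2.1 * z))).mul
      continuous_const

/-- y-form -/
lemma W_y {k φ : ℝ → ℝ} {σ : ℝ} (hσ : 0 < σ) (x : ℝ) :
    W k φ σ x = σ⁻¹ * ∫ y, φ y * k ((y - x) / σ) := by
  have h1 : ∫ y, φ y * k ((y - x) / σ) = ∫ y, φ (x + y) * k (y / σ) := by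
    rw [← MeasureTheory.integral_add_left_eq_self (fun y => φ y * k ((y - x) / σ)) x]
    simp
  have h2 := MeasureTheory.Measure.integral_comp_mul_left (fun y => φ (x + y) * k (y / σ)) σ
  rw [h1, W]
  rw [abs_of_pos (by positivity), smul_eq_mul] at h2
  rw [← h2]
  congr 1; ext z
  rw [mul_div_cancel_left₀ _ hσ.ne']

end

noncomputable section

lemma integrable_exp_abs_scale {σ : ℝ} (hσ : 0 < σ) (x : ℝ) :
    MeasureTheory.Integrable (fun y : ℝ => Real.exp (-(|y - x| / (2 * σ)))) := by
  have h := (integrable_exp_abs.comp_mul_left' (R := (2 * σ)⁻¹) (by positivity)).comp_sub_right x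
  refine h.congr (Eventually.of_forall fun y => ?_)
  simp only
  rw [abs_mul, abs_of_pos (by positivity : 0 < (2 * σ)⁻¹)]
  congr 2; field_simp

lemma exp_dom {σ σ' x x' y : ℝ} (hσ : 0 < σ) (h1 : 0 < σ') (h2 : σ' ≤ 2 * σ)
    (h3 : |x' - x| ≤ σ') : Real.exp (-|(y - x') / σ'|) ≤ 3 * Real.exp (-(|y - x| / (2 * σ))) := by
  have e1 : Real.exp 1 ≤ 3 := by linarith [Real.exp_one_lt_d9]
  calc Real.exp (-|(y - x') / σ'|) ≤ Real.exp (1 + -(|y - x| / (2 * σ))) := by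
        apply Real.exp_le_exp.2
        rw [abs_div, abs_of_pos h1]
        have t : |y - x| ≤ |y - x'| + |x' - x| := by
          have := abs_add_le (y - x') (x' - x); simpa using this
        have : |y - x| / (2 * σ) ≤ |y - x| / σ' := by gcongr
        have h5 : |y - x| / σ' ≤ (|y - x'| + σ') / σ' := by gcongr; linarith
        rw [add_div, div_self h1.ne'] at h5
        linarith
    _ = Real.exp 1 * Real.exp (-(|y - x| / (2 * σ))) := Real.exp_add _ _
    _ ≤ _ := by gcongr

lemma W_yint {k φ : ℝ → ℝ} {B σ : ℝ} (hk : Kern k) (hφ : Continuous φ) (hB : ∀ x, |φ x| ≤ B)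
    (hσ : 0 < σ) (x : ℝ) : MeasureTheory.Integrable (fun y => φ y * k ((y - x) / σ)) := by
  have h0 : 0 ≤ B := (abs_nonneg _).trans (hB 0)
  refine ((integrable_exp_abs_scale hσ x).const_mul (B * (256 * 3))).mono'
    (Continuous.aestronglyMeasurable (by have := hk.1; fun_prop)) (Eventually.of_forall fun y => ?_)
  rw [Real.norm_eq_abs, abs_mul, mul_assoc, mul_assoc]
  gcongr
  · exact hB _
  · refine (hk.le _).trans ?_
    gcongr
    exact exp_dom hσ hσ (by linarith) (by simp [hσ.le])

lemma W_dx {k k' φ : ℝ → ℝ} {B σ : ℝ} (hk : Kern k) (hk' : Kern k')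
    (hd : ∀ z, HasDerivAt k (-k' z) z) (hφ : Continuous φ) (hB : ∀ x, |φ x| ≤ B) (hσ : 0 < σ) (x : ℝ) :
    HasDerivAt (fun x => W k φ σ x) (σ⁻¹ * W k' φ σ x) x := by
  have h0 : 0 ≤ B := (abs_nonneg _).trans (hB 0)
  have key := (hasDerivAt_integral_of_dominated_loc_of_deriv_le (μ := MeasureTheory.volume)
    (F := fun x y => φ y * k ((y - x) / σ)) (F' := fun x y => φ y * (σ⁻¹ * k' ((y - x) / σ)))
    (x₀ := x) (s := Metric.ball x σ) (Metric.ball_mem_nhds x hσ)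
    (bound := fun y => (B * (σ⁻¹ * (256 * 3))) * Real.exp (-(|y - x| / (2 * σ))))
    (Eventually.of_forall fun x => (W_yint hk hφ hB hσ x).aestronglyMeasurable)
    (W_yint hk hφ hB hσ x)
    (Continuous.aestronglyMeasurable (by have := hk'.1; fun_prop))
    (Eventually.of_forall fun y x' hx' => ?_) ((integrable_exp_abs_scale hσ x).const_mul _)
    (Eventually.of_forall fun y x' hx' => ?_)).2
  · have h := key.const_mul σ⁻¹
    refine (h.congr_of_eventuallyEq (Eventually.of_forall fun q => ?_)).congr_deriv ?_
    · simp only [W_y hσ]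
    · rw [W_y hσ, ← MeasureTheory.integral_const_mul, ← MeasureTheory.integral_const_mul, ← MeasureTheory.integral_const_mul]
      apply MeasureTheory.integral_congr_ae; filter_upwards with y; ring
  · rw [Real.norm_eq_abs, abs_mul, abs_mul, abs_of_pos (by positivity : 0 < σ⁻¹), mul_assoc, mul_assoc, mul_assoc]
    gcongr
    · exact hB _
    · refine (hk'.le _).trans ?_
      gcongr
      exact exp_dom hσ hσ (by linarith) (by rw [Metric.mem_ball, Real.dist_eq] at hx'; exact hx'.le)
  · have h := (hd ((y - x') / σ)).comp x' ((((hasDerivAt_id x').const_sub y)).div_const σ)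
    refine (h.const_mul (φ y)).congr_deriv ?_
    field_simp

def kz (z : ℝ) : ℝ := z * k1 z
lemma kernz : Kern kz := by
  refine kern_aux (by unfold kz k1; fun_prop) fun z => ?_
  unfold kz k1; rw [← mul_assoc, abs_mul, abs_of_pos (Real.exp_pos _)]
  gcongr
  rw [abs_le]; constructor <;> nlinarith [sq_nonneg z]

lemma W_dσ {φ : ℝ → ℝ} {B σ : ℝ} (hφ : Continuous φ) (hB : ∀ x, |φ x| ≤ B) (hσ : 0 < σ) (x : ℝ) :
    HasDerivAt (fun σ => W k0 φ σ x) (σ⁻¹ / 2 * W k2 φ σ x) σ := by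
  have h0 : 0 ≤ B := (abs_nonneg _).trans (hB 0)
  have hs : ∀ σ' ∈ Metric.ball σ (σ/2), σ / 2 < σ' ∧ σ' < 2 * σ := fun σ' h => by
    rw [Metric.mem_ball, Real.dist_eq, abs_lt] at h; constructor <;> linarith
  have key := (hasDerivAt_integral_of_dominated_loc_of_deriv_le (μ := MeasureTheory.volume)
    (F := fun σ y => φ y * k0 ((y - x) / σ)) (F' := fun σ y => φ y * (σ⁻¹ * kz ((y - x) / σ)))
    (x₀ := σ) (s := Metric.ball σ (σ/2)) (Metric.ball_mem_nhds σ (by positivity))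
    (bound := fun y => (B * ((σ/2)⁻¹ * (256 * 3))) * Real.exp (-(|y - x| / (2 * σ))))
    (by
      filter_upwards [lt_mem_nhds hσ] with σ' hσ'
      exact (W_yint kern0 hφ hB hσ' x).aestronglyMeasurable)
    (W_yint kern0 hφ hB hσ x)
    (Continuous.aestronglyMeasurable (by have := kernz.1; fun_prop))
    (Eventually.of_forall fun y x' hx' => ?_) ((integrable_exp_abs_scale hσ x).const_mul _)
    (Eventually.of_forall fun y x' hx' => ?_)).2
  · have h := (hasDerivAt_inv hσ.ne').mul key
    refine (h.congr_of_eventuallyEq ?_).congr_deriv ?_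
    · filter_upwards [lt_mem_nhds hσ] with σ' hσ'
      simp only [W_y hσ', Pi.mul_apply]
    · have e : ∀ y, φ y * k2 ((y - x) / σ) = 2 * (φ y * kz ((y - x) / σ)) - 2 * (φ y * k0 ((y - x) / σ)) := by
        intro y; simp only [kz, k0, k1, k2]; ring
      rw [W_y hσ]
      simp_rw [e]
      rw [MeasureTheory.integral_sub ((W_yint kernz hφ hB hσ x).const_mul 2) ((W_yint kern0 hφ hB hσ x).const_mul 2),
        MeasureTheory.integral_const_mul, MeasureTheory.integral_const_mul]
      have e2 : ∀ y, φ y * (σ⁻¹ * kz ((y - x) / σ)) = σ⁻¹ * (φ y * kz ((y - x) / σ)) := fun y => by ring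
      simp_rw [e2]
      rw [MeasureTheory.integral_const_mul]
      field_simp; ring
  · obtain ⟨h1, h2⟩ := hs _ hx'
    have h3 : 0 < x' := by linarith
    rw [Real.norm_eq_abs, abs_mul, abs_mul, abs_of_pos (by positivity : 0 < x'⁻¹), mul_assoc, mul_assoc, mul_assoc]
    gcongr
    · exact hB _
    · refine (kernz.le _).trans ?_
      gcongr
      exact exp_dom hσ h3 (by linarith) (by simp [h3.le])
  · obtain ⟨h1, h2⟩ := hs _ hx'
    have h3 : 0 < x' := by linarith
    have h := (k0_deriv ((y - x) / x')).comp x' ((hasDerivAt_inv h3.ne').const_mul (y - x))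
    refine (h.const_mul (φ y)).congr_deriv ?_
    simp only [kz]
    field_simp

lemma W_one {k k' : ℝ → ℝ} (hk : Kern k) (hk' : Kern k')
    (hd : ∀ z, HasDerivAt k (-k' z) z) (σ x : ℝ) : W k' (fun _ => 1) σ x = 0 := by
  have := W_dx hk hk' hd (φ := fun _ => 1) (B := 1) (by fun_prop) (by simp) one_pos 0
  have h2 : HasDerivAt (fun x => W k (fun _ => 1) 1 x) 0 0 := by
    simp only [W]; exact hasDerivAt_const _ _
  have := this.unique h2
  simpa [W] using this

lemma W2_holder {φ : ℝ → ℝ} {B H α σ : ℝ} (hφ : Continuous φ) (hB : ∀ x, |φ x| ≤ B)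
    (h0 : 0 < α) (h1 : α < 1) (hH : ∀ x y, |φ x - φ y| ≤ H * |x - y| ^ α) (hσ : 0 < σ) (x : ℝ) :
    |W k2 φ σ x| ≤ 512 * H * σ ^ α := by
  have hH0 : 0 ≤ H := by
    have := (abs_nonneg _).trans (hH 1 0); simpa using this
  have e : W k2 φ σ x = ∫ z, (φ (x + σ * z) - φ x) * k2 z := by
    have := W_one kern1 kern2 k1_deriv σ x
    have i1 := W_int kern2 hφ hB σ x
    have i2 := (W_int (φ := fun _ => 1) (B := 1) kern2 (by fun_prop) (by simp) σ x).const_mul (φ x)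
    have := MeasureTheory.integral_sub i1 i2
    rw [MeasureTheory.integral_const_mul] at this
    simp only [W] at *
    simp_rw [sub_mul]
    simp_all
  rw [e]
  have := MeasureTheory.norm_integral_le_of_norm_le (integrable_exp_abs.const_mul (H * σ^α * 256))
    (f := fun z => (φ (x + σ * z) - φ x) * k2 z) (Eventually.of_forall fun z => by
      rw [Real.norm_eq_abs, abs_mul, mul_assoc]
      have a1 := hH (x + σ * z) x
      rw [show x + σ * z - x = σ * z by ring, abs_mul, abs_of_pos hσ,
        Real.mul_rpow hσ.le (abs_nonneg _)] at a1
      have a2 : |z| ^ α ≤ 1 + |z| := by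
        rcases le_total |z| 1 with h | h
        · linarith [Real.rpow_le_one (abs_nonneg z) h h0.le, abs_nonneg z]
        · have := Real.rpow_le_rpow_of_exponent_le h h1.le
          rw [Real.rpow_one] at this; linarith
      calc _ ≤ H * (σ^α * |z|^α) * |k2 z| := by gcongr
        _ = H * σ^α * (|k2 z| * |z|^α) := by ring
        _ ≤ H * σ^α * (|k2 z| * (1 + |z|)) := by gcongr
        _ ≤ _ := mul_le_mul_of_nonneg_left (kern2.2 z) (by positivity))
  rw [MeasureTheory.integral_const_mul, integral_exp_abs, Real.norm_eq_abs] at this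
  linarith
end

noncomputable section

def Sg (d r : ℝ) : ℝ := 2 * √(d * r)

lemma Sg_cont (d : ℝ) : Continuous (Sg d) := by unfold Sg; fun_prop
lemma Sg_pos {d r : ℝ} (hd : 0 < d) (hr : 0 < r) : 0 < Sg d r := by unfold Sg; positivity
lemma Sg_nonneg {d r : ℝ} : 0 ≤ Sg d r := by unfold Sg; positivity
lemma Sg_zero {d r : ℝ} (hd : 0 < d) (hr : r ≤ 0) : Sg d r = 0 := by
  unfold Sg; rw [Real.sqrt_eq_zero_of_nonpos (by nlinarith)]; simp

lemma Sg_int {d β : ℝ} (hd : 0 < d) (h1 : -2 < β) (h2 : β < 0) (a b : ℝ) :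
    IntervalIntegrable (fun r => (Sg d r) ^ β) MeasureTheory.volume a b := by
  have h := (intervalIntegral.intervalIntegrable_rpow' (r := β/2) (a := a) (b := b) (by linarith)).const_mul
    ((2 * √d) ^ β)
  refine h.mono_fun (Measurable.aestronglyMeasurable ?_) (Eventually.of_forall fun r => ?_)
  · exact ((Sg_cont d).measurable).pow_const β
  · rcases le_or_gt r 0 with hr | hr
    · simp only [Sg_zero hd hr, Real.zero_rpow h2.ne, norm_zero]; positivity
    · simp only
      have : Sg d r = (2 * √d) * √r := by unfold Sg; rw [Real.sqrt_mul hd.le]; ring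
      rw [this, Real.mul_rpow (by positivity) (by positivity), Real.sqrt_eq_rpow r, ← Real.rpow_mul hr.le]
      rw [show 1 / 2 * β = β / 2 by ring]

def A0 (d : ℝ) (F : ℝ → ℝ → ℝ) (r s x : ℝ) : ℝ := (√Real.pi)⁻¹ * W k0 (F s) (Sg d r) x
def A1 (d : ℝ) (F : ℝ → ℝ → ℝ) (r s x : ℝ) : ℝ := (√Real.pi)⁻¹ * ((Sg d r)⁻¹ * W k1 (F s) (Sg d r) x)
def A2 (d : ℝ) (F : ℝ → ℝ → ℝ) (r s x : ℝ) : ℝ :=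
  (√Real.pi)⁻¹ * ((Sg d r)⁻¹ * ((Sg d r)⁻¹ * W k2 (F s) (Sg d r) x))

def V0 (d : ℝ) (F : ℝ → ℝ → ℝ) (t x : ℝ) : ℝ := ∫ s in (0:ℝ)..t, A0 d F (t - s) s x
def V1 (d : ℝ) (F : ℝ → ℝ → ℝ) (t x : ℝ) : ℝ := ∫ s in (0:ℝ)..t, A1 d F (t - s) s x
def V2 (d : ℝ) (F : ℝ → ℝ → ℝ) (t x : ℝ) : ℝ := ∫ s in (0:ℝ)..t, A2 d F (t - s) s x

lemma sqrtpi_pos : 0 < √Real.pi := Real.sqrt_pos.2 Real.pi_pos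

section
variable {d B H α : ℝ} {F : ℝ → ℝ → ℝ}

lemma A0_cont (hF : Continuous fun q : ℝ × ℝ => F q.1 q.2) (hB : ∀ s x, |F s x| ≤ B) :
    Continuous fun q : ℝ × ℝ × ℝ => A0 d F q.1 q.2.1 q.2.2 := by
  have h1 := W_cont kern0 hF hB
  have h2 := Sg_cont d
  exact continuous_const.mul (h1.comp (by fun_prop : Continuous fun q : ℝ × ℝ × ℝ => (q.2.1, Sg d q.1, q.2.2)))

lemma A1_meas (hF : Continuous fun q : ℝ × ℝ => F q.1 q.2) (hB : ∀ s x, |F s x| ≤ B) :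
    Measurable fun q : ℝ × ℝ × ℝ => A1 d F q.1 q.2.1 q.2.2 := by
  have h1 := W_cont kern1 hF hB
  have h2 := Sg_cont d
  have h3 := h1.comp (by fun_prop : Continuous fun q : ℝ × ℝ × ℝ => (q.2.1, Sg d q.1, q.2.2))
  have h4 : Measurable fun q : ℝ × ℝ × ℝ => Sg d q.1 := (h2.comp continuous_fst).measurable
  exact measurable_const.mul (h4.inv.mul h3.measurable)

lemma A2_meas (hF : Continuous fun q : ℝ × ℝ => F q.1 q.2) (hB : ∀ s x, |F s x| ≤ B) :
    Measurable fun q : ℝ × ℝ × ℝ => A2 d F q.1 q.2.1 q.2.2 := by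
  have h1 := W_cont kern2 hF hB
  have h2 := Sg_cont d
  have h3 := h1.comp (by fun_prop : Continuous fun q : ℝ × ℝ × ℝ => (q.2.1, Sg d q.1, q.2.2))
  have h4 : Measurable fun q : ℝ × ℝ × ℝ => Sg d q.1 := (h2.comp continuous_fst).measurable
  exact measurable_const.mul (h4.inv.mul (h4.inv.mul h3.measurable))

lemma A0_bound (hB : ∀ s x, |F s x| ≤ B) (r s x : ℝ) : |A0 d F r s x| ≤ B := by
  have := W0_bound (hB s) (Sg d r) x
  rw [A0, abs_mul, abs_of_pos (inv_pos.2 sqrtpi_pos), inv_mul_le_iff₀ sqrtpi_pos]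
  linarith

lemma A0_zero (hd : 0 < d) (s x : ℝ) : A0 d F 0 s x = F s x := by
  rw [A0, Sg_zero hd le_rfl, W]
  simp only [zero_mul, add_zero]
  rw [MeasureTheory.integral_const_mul, integral_k0]
  have := sqrtpi_pos
  field_simp

lemma A1_bound (hB : ∀ s x, |F s x| ≤ B) (r s x : ℝ) : |A1 d F r s x| ≤ (√Real.pi)⁻¹ * (512 * B) * (Sg d r) ^ (-1:ℝ) := by
  have := W_bound kern1 (hB s) (Sg d r) x
  have h0 := sqrtpi_pos
  have h1 : 0 ≤ Sg d r := Sg_nonneg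
  rw [A1, abs_mul, abs_of_pos (inv_pos.2 h0), abs_mul, abs_of_nonneg (inv_nonneg.2 h1), Real.rpow_neg_one, mul_assoc,
    mul_comm (512 * B)]
  gcongr

lemma A2_bound (hd : 0 < d) (hF : Continuous fun q : ℝ × ℝ => F q.1 q.2) (hB : ∀ s x, |F s x| ≤ B)
    (h0 : 0 < α) (h1 : α < 1) (hH : ∀ s x y, |F s x - F s y| ≤ H * |x - y| ^ α) (r s x : ℝ) :
    |A2 d F r s x| ≤ (√Real.pi)⁻¹ * (512 * H) * (Sg d r) ^ (α - 2) := by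
  have hp := sqrtpi_pos
  rcases le_or_gt r 0 with hr | hr
  · simp [A2, Sg_zero hd hr, Real.zero_rpow (by linarith : α - 2 ≠ 0)]
  · have hs := Sg_pos hd hr
    have := W2_holder (hF.comp (by fun_prop : Continuous fun x : ℝ => (s, x))) (hB s) h0 h1 (hH s) hs x
    have e : (Sg d r) ^ (α - 2) = (Sg d r)⁻¹ * ((Sg d r)⁻¹ * (Sg d r)^α) := by
      rw [Real.rpow_sub hs, Real.rpow_two]; field_simp
    rw [A2, abs_mul, abs_of_pos (inv_pos.2 hp), abs_mul, abs_of_pos (inv_pos.2 hs), abs_mul,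
      abs_of_pos (inv_pos.2 hs), e]
    calc _ ≤ (√Real.pi)⁻¹ * ((Sg d r)⁻¹ * ((Sg d r)⁻¹ * (512 * H * Sg d r ^ α))) := by gcongr; exact this
      _ = _ := by ring

lemma A0_dx (hd : 0 < d) (hF : Continuous fun q : ℝ × ℝ => F q.1 q.2) (hB : ∀ s x, |F s x| ≤ B)
    {r : ℝ} (hr : 0 < r) (s x : ℝ) : HasDerivAt (fun x => A0 d F r s x) (A1 d F r s x) x :=
  (W_dx kern0 kern1 k0_deriv (hF.comp (by fun_prop : Continuous fun x : ℝ => (s, x))) (hB s)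
    (Sg_pos hd hr) x).const_mul _

lemma A1_dx (hd : 0 < d) (hF : Continuous fun q : ℝ × ℝ => F q.1 q.2) (hB : ∀ s x, |F s x| ≤ B)
    {r : ℝ} (hr : 0 < r) (s x : ℝ) : HasDerivAt (fun x => A1 d F r s x) (A2 d F r s x) x :=
  ((W_dx kern1 kern2 k1_deriv (hF.comp (by fun_prop : Continuous fun x : ℝ => (s, x))) (hB s)
    (Sg_pos hd hr) x).const_mul _).const_mul _

lemma A0_dr (hd : 0 < d) (hF : Continuous fun q : ℝ × ℝ => F q.1 q.2) (hB : ∀ s x, |F s x| ≤ B)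
    {r : ℝ} (hr : 0 < r) (s x : ℝ) : HasDerivAt (fun r => A0 d F r s x) (d * A2 d F r s x) r := by
  have hs := Sg_pos hd hr
  have h1 := W_dσ (hF.comp (by fun_prop : Continuous fun x : ℝ => (s, x))) (hB s) hs x
  have h2 : HasDerivAt (Sg d) (2 * (d / (2 * √(d * r)))) r := by
    have := (((hasDerivAt_id r).const_mul d).sqrt (by simp; exact ⟨hd.ne', hr.ne'⟩)).const_mul 2
    refine (this.congr_of_eventuallyEq (Eventually.of_forall fun q => ?_)).congr_deriv ?_
    · simp [Sg]
    · simp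
  have h3 := (h1.comp r h2).const_mul (√Real.pi)⁻¹
  refine h3.congr_deriv ?_
  have e : 2 * √(d * r) = Sg d r := rfl
  rw [A2, e]
  have : (fun x => F s x) = F s := rfl
  simp only [Function.comp_def]
  field_simp

lemma ae_ne' (t : ℝ) : ∀ᵐ s : ℝ, s ≠ t := by
  rw [MeasureTheory.ae_iff]; simp

lemma V0_cont (hF : Continuous fun q : ℝ × ℝ => F q.1 q.2) (hB : ∀ s x, |F s x| ≤ B) :
    Continuous fun q : ℝ × ℝ => V0 d F q.1 q.2 := by
  refine intervalIntegral.continuous_parametric_intervalIntegral_of_continuous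
    (f := fun (q : ℝ × ℝ) s => A0 d F (q.1 - s) s q.2) ?_ continuous_fst
  exact (A0_cont hF hB).comp (by fun_prop : Continuous fun q : (ℝ × ℝ) × ℝ => (q.1.1 - q.2, q.2, q.1.2))

lemma V0_bound (hB : ∀ s x, |F s x| ≤ B) {t : ℝ} (ht : 0 ≤ t) (x : ℝ) : |V0 d F t x| ≤ B * t := by
  have := intervalIntegral.norm_integral_le_of_norm_le_const (a := 0) (b := t)
    (f := fun s => A0 d F (t - s) s x) (C := B) (fun s _ => A0_bound hB _ _ _)
  simpa [abs_of_nonneg ht, V0] using this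

lemma Sg_int' {β : ℝ} (hd : 0 < d) (h1 : -2 < β) (h2 : β < 0) (t a b : ℝ) :
    IntervalIntegrable (fun s => (Sg d (t - s)) ^ β) MeasureTheory.volume a b := by
  have := (Sg_int hd h1 h2 (t - a) (t - b)).comp_sub_left t
  simpa using this

lemma V0_dx (hd : 0 < d) (hF : Continuous fun q : ℝ × ℝ => F q.1 q.2) (hB : ∀ s x, |F s x| ≤ B)
    {t : ℝ} (ht : 0 ≤ t) (x : ℝ) : HasDerivAt (fun x => V0 d F t x) (V1 d F t x) x := by
  refine (intervalIntegral.hasDerivAt_integral_of_dominated_loc_of_deriv_le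
    (F := fun x s => A0 d F (t - s) s x) (F' := fun x s => A1 d F (t - s) s x) (s := univ) univ_mem
    (bound := fun s => (√Real.pi)⁻¹ * (512 * B) * (Sg d (t - s)) ^ (-1:ℝ)) ?_ ?_ ?_ ?_ ?_ ?_).2
  · refine Eventually.of_forall fun x => Continuous.aestronglyMeasurable ?_
    exact (A0_cont hF hB).comp (by fun_prop : Continuous fun s : ℝ => (t - s, s, x))
  · refine Continuous.intervalIntegrable ?_ _ _
    exact (A0_cont hF hB).comp (by fun_prop : Continuous fun s : ℝ => (t - s, s, x))
  · refine Measurable.aestronglyMeasurable ?_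
    exact (A1_meas hF hB).comp (by fun_prop : Measurable fun s : ℝ => (t - s, s, x))
  · exact Eventually.of_forall fun s _ x _ => A1_bound hB _ _ _
  · exact (Sg_int' hd (by norm_num) (by norm_num) t 0 t).const_mul _
  · filter_upwards [ae_ne' t] with s hs hs2 x _
    rw [uIoc_of_le ht] at hs2
    exact A0_dx hd hF hB (by have := lt_of_le_of_ne hs2.2 hs; linarith) s x

lemma V1_dx (hd : 0 < d) (hF : Continuous fun q : ℝ × ℝ => F q.1 q.2) (hB : ∀ s x, |F s x| ≤ B)
    (h0 : 0 < α) (h1 : α < 1) (hH : ∀ s x y, |F s x - F s y| ≤ H * |x - y| ^ α)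
    {t : ℝ} (ht : 0 ≤ t) (x : ℝ) : HasDerivAt (fun x => V1 d F t x) (V2 d F t x) x := by
  refine (intervalIntegral.hasDerivAt_integral_of_dominated_loc_of_deriv_le
    (F := fun x s => A1 d F (t - s) s x) (F' := fun x s => A2 d F (t - s) s x) (s := univ) univ_mem
    (bound := fun s => (√Real.pi)⁻¹ * (512 * H) * (Sg d (t - s)) ^ (α - 2)) ?_ ?_ ?_ ?_ ?_ ?_).2
  · refine Eventually.of_forall fun x => Measurable.aestronglyMeasurable ?_
    exact (A1_meas hF hB).comp (by fun_prop : Measurable fun s : ℝ => (t - s, s, x))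
  · refine ((Sg_int' hd (by norm_num) (by norm_num) t 0 t).const_mul ((√Real.pi)⁻¹ * (512 * B))).mono_fun' (g := fun s => (√Real.pi)⁻¹ * (512 * B) * (Sg d (t - s)) ^ (-1:ℝ)) ?_ (Eventually.of_forall fun s => A1_bound hB _ _ _)
    refine Measurable.aestronglyMeasurable ?_
    exact (A1_meas hF hB).comp (by fun_prop : Measurable fun s : ℝ => (t - s, s, x))
  · refine Measurable.aestronglyMeasurable ?_
    exact (A2_meas hF hB).comp (by fun_prop : Measurable fun s : ℝ => (t - s, s, x))
  · exact Eventually.of_forall fun s _ x _ => A2_bound hd hF hB h0 h1 hH _ _ _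
  · exact (Sg_int' hd (by linarith) (by linarith) t 0 t).const_mul _
  · filter_upwards [ae_ne' t] with s hs hs2 x _
    rw [uIoc_of_le ht] at hs2
    exact A1_dx hd hF hB (by have := lt_of_le_of_ne hs2.2 hs; linarith) s x

lemma V1_bound (hd : 0 < d) (hB : ∀ s x, |F s x| ≤ B) (T : ℝ) :
    ∃ C, 0 ≤ C ∧ ∀ t, 0 ≤ t → t ≤ T → ∀ x, |V1 d F t x| ≤ C := by
  have hB0 : 0 ≤ B := (abs_nonneg _).trans (hB 0 0)
  have hp := sqrtpi_pos
  have hnn : ∀ r, 0 ≤ (√Real.pi)⁻¹ * (512 * B) * (Sg d r) ^ (-1:ℝ) := fun r => by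
    have : 0 ≤ Sg d r := Sg_nonneg
    positivity
  have hintg := fun a b => (Sg_int hd (β := -1) (by norm_num) (by norm_num) a b).const_mul ((√Real.pi)⁻¹ * (512 * B))
  refine ⟨|∫ r in (0:ℝ)..T, (√Real.pi)⁻¹ * (512 * B) * (Sg d r) ^ (-1:ℝ)|, abs_nonneg _, fun t h0 hT x => ?_⟩
  have := intervalIntegral.norm_integral_le_of_norm_le (a := 0) (b := t) (μ := MeasureTheory.volume) h0
    (f := fun s => A1 d F (t - s) s x) (g := fun s => (√Real.pi)⁻¹ * (512 * B) * (Sg d (t - s)) ^ (-1:ℝ))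
    (Eventually.of_forall fun s _ => A1_bound hB _ _ _)
    ((Sg_int' hd (by norm_num) (by norm_num) t 0 t).const_mul _)
  rw [intervalIntegral.integral_comp_sub_left (fun r => (√Real.pi)⁻¹ * (512 * B) * (Sg d r) ^ (-1:ℝ))] at this
  simp only [sub_self, sub_zero] at this
  refine this.trans (le_trans ?_ (le_abs_self _))
  rw [← intervalIntegral.integral_add_adjacent_intervals (hintg 0 t) (hintg t T)]
  have := intervalIntegral.integral_nonneg (μ := MeasureTheory.volume) hT (fun r _ => hnn r)
  linarith
end
end

noncomputable section
section
variable {d B H α : ℝ} {F : ℝ → ℝ → ℝ}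

lemma A2_contr (hd : 0 < d) (hF : Continuous fun q : ℝ × ℝ => F q.1 q.2) (hB : ∀ s x, |F s x| ≤ B)
    {r : ℝ} (hr : 0 < r) (x : ℝ) : Continuous fun s => A2 d F r s x := by
  have h1 := W_cont kern2 hF hB
  have h3 := h1.comp (by fun_prop : Continuous fun s : ℝ => (s, Sg d r, x))
  exact continuous_const.mul (continuous_const.mul (continuous_const.mul h3))

lemma A2_nonpos (hd : 0 < d) {r : ℝ} (hr : r ≤ 0) (s x : ℝ) : A2 d F r s x = 0 := by
  simp [A2, Sg_zero hd hr]

lemma A2_ii (hd : 0 < d) (hF : Continuous fun q : ℝ × ℝ => F q.1 q.2) (hB : ∀ s x, |F s x| ≤ B)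
    (h0 : 0 < α) (h1 : α < 1) (hH : ∀ s x y, |F s x - F s y| ≤ H * |x - y| ^ α)
    (t a b x : ℝ) : IntervalIntegrable (fun s => A2 d F (t - s) s x) MeasureTheory.volume a b := by
  refine ((Sg_int' hd (by linarith) (by linarith) t a b).const_mul ((√Real.pi)⁻¹ * (512 * H))).mono_fun' (g := fun s => (√Real.pi)⁻¹ * (512 * H) * (Sg d (t - s)) ^ (α - 2)) ?_ (Eventually.of_forall fun s => A2_bound hd hF hB h0 h1 hH _ _ _)
  refine Measurable.aestronglyMeasurable ?_
  exact (A2_meas hF hB).comp (by fun_prop : Measurable fun s : ℝ => (t - s, s, x))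

lemma A2_ii' (hd : 0 < d) (hF : Continuous fun q : ℝ × ℝ => F q.1 q.2) (hB : ∀ s x, |F s x| ≤ B)
    (h0 : 0 < α) (h1 : α < 1) (hH : ∀ s x y, |F s x - F s y| ≤ H * |x - y| ^ α)
    (s a b x : ℝ) : IntervalIntegrable (fun τ => A2 d F (τ - s) s x) MeasureTheory.volume a b := by
  have hh : IntervalIntegrable (fun τ => (√Real.pi)⁻¹ * (512 * H) * (Sg d (τ - s)) ^ (α - 2)) MeasureTheory.volume a b := by
    have := (Sg_int hd (β := α - 2) (by linarith) (by linarith) (a - s) (b - s)).comp_sub_right s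
    simp only [sub_add_cancel] at this
    exact this.const_mul _
  refine hh.mono_fun' ?_ (Eventually.of_forall fun s => A2_bound hd hF hB h0 h1 hH _ _ _)
  refine Measurable.aestronglyMeasurable ?_
  exact (A2_meas hF hB).comp (by fun_prop : Measurable fun τ : ℝ => (τ - s, s, x))

lemma V2_ext (hd : 0 < d) (hF : Continuous fun q : ℝ × ℝ => F q.1 q.2) (hB : ∀ s x, |F s x| ≤ B)
    (h0 : 0 < α) (h1 : α < 1) (hH : ∀ s x y, |F s x - F s y| ≤ H * |x - y| ^ α)
    {t T : ℝ} (hT : t ≤ T) (x : ℝ) : V2 d F t x = ∫ s in (0:ℝ)..T, A2 d F (t - s) s x := by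
  have hi := A2_ii hd hF hB h0 h1 hH t
  rw [← intervalIntegral.integral_add_adjacent_intervals (hi 0 t x) (hi t T x)]
  have : ∫ s in t..T, A2 d F (t - s) s x = 0 := by
    rw [intervalIntegral.integral_congr (g := fun _ => 0)]
    · simp
    · intro s hs
      rw [uIcc_of_le hT] at hs
      exact A2_nonpos hd (by linarith [hs.1]) s x
  rw [this, add_zero, V2]

lemma V2_cont (hd : 0 < d) (hF : Continuous fun q : ℝ × ℝ => F q.1 q.2) (hB : ∀ s x, |F s x| ≤ B)
    (h0 : 0 < α) (h1 : α < 1) (hH : ∀ s x y, |F s x - F s y| ≤ H * |x - y| ^ α)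
    {t : ℝ} (ht : 0 < t) (x : ℝ) : ContinuousAt (fun t => V2 d F t x) t := by
  have e : (fun t => V2 d F t x) =ᶠ[𝓝 t]
      fun τ => ∫ r in (0:ℝ)..(t + 1), if r < τ then A2 d F r (τ - r) x else 0 := by
    filter_upwards [Ioo_mem_nhds ht (lt_add_one t)] with τ hτ
    have e1 : V2 d F τ x = ∫ r in (0:ℝ)..τ, A2 d F r (τ - r) x := by
      have := intervalIntegral.integral_comp_sub_left (a := 0) (b := τ) (fun r => A2 d F r (τ - r) x) τ
      simp only [sub_sub_cancel, sub_self, sub_zero] at this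
      rw [V2, this]
    rw [e1, intervalIntegral.integral_of_le hτ.1.le, intervalIntegral.integral_of_le (by linarith)]
    rw [MeasureTheory.integral_Ioc_eq_integral_Ioo]
    have : (fun r => if r < τ then A2 d F r (τ - r) x else 0) = indicator (Iio τ) (fun r => A2 d F r (τ - r) x) := by
      ext r; simp [indicator]
    rw [this, MeasureTheory.setIntegral_indicator measurableSet_Iio]
    congr 2
    ext r; simp only [mem_Ioo, mem_inter_iff, mem_Ioc, mem_Iio]
    constructor
    · rintro ⟨a, b⟩; exact ⟨⟨a, by linarith [hτ.2]⟩, b⟩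
    · rintro ⟨⟨a, b⟩, c⟩; exact ⟨a, c⟩
  refine ContinuousAt.congr ?_ e.symm
  refine intervalIntegral.continuousAt_of_dominated_interval
    (bound := fun r => (√Real.pi)⁻¹ * (512 * H) * (Sg d r) ^ (α - 2)) ?_ ?_ ?_ ?_
  · refine Eventually.of_forall fun τ => Measurable.aestronglyMeasurable ?_
    refine Measurable.ite measurableSet_Iio ?_ measurable_const
    exact (A2_meas hF hB).comp (by fun_prop : Measurable fun r : ℝ => (r, τ - r, x))
  · refine Eventually.of_forall fun τ => Eventually.of_forall fun r _ => ?_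
    split_ifs
    · exact A2_bound hd hF hB h0 h1 hH _ _ _
    · have hH0 : 0 ≤ H := by
        have := (abs_nonneg _).trans (hH 0 1 0); simpa using this
      have : 0 ≤ Sg d r := Sg_nonneg
      have := sqrtpi_pos
      rw [norm_zero]; positivity
  · exact (Sg_int hd (by linarith) (by linarith) _ _).const_mul _
  · filter_upwards [ae_ne' t] with r hr hr2
    rw [uIoc_of_le (by linarith)] at hr2
    rcases lt_or_gt_of_ne hr with h | h
    · have : (fun τ => A2 d F r (τ - r) x) =ᶠ[𝓝 t] fun τ => if r < τ then A2 d F r (τ - r) x else 0 := by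
        filter_upwards [lt_mem_nhds h] with τ hτ
        rw [if_pos hτ]
      refine ContinuousAt.congr ?_ this
      exact ((A2_contr hd hF hB hr2.1 x).comp (by fun_prop : Continuous fun τ => τ - r)).continuousAt
    · have : (fun _ => (0:ℝ)) =ᶠ[𝓝 t] fun τ => if r < τ then A2 d F r (τ - r) x else 0 := by
        filter_upwards [gt_mem_nhds h] with τ hτ
        rw [if_neg (by linarith)]
      exact continuousAt_const.congr this

lemma A2_prod (hd : 0 < d) (hF : Continuous fun q : ℝ × ℝ => F q.1 q.2) (hB : ∀ s x, |F s x| ≤ B)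
    (h0 : 0 < α) (h1 : α < 1) (hH : ∀ s x y, |F s x - F s y| ≤ H * |x - y| ^ α)
    {t : ℝ} (ht : 0 ≤ t) (x : ℝ) : MeasureTheory.Integrable (fun q : ℝ × ℝ => A2 d F (q.1 - q.2) q.2 x)
      ((MeasureTheory.volume.restrict (Ioc 0 t)).prod (MeasureTheory.volume.restrict (Ioc 0 t))) := by
  have i1 : MeasureTheory.Integrable (indicator (Ioc (-t) t) (fun r => (√Real.pi)⁻¹ * (512 * H) * (Sg d r) ^ (α - 2))) := by
    rw [MeasureTheory.integrable_indicator_iff measurableSet_Ioc]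
    have := (Sg_int hd (β := α - 2) (by linarith) (by linarith) (-t) t).const_mul ((√Real.pi)⁻¹ * (512 * H))
    rwa [intervalIntegrable_iff_integrableOn_Ioc_of_le (by linarith)] at this
  have i2 : MeasureTheory.Integrable (indicator (Ioc 0 t) (fun _ => (1:ℝ))) := by
    rw [MeasureTheory.integrable_indicator_iff measurableSet_Ioc]
    simp
  have i3 := i2.convolution_integrand (ContinuousLinearMap.mul ℝ ℝ) i1
  rw [MeasureTheory.Measure.prod_restrict]
  refine (i3.integrableOn (s := Ioc 0 t ×ˢ Ioc 0 t)).mono' ?_ ?_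
  · refine Measurable.aestronglyMeasurable ?_
    exact (A2_meas hF hB).comp (by fun_prop : Measurable fun q : ℝ × ℝ => (q.1 - q.2, q.2, x))
  · refine (MeasureTheory.ae_restrict_iff' (measurableSet_Ioc.prod measurableSet_Ioc)).2 (Eventually.of_forall fun q hq => ?_)
    simp only [ContinuousLinearMap.mul_apply']
    rw [indicator_of_mem hq.2, indicator_of_mem, one_mul]
    · exact A2_bound hd hF hB h0 h1 hH _ _ _
    · have h1 := hq.1; have h2 := hq.2
      exact ⟨by linarith [h1.1, h2.2], by linarith [h1.2, h2.1]⟩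

lemma V0_formula (hd : 0 < d) (hF : Continuous fun q : ℝ × ℝ => F q.1 q.2) (hB : ∀ s x, |F s x| ≤ B)
    (h0 : 0 < α) (h1 : α < 1) (hH : ∀ s x y, |F s x - F s y| ≤ H * |x - y| ^ α)
    {t : ℝ} (ht : 0 ≤ t) (x : ℝ) :
    IntervalIntegrable (fun τ => V2 d F τ x) MeasureTheory.volume 0 t ∧
    V0 d F t x = ∫ τ in (0:ℝ)..t, (d * V2 d F τ x + F τ x) := by
  have hFx : Continuous fun s => F s x := hF.comp (by fun_prop : Continuous fun s : ℝ => (s, x))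
  have hA0 : Continuous fun s => A0 d F (t - s) s x :=
    (A0_cont hF hB).comp (by fun_prop : Continuous fun s : ℝ => (t - s, s, x))
  have hI := A2_prod hd hF hB h0 h1 hH ht x
  have e : ∀ τ ∈ Ioc 0 t, ∫ s in Ioc 0 t, A2 d F (τ - s) s x = V2 d F τ x := by
    intro τ hτ
    rw [V2_ext hd hF hB h0 h1 hH hτ.2, intervalIntegral.integral_of_le ht]
  have hV2 : IntervalIntegrable (fun τ => V2 d F τ x) MeasureTheory.volume 0 t := by
    rw [intervalIntegrable_iff_integrableOn_Ioc_of_le ht]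
    have := hI.integral_prod_left
    refine MeasureTheory.IntegrableOn.congr_fun this (fun τ hτ => e τ hτ) measurableSet_Ioc
  refine ⟨hV2, ?_⟩
  rw [intervalIntegral.integral_add (hV2.const_mul d) (hFx.intervalIntegrable _ _),
    intervalIntegral.integral_const_mul]
  have e2 : ∫ τ in (0:ℝ)..t, V2 d F τ x = ∫ s in Ioc 0 t, ∫ τ in Ioc 0 t, A2 d F (τ - s) s x := by
    rw [intervalIntegral.integral_of_le ht, ← MeasureTheory.integral_integral_swap hI]
    exact MeasureTheory.setIntegral_congr_fun measurableSet_Ioc (fun τ hτ => (e τ hτ).symm)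
  have e3 : ∀ s ∈ Ioc 0 t, ∫ τ in Ioc 0 t, A2 d F (τ - s) s x = d⁻¹ * (A0 d F (t - s) s x - F s x) := by
    intro s hs
    have hi := A2_ii' hd hF hB h0 h1 hH s
    rw [← intervalIntegral.integral_of_le ht, ← intervalIntegral.integral_add_adjacent_intervals (hi 0 s x) (hi s t x)]
    have z : ∫ τ in (0:ℝ)..s, A2 d F (τ - s) s x = 0 := by
      rw [intervalIntegral.integral_congr (g := fun _ => 0)]
      · simp
      · intro τ hτ
        rw [uIcc_of_le hs.1.le] at hτ
        exact A2_nonpos hd (by linarith [hτ.2]) s x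
    have := intervalIntegral.integral_eq_sub_of_hasDerivAt_of_le (f := fun τ => A0 d F (τ - s) s x)
      (f' := fun τ => d * A2 d F (τ - s) s x) hs.2
      (((A0_cont hF hB).comp (by fun_prop : Continuous fun τ : ℝ => (τ - s, s, x))).continuousOn)
      (fun τ hτ => by
        have := (A0_dr hd hF hB (sub_pos.2 hτ.1) s x).comp τ ((hasDerivAt_id τ).sub_const s)
        refine this.congr_deriv ?_
        simp) ((hi s t x).const_mul d)
    rw [intervalIntegral.integral_const_mul, sub_self, A0_zero hd] at this
    rw [z, ← this]; field_simp; ring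
  rw [e2, MeasureTheory.setIntegral_congr_fun measurableSet_Ioc e3, ← intervalIntegral.integral_of_le ht,
    intervalIntegral.integral_const_mul, intervalIntegral.integral_sub (hA0.intervalIntegrable _ _) (hFx.intervalIntegrable _ _), V0]
  field_simp; ring

lemma V0_dt (hd : 0 < d) (hF : Continuous fun q : ℝ × ℝ => F q.1 q.2) (hB : ∀ s x, |F s x| ≤ B)
    (h0 : 0 < α) (h1 : α < 1) (hH : ∀ s x y, |F s x - F s y| ≤ H * |x - y| ^ α)
    {t : ℝ} (ht : 0 < t) (x : ℝ) :
    HasDerivAt (fun t => V0 d F t x) (d * V2 d F t x + F t x) t := by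
  have hFx : Continuous fun s => F s x := hF.comp (by fun_prop : Continuous fun s : ℝ => (s, x))
  have hc : ∀ τ > 0, ContinuousAt (fun τ => d * V2 d F τ x + F τ x) τ := fun τ hτ =>
    ((V2_cont hd hF hB h0 h1 hH hτ x).const_mul d).add hFx.continuousAt
  have hi := (((V0_formula hd hF hB h0 h1 hH ht.le x).1.const_mul d).add (hFx.intervalIntegrable _ _))
  have h := intervalIntegral.integral_hasDerivAt_right hi
    ((ContinuousOn.stronglyMeasurableAtFilter isOpen_Ioi
      (fun τ (hτ : τ ∈ Ioi 0) => (hc τ hτ).continuousWithinAt)) t ht) (hc t ht)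
  refine h.congr_of_eventuallyEq ?_
  filter_upwards [lt_mem_nhds ht] with τ hτ
  exact (V0_formula hd hF hB h0 h1 hH hτ.le x).2
end
end

noncomputable section

lemma A0_diff {d B δ : ℝ} {F G : ℝ → ℝ → ℝ} (hF : Continuous fun q : ℝ × ℝ => F q.1 q.2) (hB : ∀ s x, |F s x| ≤ B)
    (hG : Continuous fun q : ℝ × ℝ => G q.1 q.2) (hB' : ∀ s x, |G s x| ≤ B) (r s x : ℝ)
    (hδ : ∀ y, |F s y - G s y| ≤ δ) : |A0 d F r s x - A0 d G r s x| ≤ δ := by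
  have i1 := W_int kern0 (hF.comp (by fun_prop : Continuous fun x : ℝ => (s, x))) (hB s) (Sg d r) x
  have i2 := W_int kern0 (hG.comp (by fun_prop : Continuous fun x : ℝ => (s, x))) (hB' s) (Sg d r) x
  have e : A0 d F r s x - A0 d G r s x = A0 d (fun s x => F s x - G s x) r s x := by
    simp only [A0, W]
    rw [← mul_sub]
    congr 1
    simp only [Function.comp_def] at i1 i2
    rw [← MeasureTheory.integral_sub i1 i2]
    simp only [sub_mul]
  rw [e]
  have := W0_bound (φ := fun y => F s y - G s y) hδ (Sg d r) x
  rw [A0, abs_mul, abs_of_pos (inv_pos.2 sqrtpi_pos), inv_mul_le_iff₀ sqrtpi_pos]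
  linarith

lemma mild {d B K ε : ℝ} (hK : 0 < K) {ft : ℝ → ℝ → ℝ → ℝ}
    (hc : Continuous fun q : ℝ × ℝ × ℝ => ft q.1 q.2.1 q.2.2) (hB : ∀ t x u, |ft t x u| ≤ B)
    (hLip : ∀ t x u v, |ft t x u - ft t x v| ≤ K * |u - v|) :
    ∃ v : ℝ → ℝ → ℝ, (Continuous fun q : ℝ × ℝ => v q.1 q.2) ∧
      ∀ t ≥ 0, ∀ x, v t x = ε + V0 d (fun s x => ft s x (v s x)) t x := by
  classical
  have hB0 : 0 ≤ B := (abs_nonneg _).trans (hB 0 0 0)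
  let X := BoundedContinuousFunction (ℝ × ℝ) ℝ
  let Fw : X → ℝ → ℝ → ℝ := fun w s x => ft s x (Real.exp (2 * K * max s 0) * w (s, x))
  have hFc : ∀ w : X, Continuous fun q : ℝ × ℝ => Fw w q.1 q.2 := by
    intro w
    have hw := w.continuous
    exact hc.comp (by fun_prop : Continuous fun q : ℝ × ℝ => (q.1, q.2, Real.exp (2 * K * max q.1 0) * w (q.1, q.2)))
  have hFB : ∀ w : X, ∀ s x, |Fw w s x| ≤ B := fun w s x => hB _ _ _
  have hcont : ∀ w : X, Continuous fun q : ℝ × ℝ => Real.exp (-(2 * K * max q.1 0)) * (ε + V0 d (Fw w) (max q.1 0) q.2) := by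
    intro w
    have h1 := (V0_cont (d := d) (hFc w) (hFB w)).comp (by fun_prop : Continuous fun q : ℝ × ℝ => (max q.1 0, q.2))
    refine Continuous.mul (by fun_prop) (continuous_const.add h1)
  have hbd : ∀ w : X, ∀ q : ℝ × ℝ, ‖Real.exp (-(2 * K * max q.1 0)) * (ε + V0 d (Fw w) (max q.1 0) q.2)‖ ≤ |ε| + B / (2 * K) := by
    intro w q
    set t := max q.1 0 with ht
    have ht0 : 0 ≤ t := le_max_right _ _
    have h1 := V0_bound (d := d) (hFB w) ht0 q.2
    have h2 : |ε + V0 d (Fw w) t q.2| ≤ |ε| + B * t := (abs_add_le _ _).trans (by linarith)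
    rw [Real.norm_eq_abs, abs_mul, abs_of_pos (Real.exp_pos _)]
    have h3 : Real.exp (-(2 * K * t)) ≤ 1 := Real.exp_le_one_iff.2 (neg_nonpos.2 (by positivity))
    have h4 : Real.exp (-(2 * K * t)) * t ≤ 1 / (2 * K) := by
      rw [Real.exp_neg, ← div_eq_inv_mul, div_le_div_iff₀ (Real.exp_pos _) (by positivity)]
      linarith [Real.add_one_le_exp (2 * K * t)]
    calc _ ≤ Real.exp (-(2 * K * t)) * (|ε| + B * t) := by gcongr
      _ = Real.exp (-(2 * K * t)) * |ε| + B * (Real.exp (-(2 * K * t)) * t) := by ring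
      _ ≤ 1 * |ε| + B * (1 / (2 * K)) := by gcongr
      _ = _ := by ring
  let Φ : X → X := fun w => BoundedContinuousFunction.ofNormedAddCommGroup _ (hcont w) _ (hbd w)
  have hΦ : ∀ w q, Φ w q = Real.exp (-(2 * K * max q.1 0)) * (ε + V0 d (Fw w) (max q.1 0) q.2) := fun w q => rfl
  have hcon : ContractingWith (1/2) Φ := by
    refine ⟨by norm_num, LipschitzWith.of_dist_le_mul fun w w' => ?_⟩
    rw [BoundedContinuousFunction.dist_le (by positivity)]
    intro q
    rw [Real.dist_eq, hΦ, hΦ, ← mul_sub, abs_mul, abs_of_pos (Real.exp_pos _)]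
    set t := max q.1 0 with ht
    have ht0 : 0 ≤ t := le_max_right _ _
    set D := dist w w' with hD
    have hw : ∀ p : ℝ × ℝ, |w p - w' p| ≤ D := fun p => by
      have := BoundedContinuousFunction.dist_coe_le_dist (f := w) (g := w') p
      rwa [Real.dist_eq] at this
    have hs : ∀ s ∈ Ioc 0 t, ‖A0 d (Fw w) (t - s) s q.2 - A0 d (Fw w') (t - s) s q.2‖ ≤ D / 2 * (2 * K * Real.exp (2 * K * s)) := by
      intro s hs
      refine A0_diff (hFc w) (hFB w) (hFc w') (hFB w') _ _ _ fun y => ?_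
      refine (hLip _ _ _ _).trans ?_
      rw [← mul_sub, abs_mul, abs_of_pos (Real.exp_pos _), max_eq_left hs.1.le]
      have := hw (s, y)
      calc _ ≤ K * (Real.exp (2 * K * s) * D) := by gcongr
        _ = _ := by ring
    have hA : ∀ w : X, Continuous fun s => A0 d (Fw w) (t - s) s q.2 := fun w =>
      (A0_cont (hFc w) (hFB w)).comp (by fun_prop : Continuous fun s : ℝ => (t - s, s, q.2))
    have h1 := intervalIntegral.norm_integral_le_of_norm_le (μ := MeasureTheory.volume) ht0
      (Eventually.of_forall hs) (Continuous.intervalIntegrable (by fun_prop) _ _)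
    rw [intervalIntegral.integral_sub ((hA w).intervalIntegrable _ _) ((hA w').intervalIntegrable _ _),
      intervalIntegral.integral_const_mul] at h1
    have h2 : ∫ s in (0:ℝ)..t, 2 * K * Real.exp (2 * K * s) = Real.exp (2 * K * t) - 1 := by
      rw [intervalIntegral.integral_eq_sub_of_hasDerivAt (f := fun s => Real.exp (2 * K * s))]
      · simp
      · intro s _
        have := ((hasDerivAt_id s).const_mul (2 * K)).exp
        refine this.congr_deriv ?_
        simp; ring
      · exact Continuous.intervalIntegrable (by fun_prop) _ _
    rw [h2] at h1
    have h3 : |ε + V0 d (Fw w) t q.2 - (ε + V0 d (Fw w') t q.2)| ≤ D / 2 * Real.exp (2 * K * t) := by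
      rw [add_sub_add_left_eq_sub]
      refine (show _ ≤ _ from h1).trans ?_
      have : 0 ≤ D := dist_nonneg
      nlinarith
    calc _ ≤ Real.exp (-(2 * K * t)) * (D / 2 * Real.exp (2 * K * t)) := by gcongr
      _ = D / 2 * (Real.exp (-(2 * K * t)) * Real.exp (2 * K * t)) := by ring
      _ = _ := by rw [← Real.exp_add]; norm_num; ring
  haveI : Nonempty X := ⟨0⟩
  set w : X := hcon.fixedPoint Φ with hw
  have hfix : Φ w = w := hcon.fixedPoint_isFixedPt
  refine ⟨fun t x => Real.exp (2 * K * max t 0) * w (t, x), ?_, fun t ht x => ?_⟩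
  · have := w.continuous
    fun_prop
  · have h1 : w (t, x) = Φ w (t, x) := by rw [hfix]
    show Real.exp (2 * K * max t 0) * w (t, x) = ε + V0 d (Fw w) t x
    rw [h1, hΦ]
    simp only [max_eq_left (show (0:ℝ) ≤ t from ht)]
    rw [← mul_assoc, ← Real.exp_add]; simp
end

noncomputable section

lemma max_prin {d T C m : ℝ} (hd : 0 < d) {w : ℝ → ℝ → ℝ}
    (hc : ContinuousOn (fun q : ℝ × ℝ => w q.1 q.2) {q | 0 ≤ q.1})
    (hC : ∀ t, 0 ≤ t → t ≤ T → ∀ x, w t x ≤ C) (h0 : ∀ x, w 0 x ≤ m)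
    (H : ∀ t, 0 < t → t ≤ T → ∀ x, m < w t x → (∀ᶠ y in 𝓝 x, DifferentiableAt ℝ (w t) y) ∧
      DifferentiableAt ℝ (deriv (w t)) x ∧ ∃ a, HasDerivAt (fun s => w s x) a t ∧ a ≤ d * deriv (deriv (w t)) x) :
    ∀ t, 0 ≤ t → t ≤ T → ∀ x, w t x ≤ m := by
  intro t ht htT x
  have key : ∀ δ > 0, w t x < m + δ * (1 + x^2 + (2 * d + 1) * t) := by
    intro δ hδ
    obtain ⟨R, hR1, hR2⟩ : ∃ R, |x| ≤ R ∧ C - m < δ * (1 + R^2) := by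
      refine ⟨|x| + |C - m| / δ + 1, ?_, ?_⟩
      · have : 0 ≤ |C - m| / δ := by positivity
        linarith
      · have h1 : |C - m| / δ + 1 ≤ |x| + |C - m| / δ + 1 := by linarith [abs_nonneg x]
        have h2 : 0 ≤ |C - m| / δ := by positivity
        have h3 : |C - m| / δ < 1 + (|x| + |C - m| / δ + 1)^2 := by nlinarith
        have h4 : |C - m| = δ * (|C - m| / δ) := by field_simp
        calc C - m ≤ |C - m| := le_abs_self _
          _ = δ * (|C - m| / δ) := h4
          _ < _ := by gcongr
    have := master (K := Icc 0 T ×ˢ Icc (-R) R) (isCompact_Icc.prod isCompact_Icc)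
      (h := fun t x => m + δ * (1 + x^2 + (2 * d + 1) * t) - w t x) ?_ ?_ t x ⟨⟨ht, htT⟩, abs_le.1 hR1⟩
    · simpa using this
    · refine ContinuousOn.sub (Continuous.continuousOn (by fun_prop)) (hc.mono ?_)
      rintro ⟨s, y⟩ ⟨h1, -⟩; exact h1.1
    · rintro s y ⟨hs, hy⟩ hle
      simp only at hs hy hle
      have hs0 : 0 < s := by
        rcases hs.1.lt_or_eq with h | h
        · exact h
        · subst h
          exfalso
          have := h0 y
          have : 0 < δ * (1 + y^2 + (2 * d + 1) * 0) := by positivity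
          linarith
      have hyR : y^2 < R^2 := by
        by_contra! hcon
        have a1 := hC s hs.1 hs.2 y
        have : δ * (1 + R^2) ≤ δ * (1 + y^2 + (2 * d + 1) * s) := by
          have : 0 ≤ (2 * d + 1) * s := by have := hs.1; positivity
          exact mul_le_mul_of_nonneg_left (by linarith) hδ.le
        linarith
      have hR0 : 0 ≤ R := (abs_nonneg x).trans hR1
      have hyR' := abs_lt.1 (abs_lt_of_sq_lt_sq hyR hR0)
      refine ⟨?_, ?_, fun h0' hmin hpast => ?_⟩
      · filter_upwards [Ioo_mem_nhds hyR'.1 hyR'.2] with z hz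
        exact ⟨hs, hz.1.le, hz.2.le⟩
      · filter_upwards [Ioo_mem_nhdsLT hs0] with z hz
        exact ⟨⟨hz.1.le, by linarith [hz.2, hs.2]⟩, hy⟩
      · have hlt : m < w s y := by
          have : 0 < δ * (1 + y^2 + (2 * d + 1) * s) := by positivity
          linarith
        obtain ⟨b1, b2, a, b3, b4⟩ := H s hs0 hs.2 y hlt
        have c1 : 0 ≤ δ * 2 - deriv (deriv (w s)) y := by
          apply second_deriv_nonneg (φ := fun y => m + δ * (1 + y^2 + (2 * d + 1) * s) - w s y)
            (φ1 := fun y => δ * (2 * y) - deriv (w s) y) (x := y)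
          · filter_upwards [b1] with z hz
            have e1 : HasDerivAt (fun y : ℝ => m + δ * (1 + y^2 + (2 * d + 1) * s)) (δ * (2 * z)) z := by
              have := (((((hasDerivAt_pow 2 z).const_add 1).add_const ((2 * d + 1) * s)).const_mul δ).const_add m)
              refine this.congr_deriv ?_
              simp
            exact e1.sub hz.hasDerivAt
          · have e1 : HasDerivAt (fun y : ℝ => δ * (2 * y)) (δ * 2) y := by
              have := ((hasDerivAt_id y).const_mul 2).const_mul δ
              simpa using this
            exact e1.sub b2.hasDerivAt
          · rw [h0']; exact hmin
        have c2 := deriv_nonpos_of_past (φ := fun s => m + δ * (1 + y^2 + (2 * d + 1) * s) - w s y) (a := δ * (2 * d + 1) - a) (t := s)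
          (by
            have e1 : HasDerivAt (fun s : ℝ => m + δ * (1 + y^2 + (2 * d + 1) * s)) (δ * (2 * d + 1)) s := by
              have := (((((hasDerivAt_id s).const_mul (2 * d + 1)).const_add (1 + y^2))).const_mul δ).const_add m
              simpa using this
            exact e1.sub b3)
          (by rw [h0']; exact hpast.mono fun s hs => hs.le)
        have : 0 ≤ d * (δ * 2 - deriv (deriv (w s)) y) := by positivity
        nlinarith
  by_contra! hcon
  have hX : 0 < 1 + x^2 + (2 * d + 1) * t := by positivity
  have := key ((w t x - m) / (1 + x^2 + (2 * d + 1) * t)) (div_pos (by linarith) hX)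
  rw [div_mul_cancel₀ _ hX.ne'] at this
  linarith

lemma classical {d B K ε Cf α : ℝ} (hd : 0 < d) (hK : 0 < K) {ft : ℝ → ℝ → ℝ → ℝ}
    (hc : Continuous fun q : ℝ × ℝ × ℝ => ft q.1 q.2.1 q.2.2) (hB : ∀ t x u, |ft t x u| ≤ B)
    (hLip : ∀ t x u v, |ft t x u - ft t x v| ≤ K * |u - v|) (h0 : 0 < α) (h1 : α < 1)
    (hCf : 0 ≤ Cf) (hH : ∀ t x y u, |ft t x u - ft t y u| ≤ Cf * |x - y| ^ α) :
    ∃ v : ℝ → ℝ → ℝ, (Continuous fun q : ℝ × ℝ => v q.1 q.2) ∧ (∀ x, v 0 x = ε) ∧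
      (∀ t ≥ 0, ∀ x, |v t x| ≤ |ε| + B * t) ∧ SolvesPDE d ft v {q | 0 < q.1} := by
  obtain ⟨v, hvc, hv⟩ := mild (d := d) (ε := ε) hK hc hB hLip
  have hB0 : 0 ≤ B := (abs_nonneg _).trans (hB 0 0 0)
  set F : ℝ → ℝ → ℝ := fun s x => ft s x (v s x) with hFdef
  have hFc : Continuous fun q : ℝ × ℝ => F q.1 q.2 :=
    hc.comp (by fun_prop : Continuous fun q : ℝ × ℝ => (q.1, q.2, v q.1 q.2))
  have hFB : ∀ s x, |F s x| ≤ B := fun s x => hB _ _ _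
  refine ⟨v, hvc, fun x => ?_, fun t ht x => ?_, ?_⟩
  · rw [hv 0 le_rfl]; simp [V0]
  · rw [hv t ht]
    exact (abs_add_le _ _).trans (by linarith [V0_bound (d := d) hFB ht x])
  · rintro ⟨t0, x⟩ ht0
    simp only [Set.mem_ofPred_eq] at ht0
    set T := t0 + 1 with hT
    have hT0 : 0 < T := by linarith
    set G : ℝ → ℝ → ℝ := fun s x => F (max 0 (min s T)) x with hG
    have hGc : Continuous fun q : ℝ × ℝ => G q.1 q.2 :=
      hFc.comp (by fun_prop : Continuous fun q : ℝ × ℝ => (max 0 (min q.1 T), q.2))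
    have hGB : ∀ s x, |G s x| ≤ B := fun s x => hB _ _ _
    have hGF : ∀ s, 0 ≤ s → s ≤ T → G s = F s := fun s h0 h1 => by
      ext x; simp [hG, h1, h0]
    have hvG : ∀ t, 0 ≤ t → t ≤ T → ∀ x, v t x = ε + V0 d G t x := by
      intro t ht htT x
      rw [hv t ht, V0, V0]
      congr 1
      apply intervalIntegral.integral_congr
      intro s hs
      rw [uIcc_of_le ht] at hs
      simp only [A0]
      rw [hGF s hs.1 (hs.2.trans htT)]
    obtain ⟨C, hC0, hC⟩ := V1_bound (d := d) hd hGB T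
    have hvd : ∀ t, 0 ≤ t → t ≤ T → ∀ x, HasDerivAt (v t) (V1 d G t x) x := by
      intro t ht htT x
      have := (V0_dx hd hGc hGB ht x).const_add ε
      exact this.congr_of_eventuallyEq (Eventually.of_forall fun y => hvG t ht htT y)
    have hvl : ∀ t, 0 ≤ t → t ≤ T → ∀ x y, |v t x - v t y| ≤ C * |x - y| := by
      intro t ht htT x y
      have := Convex.norm_image_sub_le_of_norm_hasDerivWithin_le (f := v t) (s := univ) (C := C)
        (fun x _ => (hvd t ht htT x).hasDerivWithinAt) (fun x _ => hC t ht htT x) convex_univ (mem_univ y) (mem_univ x)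
      simpa using this
    have hGH : ∀ s x y, |G s x - G s y| ≤ (Cf + K * C + 2 * B) * |x - y| ^ α := by
      intro s x y
      set τ := max 0 (min s T) with hτ
      have t0 : 0 ≤ τ := le_max_left _ _
      have t1 : τ ≤ T := max_le hT0.le (min_le_right _ _)
      have hp : 0 ≤ |x - y| ^ α := by positivity
      rcases le_total |x - y| 1 with h | h
      · have e1 : |x - y| ≤ |x - y| ^ α := by
          have := Real.rpow_le_rpow_of_exponent_ge' (abs_nonneg (x - y)) h h0.le h1.le
          simpa using this
        have e2 := hH τ x y (v τ x)
        have e3 := (hLip τ y (v τ x) (v τ y)).trans (mul_le_mul_of_nonneg_left (hvl τ t0 t1 x y) hK.le)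
        have e4 : |G s x - G s y| ≤ |ft τ x (v τ x) - ft τ y (v τ x)| + |ft τ y (v τ x) - ft τ y (v τ y)| :=
          abs_sub_le _ _ _
        have e5 : K * (C * |x - y|) ≤ K * C * |x - y| ^ α := by rw [← mul_assoc]; gcongr
        nlinarith [mul_nonneg hB0 hp]
      · have e1 : 1 ≤ |x - y| ^ α := Real.one_le_rpow h h0.le
        have e4 : |G s x - G s y| ≤ |G s x| + |G s y| := abs_sub _ _
        have := hGB s x; have := hGB s y
        have : 0 ≤ (Cf + K * C) * |x - y| ^ α := by positivity
        nlinarith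
    have t0T : t0 ≤ T := by linarith
    have hderiv : deriv (v t0) = fun x => V1 d G t0 x := by
      ext x; exact (hvd t0 ht0.le t0T x).deriv
    have h2 := V1_dx hd hGc hGB h0 h1 hGH ht0.le x
    refine ⟨(hvd t0 ht0.le t0T x).differentiableAt, ?_, ?_⟩
    · simp only; rw [hderiv]; exact h2.differentiableAt
    · simp only
      rw [hderiv, h2.deriv]
      have h3 := (V0_dt hd hGc hGB h0 h1 hGH ht0 x).const_add ε
      rw [hGF t0 ht0.le t0T] at h3
      refine h3.congr_of_eventuallyEq ?_
      filter_upwards [Ioo_mem_nhds ht0 (show t0 < T by linarith)] with t ht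
      exact hvG t ht.1.le ht.2.le x
end

noncomputable section

lemma cauchy_exists {d ω L : ℝ} (hd : 0 < d) (hω : 0 < ω) (hL : 0 < L) {f : ℝ → ℝ → ℝ → ℝ}
    (hf : BasicAssumptions ω L f) {ε : ℝ} (hε : 0 < ε) :
    ∃ v : ℝ → ℝ → ℝ, IsCauchySolution d f (fun _ => ε) v ∧ (Continuous fun q : ℝ × ℝ => v q.1 q.2) ∧
      ∀ t ≥ 0, ∀ x, 0 ≤ v t x := by
  obtain ⟨M, hM, hneg⟩ := hf.neg_large
  obtain ⟨α, hα, hHol⟩ := hf.holder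
  set M1 := max M ε with hM1
  have hM1p : 0 < M1 := hM.trans_le (le_max_left _ _)
  obtain ⟨Cf, hCf, hHol⟩ := hHol M1 hM1p
  obtain ⟨K, hK, hlip⟩ := f_lip hω hL hf M1
  set cl : ℝ → ℝ := fun u => max 0 (min u M1) with hcl
  have cl0 : ∀ u, 0 ≤ cl u := fun u => le_max_left _ _
  have cl1 : ∀ u, cl u ≤ M1 := fun u => max_le hM1p.le (min_le_right _ _)
  have clc : Continuous cl := by fun_prop
  set ft : ℝ → ℝ → ℝ → ℝ := fun t x u => f t x (cl u) with hft
  have hc : Continuous fun q : ℝ × ℝ × ℝ => ft q.1 q.2.1 q.2.2 :=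
    hf.cont.comp_continuous (by fun_prop : Continuous fun q : ℝ × ℝ × ℝ => (q.1, q.2.1, cl q.2.2)) (fun q => cl0 _)
  have hB : ∀ t x u, |ft t x u| ≤ K * M1 := by
    intro t x u
    have := hlip t x (cl u) 0 (cl0 u) (cl1 u) le_rfl hM1p.le
    rw [hf.zero, sub_zero, sub_zero, abs_of_nonneg (cl0 u)] at this
    exact this.trans (by gcongr; exact cl1 u)
  have hcll : ∀ u v, |cl u - cl v| ≤ |u - v| := by
    intro u v
    have h1 := abs_max_sub_max_le_abs (min u M1) (min v M1) 0
    have h2 := abs_min_sub_min_le_max u M1 v M1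
    simp only [sub_self, abs_zero] at h2
    rw [max_eq_left (abs_nonneg _)] at h2
    simp only [hcl]
    rw [max_comm 0, max_comm 0]
    exact h1.trans h2
  have hLip : ∀ t x u v, |ft t x u - ft t x v| ≤ K * |u - v| := fun t x u v =>
    (hlip t x _ _ (cl0 u) (cl1 u) (cl0 v) (cl1 v)).trans (mul_le_mul_of_nonneg_left (hcll u v) hK.le)
  have hH : ∀ t x y u, |ft t x u - ft t y u| ≤ Cf * |x - y| ^ α := by
    intro t x y u
    have := hHol t t x y (cl u) (cl0 u) (cl1 u)
    rw [sub_self, abs_zero, Real.zero_rpow (by linarith [hα.1]), zero_add] at this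
    exact this
  obtain ⟨v, hvc, hv0, hvb, hvs⟩ := classical (ε := ε) hd hK hc hB hLip hα.1 hα.2 hCf.le hH
  have hloc : ∀ t > 0, ∀ x, LocSol d ft v t x := fun t ht x =>
    hvs.locSol (Eventually.of_forall fun y => ht)
  have hup : ∀ t ≥ 0, ∀ x, v t x ≤ M1 := by
    intro t ht x
    refine max_prin (T := t) (C := |ε| + K * M1 * t) (m := M1) hd hvc.continuousOn ?_ ?_ ?_ t ht le_rfl x
    · intro s h0 h1 x
      refine (le_abs_self _).trans ((hvb s h0 x).trans ?_)
      gcongr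
    · intro x; rw [hv0]; exact le_max_right _ _
    · intro s h0 h1 x hx
      obtain ⟨a, b, c⟩ := hloc s h0 x
      refine ⟨a, b, _, c, ?_⟩
      have : ft s x (v s x) ≤ 0 := hneg _ _ _ (by
        simp only [hcl]; rw [min_eq_right hx.le]
        exact (le_max_left _ _).trans (le_max_right _ _))
      linarith
  have hlo : ∀ t ≥ 0, ∀ x, 0 ≤ v t x := by
    intro t ht x
    have := max_prin (T := t) (C := |ε| + K * M1 * t) (m := 0) (w := fun t x => - v t x) hd hvc.neg.continuousOn ?_ ?_ ?_ t ht le_rfl x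
    · linarith
    · intro s h0 h1 x
      refine (neg_le_abs _).trans ((hvb s h0 x).trans ?_)
      gcongr
    · intro x; rw [hv0]; linarith
    · intro s h0 h1 x hx
      obtain ⟨a, b, c⟩ := hloc s h0 x
      have e1 : deriv (fun x => -v s x) = fun x => - deriv (v s) x := by
        ext y; exact deriv.fun_neg
      have e2 : deriv (deriv (fun x => -v s x)) x = - deriv (deriv (v s)) x := by
        rw [e1]; exact deriv.fun_neg
      refine ⟨a.mono fun y hy => hy.neg, ?_, _, c.neg, ?_⟩
      · rw [e1]; exact b.neg
      · rw [e2]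
        have : ft s x (v s x) = 0 := by
          have : cl (v s x) = 0 := by
            simp only [hcl]; apply max_eq_left; exact (min_le_left _ _).trans (by linarith)
          simp only [hft]; rw [this, hf.zero]
        linarith
  refine ⟨v, ⟨hv0, hvc.continuousOn, ?_, ?_⟩, hvc, hlo⟩
  · intro q hq
    obtain ⟨a, b, c⟩ := hvs q hq
    refine ⟨a, b, c.congr_deriv ?_⟩
    have h1 := hlo q.1 (le_of_lt hq) q.2
    have h2 := hup q.1 (le_of_lt hq) q.2
    simp only [hft, hcl, min_eq_left h2, max_eq_right h1]
  · exact ⟨M1, fun t ht x => abs_le.2 ⟨by linarith [hlo t ht x], hup t ht x⟩⟩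

lemma per_int {φ : ℝ → ℝ} {ω : ℝ} (h : ∀ t, φ (t + ω) = φ t) (n : ℤ) (t : ℝ) : φ (t + n * ω) = φ t := by
  have : Function.Periodic φ ω := h
  exact this.int_mul n t

lemma per_rep {ω : ℝ} (hω : 0 < ω) (t : ℝ) : ∃ n : ℤ, t + n * ω ∈ Icc 0 ω := by
  refine ⟨-⌊t / ω⌋, ?_⟩
  have h1 := Int.floor_le (t / ω)
  have h2 := Int.lt_floor_add_one (t / ω)
  rw [le_div_iff₀ hω] at h1
  rw [div_lt_iff₀ hω] at h2
  push_cast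
  constructor <;> linarith

lemma p_props {d ω L : ℝ} (hd : 0 < d) (hω : 0 < ω) (hL : 0 < L) {f : ℝ → ℝ → ℝ → ℝ}
    (hf : BasicAssumptions ω L f) {p : ℝ → ℝ → ℝ} (hp : HypH d ω L f p) :
    (Continuous fun q : ℝ × ℝ => p q.1 q.2) ∧ ∃ m > 0, ∃ P, ∀ t x, m ≤ p t x ∧ p t x ≤ P := by
  obtain ⟨v, hv, hvc, -⟩ := cauchy_exists hd hω hL hf one_pos
  have hpt : ∀ x (n : ℤ) t, p (t + n * ω) x = p t x := fun x n t =>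
    per_int (φ := fun t => p t x) (fun t => hp.per_t t x) n t
  have hpx : ∀ t (n : ℤ) x, p t (x + n * L) = p t x := fun t n x =>
    per_int (φ := fun x => p t x) (fun x => hp.per_x t x) n x
  have hcont : Continuous fun q : ℝ × ℝ => p q.1 q.2 := by
    refine continuous_of_locally_uniform_approx_of_continuousAt fun q U hU => ?_
    obtain ⟨ε, hε, hεU⟩ := Metric.mem_uniformity_dist.1 hU
    obtain ⟨S, hS⟩ := hp.conv (fun _ => 1) (by fun_prop) ⟨1, by simp⟩ ⟨1, one_pos, by simp⟩ v hv (ε/2) (by positivity)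
    obtain ⟨n, hn⟩ := exists_nat_gt ((S - (q.1 - 1)) / ω)
    rw [div_lt_iff₀ hω] at hn
    refine ⟨{r | q.1 - 1 < r.1}, ?_, fun r => v (r.1 + (n:ℤ) * ω) r.2, ?_, ?_⟩
    · exact (isOpen_lt continuous_const continuous_fst).mem_nhds (by simp)
    · exact (hvc.comp (by fun_prop : Continuous fun r : ℝ × ℝ => (r.1 + (n:ℤ) * ω, r.2))).continuousAt
    · intro r hr
      apply hεU
      have hr : q.1 - 1 < r.1 := hr
      have := hS (r.1 + (n:ℤ) * ω) (by push_cast; linarith) 0 le_rfl r.2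
      rw [zero_add, hpt, abs_sub_comm] at this
      rw [Real.dist_eq]
      linarith
  refine ⟨hcont, ?_⟩
  have hne : (Icc 0 ω ×ˢ Icc 0 L : Set (ℝ × ℝ)).Nonempty := ⟨(0,0), by simp [hω.le, hL.le]⟩
  obtain ⟨q1, hq1, h1⟩ := (isCompact_Icc.prod isCompact_Icc).exists_isMinOn hne hcont.continuousOn
  obtain ⟨q2, hq2, h2⟩ := (isCompact_Icc.prod isCompact_Icc).exists_isMaxOn hne hcont.continuousOn
  refine ⟨p q1.1 q1.2, hp.pos _ _, p q2.1 q2.2, fun t x => ?_⟩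
  obtain ⟨n, hn⟩ := per_rep hω t
  obtain ⟨k, hk⟩ := per_rep hL x
  have e : p t x = p (t + n * ω) (x + k * L) := by rw [hpx, hpt]
  rw [e]
  exact ⟨h1 (show (_, _) ∈ _ from ⟨hn, hk⟩), h2 (show (_, _) ∈ _ from ⟨hn, hk⟩)⟩
end

noncomputable section

/-- collected data on the periodic problem -/
structure Ctx (d μ ω L M K m : ℝ) (f : ℝ → ℝ → ℝ → ℝ) (p : ℝ → ℝ → ℝ) : Prop where
  hd : 0 < d
  hμ : 0 < μ
  hω : 0 < ω
  hL : 0 < L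
  hK : 0 < K
  hM : 0 < M
  hm : 0 < m
  zero : ∀ t x, f t x 0 = 0
  lip : ∀ t x a b, 0 ≤ a → a ≤ M → 0 ≤ b → b ≤ M → |f t x a - f t x b| ≤ K * |a - b|
  per_t : ∀ (n : ℤ) t x u, 0 ≤ u → f (t + n * ω) x u = f t x u
  per_x : ∀ (n : ℤ) t x u, 0 ≤ u → f t (x + n * L) u = f t x u
  pc : Continuous fun q : ℝ × ℝ => p q.1 q.2
  pm : ∀ t x, m ≤ p t x
  pM : ∀ t x, p t x ≤ M
  ppt : ∀ (n : ℤ) t x, p (t + n * ω) x = p t x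
  ppx : ∀ (n : ℤ) t x, p t (x + n * L) = p t x
  psol : ∀ t x, LocSol d f p t x
  conv : ∀ ε > 0, ε ≤ M → ∃ v : ℝ → ℝ → ℝ, (Continuous fun q : ℝ × ℝ => v q.1 q.2) ∧
    (∀ x, v 0 x = ε) ∧ (∀ t ≥ 0, ∀ x, 0 ≤ v t x ∧ v t x ≤ M) ∧ (∀ t > 0, ∀ x, LocSol d f v t x) ∧
    ∀ δ > 0, ∃ S, ∀ s ≥ S, ∀ x, |v s x - p s x| ≤ δ

lemma ctx_exists {d μ ω L : ℝ} (hd : 0 < d) (hμ : 0 < μ) (hω : 0 < ω) (hL : 0 < L)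
    {f : ℝ → ℝ → ℝ → ℝ} (hf : BasicAssumptions ω L f) {p : ℝ → ℝ → ℝ} (hp : HypH d ω L f p) :
    ∃ M K m, Ctx d μ ω L M K m f p := by
  obtain ⟨hpc, m, hm, P, hmP⟩ := p_props hd hω hL hf hp
  obtain ⟨M0, hM0, hneg⟩ := hf.neg_large
  obtain ⟨K, hK, hlip⟩ := f_lip hω hL hf (max P M0)
  have hM : 0 < max P M0 := lt_max_of_lt_right hM0
  have pt : ∀ (n : ℤ) t x u, 0 ≤ u → f (t + n * ω) x u = f t x u := fun n t x u hu =>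
    per_int (φ := fun t => f t x u) (fun t => hf.per_t t x u hu) n t
  have px : ∀ (n : ℤ) t x u, 0 ≤ u → f t (x + n * L) u = f t x u := fun n t x u hu =>
    per_int (φ := fun x => f t x u) (fun x => hf.per_x t x u hu) n x
  refine ⟨max P M0, K, m, hd, hμ, hω, hL, hK, hM, hm, hf.zero, hlip, pt, px, hpc,
    fun t x => (hmP t x).1, fun t x => (hmP t x).2.trans (le_max_left _ _),
    fun n t x => per_int (φ := fun t => p t x) (fun t => hp.per_t t x) n t,
    fun n t x => per_int (φ := fun x => p t x) (fun x => hp.per_x t x) n x,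
    fun t x => hp.sol.locSol (Eventually.of_forall fun y => mem_univ _), ?_⟩
  intro ε hε hεM
  obtain ⟨v, hv, hvc, hv0⟩ := cauchy_exists hd hω hL hf hε
  have hloc : ∀ t > 0, ∀ x, LocSol d f v t x := fun t ht x =>
    hv.pde.locSol (Eventually.of_forall fun y => ht)
  obtain ⟨C, hC⟩ := hv.bdd
  refine ⟨v, hvc, hv.init, fun t ht x => ⟨hv0 t ht x, ?_⟩, hloc, ?_⟩
  · refine max_prin (T := t) (C := C) (m := max P M0) hd hvc.continuousOn ?_ ?_ ?_ t ht le_rfl x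
    · intro s h0 h1 x; exact (le_abs_self _).trans (hC s h0 x)
    · intro x; rw [hv.init]; exact hεM
    · intro s h0 h1 x hx
      obtain ⟨a, b, c⟩ := hloc s h0 x
      refine ⟨a, b, _, c, ?_⟩
      have := hneg s x (v s x) ((le_max_right _ _).trans hx.le)
      linarith
  · intro δ hδ
    obtain ⟨S, hS⟩ := hp.conv (fun _ => ε) continuous_const ⟨ε, fun _ => (abs_of_pos hε).le⟩
      ⟨ε, hε, fun _ => le_rfl⟩ v hv δ hδ
    refine ⟨S, fun s hs x => ?_⟩
    simpa using hS s hs 0 le_rfl x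

/-- shifting solutions -/
lemma LocSol.shift {d : ℝ} {f : ℝ → ℝ → ℝ → ℝ} {u : ℝ → ℝ → ℝ} {t x a b : ℝ}
    (h : LocSol d f u (t + a) (x + b))
    (hf : f (t + a) (x + b) (u (t + a) (x + b)) = f t x (u (t + a) (x + b))) :
    LocSol d f (fun t x => u (t + a) (x + b)) t x := by
  obtain ⟨h1, h2, h3⟩ := h
  have e : deriv (fun x => u (t + a) (x + b)) = fun x => deriv (u (t + a)) (x + b) := by
    ext y; exact deriv_comp_add_const _ _ _
  have hs : ∀ {φ : ℝ → ℝ} {y c : ℝ}, DifferentiableAt ℝ φ (y + c) →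
      DifferentiableAt ℝ (fun z => φ (z + c)) y := by
    intro φ y c h
    exact h.comp y (by fun_prop : DifferentiableAt ℝ (fun z => z + c) y)
  refine ⟨?_, ?_, ?_⟩
  · have : Tendsto (fun y : ℝ => y + b) (𝓝 x) (𝓝 (x + b)) :=
      (continuous_add_const b).tendsto x
    filter_upwards [this.eventually h1] with y hy
    exact hs hy
  · simp only [e]; exact hs h2
  · simp only [e, deriv_comp_add_const]
    rw [← hf]
    exact h3.comp_add_const t a

/-- well behaved solution for all `t ≥ 0` -/
structure Nice (d μ M K : ℝ) (f : ℝ → ℝ → ℝ → ℝ) (p : ℝ → ℝ → ℝ) (u : ℝ → ℝ → ℝ) (g : ℝ → ℝ) :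
    Prop where
  fb : FB d μ M K f u g
  pos : ∀ t ≥ 0, ∀ x, g t < x → 0 < u t x
  dpos : ∀ t ≥ 0, 0 < derivWithin (u t) (Ici (g t)) (g t)
  gc0 : ContinuousOn (fun t => -μ * derivWithin (u t) (Ici (g t)) (g t)) (Ici 0)
  lep : ∀ t ≥ 0, ∀ x, u t x ≤ p t x

lemma derivWithin_shift (φ : ℝ → ℝ) (a b : ℝ) :
    derivWithin (fun x => φ (x + b)) (Ici (a - b)) (a - b) = derivWithin φ (Ici a) a := by
  rw [derivWithin_comp_add_const]
  congr 1
  · ext y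
    rw [mem_vadd_set]
    simp only [mem_Ici, vadd_eq_add]
    constructor
    · rintro ⟨z, hz, rfl⟩; linarith
    · intro h; exact ⟨y - b, by linarith, by ring⟩
  · ring

section
variable {d μ ω L M K m : ℝ} {f : ℝ → ℝ → ℝ → ℝ} {p : ℝ → ℝ → ℝ} {u : ℝ → ℝ → ℝ} {g : ℝ → ℝ}

lemma Nice.nonneg (h : Nice d μ M K f p u g) {t x : ℝ} (ht : 0 ≤ t) : 0 ≤ u t x := by
  rcases lt_trichotomy x (g t) with h1 | h1 | h1
  · rw [h.fb.ext t ht x h1]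
  · rw [h1, h.fb.bc t ht]
  · exact (h.pos t ht x h1).le

lemma Nice.leM (h : Nice d μ M K f p u g) {t x : ℝ} (ht : 0 ≤ t) : u t x ≤ M :=
  (le_abs_self _).trans (h.fb.le t ht x)

lemma Nice.gt_of_pos (h : Nice d μ M K f p u g) {t x : ℝ} (ht : 0 ≤ t) (hx : 0 < u t x) :
    g t < x := by
  by_contra! hle
  rcases hle.lt_or_eq with h1 | h1
  · rw [h.fb.ext t ht x h1] at hx; exact lt_irrefl _ hx
  · rw [h1, h.fb.bc t ht] at hx; exact lt_irrefl _ hx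

lemma Nice.zero_of_le (h : Nice d μ M K f p u g) {t x : ℝ} (ht : 0 ≤ t) (hx : x ≤ g t) :
    u t x = 0 := by
  rcases hx.lt_or_eq with h1 | h1
  · exact h.fb.ext t ht x h1
  · rw [h1, h.fb.bc t ht]

lemma Nice.cont (h : Nice d μ M K f p u g) :
    ContinuousOn (fun q : ℝ × ℝ => u q.1 q.2) {q : ℝ × ℝ | 0 ≤ q.1} := by
  have e : ∀ q ∈ {q : ℝ × ℝ | 0 ≤ q.1}, u q.1 q.2 = u q.1 (max q.2 (g q.1)) := by
    intro q hq
    rcases le_total q.2 (g q.1) with h1 | h1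
    · rw [max_eq_right h1, h.fb.bc _ hq, h.zero_of_le hq h1]
    · rw [max_eq_left h1]
  refine ContinuousOn.congr ?_ e
  have hg : ContinuousOn (fun q : ℝ × ℝ => g q.1) {q : ℝ × ℝ | 0 ≤ q.1} :=
    h.fb.gc.comp continuousOn_fst fun q hq => hq
  have : ContinuousOn (fun q : ℝ × ℝ => (q.1, max q.2 (g q.1))) {q : ℝ × ℝ | 0 ≤ q.1} :=
    continuousOn_fst.prodMk (continuous_max.comp_continuousOn (continuousOn_snd.prodMk hg))
  exact h.fb.uc.comp this fun q hq => ⟨hq, le_max_right _ _⟩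

lemma Nice.anti (h : Nice d μ M K f p u g) : AntitoneOn g (Ici 0) := by
  apply antitoneOn_of_deriv_nonpos (convex_Ici 0) h.fb.gc
  · intro t ht
    rw [interior_Ici] at ht
    exact (h.fb.st t ht).differentiableAt.differentiableWithinAt
  · intro t ht
    rw [interior_Ici] at ht
    rw [(h.fb.st t ht).deriv]
    have := mul_pos h.fb.hμ (h.dpos t (le_of_lt ht))
    linarith

lemma Nice.hasD (h : Nice d μ M K f p u g) {t : ℝ} (ht : 0 ≤ t) :
    HasDerivWithinAt (u t) (derivWithin (u t) (Ici (g t)) (g t)) (Ici (g t)) (g t) := by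
  have : DifferentiableWithinAt ℝ (u t) (Ici (g t)) (g t) := by
    by_contra hn
    have := h.dpos t ht
    rw [derivWithin_zero_of_not_differentiableWithinAt hn] at this
    exact lt_irrefl _ this
  exact this.hasDerivWithinAt

lemma Nice.shift (h : Nice d μ M K f p u g) (c : Ctx d μ ω L M K m f p) (n : ℕ) (k : ℤ) :
    Nice d μ M K f p (fun t x => u (t + n * ω) (x + k * L)) (fun t => g (t + n * ω) - k * L) := by
  have hn : 0 ≤ (n : ℝ) * ω := mul_nonneg n.cast_nonneg c.hω.le
  have hcs : ContinuousOn (fun t : ℝ => t + n * ω) (Ici 0) := by fun_prop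
  have hm : MapsTo (fun t : ℝ => t + n * ω) (Ici 0) (Ici 0) := fun t ht => by
    simp only [mem_Ici] at ht ⊢; linarith
  have key : ∀ t, derivWithin (fun x => u (t + n * ω) (x + k * L)) (Ici (g (t + n * ω) - k * L))
      (g (t + n * ω) - k * L) =
      derivWithin (u (t + n * ω)) (Ici (g (t + n * ω))) (g (t + n * ω)) := fun t =>
    derivWithin_shift _ _ _
  have gc0' : ContinuousOn (fun t => -μ * derivWithin (fun x => u (t + n * ω) (x + k * L))
      (Ici (g (t + n * ω) - k * L)) (g (t + n * ω) - k * L)) (Ici 0) := by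
    simp only [key]
    exact h.gc0.comp hcs hm
  constructor
  · constructor
    · exact c.hd
    · exact c.hμ
    · exact c.hK
    · exact c.hM
    · exact c.zero
    · exact c.lip
    · exact (h.fb.gc.comp hcs hm).sub continuousOn_const
    · refine h.fb.uc.comp (f := fun q : ℝ × ℝ => ((q.1 + n * ω, q.2 + k * L) : ℝ × ℝ))
        (by fun_prop) ?_
      rintro q ⟨h1, h2⟩
      exact ⟨by simp only; linarith, by simp only at *; linarith⟩
    · intro t ht
      simp only [sub_add_cancel]
      exact h.fb.bc _ (by linarith)
    · intro t ht x; exact h.fb.le _ (by linarith) _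
    · intro t ht x hx
      refine LocSol.shift (h.fb.sol _ (by linarith) _ (by linarith)) ?_
      have h0 := h.nonneg (t := t + n * ω) (x := x + k * L) (by linarith)
      rw [c.per_x k _ _ _ h0]
      exact_mod_cast c.per_t n t x _ h0
    · intro t ht
      rw [key]
      exact ((h.fb.st (t + n * ω) (by linarith)).comp_add_const t _).sub_const _
    · exact gc0'.mono Ioi_subset_Ici_self
    · intro t ht x hx
      exact h.fb.ext _ (by linarith) _ (by linarith)
  · intro t ht x hx; exact h.pos _ (by linarith) _ (by linarith)
  · intro t ht; rw [key]; exact h.dpos _ (by linarith)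
  · exact gc0'
  · intro t ht x
    have := h.lep (t + n * ω) (by linarith) (x + k * L)
    rw [c.ppx k] at this
    have e := c.ppt n t x
    push_cast at e
    rwa [e] at this

/-- lower estimate on a half line -/
lemma HL {Λ T T' x1 δ : ℝ} {u v : ℝ → ℝ → ℝ} (c : Ctx d μ ω L M K m f p) (hΛ : Λ = K + d + 1)
    (hδ : 0 ≤ δ)
    (hu : ContinuousOn (fun q : ℝ × ℝ => u q.1 q.2) {q : ℝ × ℝ | q.1 ∈ Icc T T' ∧ x1 ≤ q.2})
    (hv : ContinuousOn (fun q : ℝ × ℝ => v q.1 q.2) {q : ℝ × ℝ | q.1 ∈ Icc T T' ∧ x1 ≤ q.2})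
    (hu0 : ∀ t ∈ Icc T T', ∀ x, 0 ≤ u t x ∧ u t x ≤ M)
    (hv0 : ∀ t ∈ Icc T T', ∀ x, 0 ≤ v t x ∧ v t x ≤ M)
    (hT : ∀ x ≥ x1, v T x - δ ≤ u T x)
    (lu : ∀ t ∈ Ioc T T', ∀ x > x1, LocSol d f u t x)
    (lv : ∀ t ∈ Ioc T T', ∀ x > x1, LocSol d f v t x) :
    ∀ t ∈ Icc T T', ∀ x ≥ x1,
      v t x - (δ + M * Real.exp (-(x - x1))) * Real.exp (Λ * (t - T)) ≤ u t x := by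
  intro t ht x hx
  have := bar_right (u := u) (v := v) (f := f) (T := T) (T' := T') (x1 := x1) (a := δ) (c := M)
    (η := 0) (C := M) (γ := fun _ => x1) c.hd c.hK.le hΛ hδ c.hM.le le_rfl continuousOn_const
    (hu.sub hv) ?_ ?_ ?_ t ht x hx
  · simp only [bar] at this
    linarith
  · intro s hs y _
    linarith [hu0 s hs y, hv0 s hs y]
  · intro s hs y hy hor
    have hΛ0 : 0 < Λ := by rw [hΛ]; linarith [c.hd, c.hK]
    have e1 : 1 ≤ Real.exp (Λ * (s - T)) :=
      Real.one_le_exp (mul_nonneg hΛ0.le (by linarith [hs.1]))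
    have e2 : 0 < M * Real.exp (-(y - x1)) := mul_pos c.hM (Real.exp_pos _)
    simp only [bar, zero_mul, add_zero, sub_zero]
    have e3 : δ + M * Real.exp (-(y - x1)) ≤
        (δ + M * Real.exp (-(y - x1))) * Real.exp (Λ * (s - T)) :=
      le_mul_of_one_le_right (by positivity) e1
    rcases hor with h | h
    · have := hT y hy
      rw [← h] at this e3 ⊢
      linarith
    · have e4 : M * Real.exp (-(y - x1)) = M := by rw [h]; simp
      rw [e4] at e3 ⊢
      linarith [hu0 s hs y, hv0 s hs y]
  · intro s hs y hy _
    have hs' : s ∈ Icc T T' := ⟨hs.1.le, hs.2⟩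
    exact ⟨lu s hs y hy, lv s hs y hy, c.lip _ _ _ _ (hu0 s hs' y).1 (hu0 s hs' y).2
      (hv0 s hs' y).1 (hv0 s hs' y).2⟩
end
end

noncomputable section
section
variable {d μ ω L M K m : ℝ} {f : ℝ → ℝ → ℝ → ℝ} {p : ℝ → ℝ → ℝ} {u u1 u2 : ℝ → ℝ → ℝ}
  {g g1 g2 : ℝ → ℝ}

lemma Nice.bdd (h : Nice d μ M K f p u g) (T : ℝ) : ∃ B ≥ 0, ∀ t ∈ Icc 0 T,
    |-μ * derivWithin (u t) (Ici (g t)) (g t)| ≤ B := by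
  obtain ⟨B, hB⟩ := (isCompact_Icc (a := (0:ℝ)) (b := T)).exists_bound_of_continuousOn
    (h.gc0.mono Icc_subset_Ici_self)
  exact ⟨max B 0, le_max_right _ _, fun t ht => (hB t ht).trans (le_max_left _ _)⟩

/-- order preserved as long as the fronts are ordered -/
lemma cmp_aux (h1 : Nice d μ M K f p u1 g1) (h2 : Nice d μ M K f p u2 g2) {T : ℝ}
    (hg : ∀ t ∈ Icc 0 T, g2 t ≤ g1 t) (h0 : ∀ x, g1 0 ≤ x → u1 0 x ≤ u2 0 x) :
    ∀ t ∈ Icc 0 T, ∀ x, u1 t x ≤ u2 t x := by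
  intro t ht x
  rcases le_total x (g1 t) with hx | hx
  · rw [h1.zero_of_le ht.1 hx]; exact h2.nonneg ht.1
  have := bar_right (u := u2) (v := u1) (f := f) (T := 0) (T' := T) (x1 := 0) (a := 0) (c := 0)
    (η := 0) (C := M) (γ := g1) h1.fb.hd h1.fb.hK.le rfl le_rfl le_rfl le_rfl
    (h1.fb.gc.mono Icc_subset_Ici_self) ?_ ?_ ?_ ?_ t ht x hx
  · simp only [bar] at this; linarith
  · exact (h2.cont.mono fun q hq => hq.1.1).sub (h1.cont.mono fun q hq => hq.1.1)
  · intro s hs y _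
    linarith [h1.leM (x := y) hs.1, h2.nonneg (x := y) hs.1]
  · intro s hs y hy hor
    simp only [bar]
    have : u1 s y ≤ u2 s y := by
      rcases hor with h | h
      · rw [h] at hy ⊢; exact h0 y hy
      · rw [h, h1.fb.bc s hs.1]; exact h2.nonneg hs.1
    linarith
  · intro s hs y hy _
    have hs0 : 0 ≤ s := hs.1.le
    exact ⟨h2.fb.sol s hs.1 y ((hg s ⟨hs0, hs.2⟩).trans_lt hy), h1.fb.sol s hs.1 y hy,
      h1.fb.lip _ _ _ _ (h2.nonneg hs0) (h2.leM hs0) (h1.nonneg hs0) (h1.leM hs0)⟩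

/-- comparison of free boundary solutions -/
lemma CMP (h1 : Nice d μ M K f p u1 g1) (h2 : Nice d μ M K f p u2 g2) {δ : ℝ} (hδ : 0 < δ)
    (h0 : ∀ x, g1 0 ≤ x → u1 0 x + δ ≤ u2 0 x) :
    ∀ t ≥ 0, g2 t ≤ g1 t ∧ ∀ x, u1 t x ≤ u2 t x := by
  have h0' : ∀ x, g1 0 ≤ x → u1 0 x ≤ u2 0 x := fun x hx => by linarith [h0 x hx]
  have hg0 : g2 0 < g1 0 := by
    apply h2.gt_of_pos le_rfl
    have := h0 (g1 0) le_rfl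
    rw [h1.fb.bc 0 le_rfl] at this; linarith
  have key : ∀ t ≥ 0, g2 t < g1 t := by
    intro t ht
    by_contra! hle
    set S := Icc 0 t ∩ (fun s => g1 s - g2 s) ⁻¹' Iic 0 with hS
    have hcg : ContinuousOn (fun s => g1 s - g2 s) (Icc 0 t) :=
      (h1.fb.gc.mono Icc_subset_Ici_self).sub (h2.fb.gc.mono Icc_subset_Ici_self)
    have hSc : IsCompact S := isCompact_Icc.of_isClosed_subset
      (hcg.preimage_isClosed_of_isClosed isClosed_Icc isClosed_Iic) inter_subset_left
    obtain ⟨τ, hτS, hτ⟩ := hSc.exists_isMinOn ⟨t, ⟨ht, le_rfl⟩, by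
      simp only [mem_preimage, mem_Iic]; linarith⟩ continuous_id.continuousOn
    have hlt : ∀ s, 0 ≤ s → s < τ → g2 s < g1 s := by
      intro s hs hsτ
      by_contra! hn
      have : τ ≤ s := hτ (a := s) ⟨⟨hs, hsτ.le.trans hτS.1.2⟩, by
        simp only [mem_preimage, mem_Iic]; linarith⟩
      linarith
    have hτ1 : g1 τ ≤ g2 τ := by have := hτS.2; simp only [mem_preimage, mem_Iic] at this; linarith
    have hτ0 : 0 < τ := by
      rcases hτS.1.1.lt_or_eq with h | h
      · exact h
      · rw [← h] at hτ1; linarith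
    have hτe : g2 τ = g1 τ := by
      refine le_antisymm ?_ hτ1
      have c1 : ContinuousWithinAt (fun s => g1 s - g2 s) (Iio τ) τ := by
        have : ContinuousAt (fun s => g1 s - g2 s) τ :=
          ((h1.fb.st τ hτ0).continuousAt).sub ((h2.fb.st τ hτ0).continuousAt)
        exact this.continuousWithinAt
      have : 0 ≤ g1 τ - g2 τ := by
        refine ge_of_tendsto c1 ?_
        filter_upwards [Ioo_mem_nhdsLT hτ0] with s hs
        linarith [hlt s hs.1.le hs.2]
      linarith
    have hgle : ∀ s ∈ Icc 0 τ, g2 s ≤ g1 s := by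
      intro s hs
      rcases hs.2.lt_or_eq with h | h
      · exact (hlt s hs.1 h).le
      · rw [h, hτe]
    have hord := cmp_aux h1 h2 hgle h0'
    obtain ⟨B, hB, hBd⟩ := h1.bdd τ
    obtain ⟨c, hc, hopf⟩ := hopf (d := d) (K := K) (B := B) (l := 1) (τ := τ) h1.fb.hd h1.fb.hK.le
      hB one_pos
    have hH := hopf f u2 u1 0 τ δ g1 (fun t => -μ * derivWithin (u1 t) (Ici (g1 t)) (g1 t))
      (by linarith) hδ (h1.fb.gc.mono Icc_subset_Ici_self) (fun t ht => h1.fb.st t ht.1)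
      (fun t ht => hBd t ⟨ht.1.le, ht.2⟩)
      ((h2.cont.mono fun q hq => hq.1.1).sub (h1.cont.mono fun q hq => hq.1.1))
      (fun t ht x _ _ => hord t ht x) (fun x hx _ => by linarith [h0 x hx])
      (fun s hs y hy _ _ => ⟨h2.fb.sol s hs.1 y ((hgle s ⟨hs.1.le, hs.2⟩).trans_lt hy),
        h1.fb.sol s hs.1 y hy,
        h1.fb.lip _ _ _ _ (h2.nonneg hs.1.le) (h2.leM hs.1.le) (h1.nonneg hs.1.le)
          (h1.leM hs.1.le)⟩) τ ⟨hτ0.le, le_rfl⟩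
    have D1 := h1.hasD hτ0.le
    have D2 := h2.hasD hτ0.le
    have dd : HasDerivWithinAt (fun x => u2 τ x - u1 τ x)
        (derivWithin (u2 τ) (Ici (g2 τ)) (g2 τ) - derivWithin (u1 τ) (Ici (g1 τ)) (g1 τ))
        (Ici (g1 τ)) (g1 τ) := by
      refine HasDerivWithinAt.sub ?_ D1
      rw [hτe] at D2 ⊢; exact D2
    have hge := derivWithin_ge (η := c * δ / 2) (r := 1 / 2) dd (by norm_num) (by
      rw [h1.fb.bc τ hτ0.le, ← hτe, h2.fb.bc τ hτ0.le, sub_zero]) (by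
      intro y hy
      have := hH (g1 τ + y) (by linarith [hy.1]) (by linarith [hy.2])
      refine le_trans ?_ this
      have e : (g1 τ + y - g1 τ) * (g1 τ + 1 - (g1 τ + y)) = y * (1 - y) := by ring
      rw [e]
      have h3 : y * (1 / 2) ≤ y * (1 - y) :=
        mul_le_mul_of_nonneg_left (by linarith [hy.2]) hy.1.le
      have := mul_le_mul_of_nonneg_left h3 (mul_pos hc hδ).le
      linarith)
    have hder := (h1.fb.st τ hτ0).sub (h2.fb.st τ hτ0)
    have := deriv_nonpos_of_past hder (by
      filter_upwards [Ioo_mem_nhdsLT hτ0] with s hs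
      have := hlt s hs.1.le hs.2
      simp only [Pi.sub_apply]
      linarith)
    have h4 : 0 < c * δ / 2 := by positivity
    have h5 := mul_le_mul_of_nonneg_left hge h1.fb.hμ.le
    have h6 := mul_pos h1.fb.hμ h4
    linarith
  intro t ht
  exact ⟨(key t ht).le, cmp_aux h1 h2 (T := t) (fun s hs => (key s hs.1).le) h0' t ⟨ht, le_rfl⟩⟩

/-- upper bound on the propagation -/
lemma UB (h : Nice d μ M K f p u g) {E η T τ : ℝ} (hE : 0 < E) (hη : 0 < η)
    (hη2 : K < 2 * d / η ^ 2) (hT : 0 ≤ T)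
    (hsm : ∀ t ∈ Icc T (T + τ), ∀ x, g t ≤ x → x ≤ g t + η → u t x < E) :
    ∀ t ∈ Icc T (T + τ), g T - η - 3 * μ * E / η * (t - T) < g t := by
  set s := 3 * μ * E / η with hs
  set gb : ℝ → ℝ := fun t => g T - η - s * (t - T) with hgb
  have hs0 : 0 < s := by have := h.fb.hμ; positivity
  have gbc : Continuous gb := by fun_prop
  intro t ht
  by_contra! hle
  change g t ≤ gb t at hle
  have gsub : Icc T t ⊆ Ici 0 := fun r hr => hT.trans hr.1
  set S := Icc T t ∩ (fun r => g r - gb r) ⁻¹' Iic 0 with hS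
  have hcg : ContinuousOn (fun r => g r - gb r) (Icc T t) := (h.fb.gc.mono gsub).sub gbc.continuousOn
  have hSc : IsCompact S := isCompact_Icc.of_isClosed_subset
    (hcg.preimage_isClosed_of_isClosed isClosed_Icc isClosed_Iic) inter_subset_left
  obtain ⟨r, hrS, hr⟩ := hSc.exists_isMinOn ⟨t, ⟨ht.1, le_rfl⟩, by
    simp only [mem_preimage, mem_Iic]; linarith⟩ continuous_id.continuousOn
  have hlt : ∀ s, T ≤ s → s < r → gb s < g s := by
    intro s hs hsτ
    by_contra! hn
    have : r ≤ s := hr (a := s) ⟨⟨hs, hsτ.le.trans hrS.1.2⟩, by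
      simp only [mem_preimage, mem_Iic]; linarith⟩
    linarith
  have hr1 : g r ≤ gb r := by have := hrS.2; simp only [mem_preimage, mem_Iic] at this; linarith
  have hrT : T < r := by
    rcases hrS.1.1.lt_or_eq with h | h
    · exact h
    · rw [← h] at hr1; simp only [hgb, sub_self, mul_zero, sub_zero] at hr1; linarith
  have hr0 : 0 < r := hT.trans_lt hrT
  have hre : g r = gb r := by
    refine le_antisymm hr1 ?_
    have c1 : ContinuousWithinAt (fun s => g s - gb s) (Iio r) r :=
      ((h.fb.st r hr0).continuousAt.sub gbc.continuousAt).continuousWithinAt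
    have : 0 ≤ g r - gb r := by
      refine ge_of_tendsto c1 ?_
      filter_upwards [Ioo_mem_nhdsLT hrT] with s hs
      linarith [hlt s hs.1.le hs.2]
    linarith
  -- barrier
  set U : ℝ → ℝ → ℝ := fun t x => E * (2 * ((x - gb t) / η) - ((x - gb t) / η) ^ 2) with hU
  have hUpos : ∀ t x, gb t < x → x ≤ gb t + η → 0 < U t x := by
    intro t x h1 h2
    have a1 : 0 < (x - gb t) / η := div_pos (by linarith) hη
    have a2 : (x - gb t) / η ≤ 1 := by rw [div_le_one hη]; linarith
    exact mul_pos hE (by nlinarith)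
  have hUle : ∀ t x, U t x ≤ E := by
    intro t x
    have := mul_nonneg hE.le (sq_nonneg ((x - gb t) / η - 1))
    simp only [hU]; nlinarith
  have hUc : Continuous fun q : ℝ × ℝ => U q.1 q.2 := by
    simp only [hU]
    have : Continuous fun q : ℝ × ℝ => gb q.1 := gbc.comp continuous_fst
    fun_prop
  have hcmp : ∀ T' < r, T < T' → ∀ t ∈ Icc T T', ∀ x, g t ≤ x → x ≤ gb t + η → 0 < 0 - u t x + U t x := by
    intro T' hT'r hTT'
    have hst : ∀ t ∈ Icc T T', t ∈ Icc T (T + τ) := fun a ha =>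
      ⟨ha.1, by linarith [ha.2, hrS.1.2, ht.2]⟩
    refine comp_strip (K := K) (f := f) (u := fun _ _ => 0) (v := u) (E := U)
      (Ex := fun t x => E * (2 * (1 / η) - 2 * ((x - gb t) / η) * (1 / η)))
      (Exx := fun t x => E * (- 2 * (1 / η) * (1 / η)))
      (Et := fun t x => E * (2 * (s / η) - 2 * ((x - gb t) / η) * (s / η)))
      (γ₂ := fun t => gb t + η) h.fb.hd
      (h.fb.gc.mono fun a ha => hT.trans ha.1) (by fun_prop) ?_ ?_ ?_ ?_
    · exact (continuousOn_const.sub (h.cont.mono fun q hq => hT.trans hq.1.1)).add hUc.continuousOn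
    · intro t y
      have h1 : HasDerivAt (fun x => (x - gb t) / η) (1 / η) y :=
        ((hasDerivAt_id y).sub_const _).div_const _
      refine (((h1.const_mul 2).sub (h1.pow 2)).const_mul E).congr_deriv ?_
      simp
    · intro t y
      have h1 : HasDerivAt (fun x => (x - gb t) / η) (1 / η) y :=
        ((hasDerivAt_id y).sub_const _).div_const _
      refine ((((h1.const_mul 2).mul_const (1 / η)).const_sub (2 * (1 / η))).const_mul E).congr_deriv ?_
      ring
    · intro a ha x hx1 hx2 hle
      have ha0 : 0 ≤ a := hT.trans ha.1
      have hgg := hlt a ha.1 (ha.2.trans_lt hT'r)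
      have hUp := hUpos a x (hgg.trans_le hx1) hx2
      have hx1' : g a < x := by
        rcases hx1.lt_or_eq with h' | h'
        · exact h'
        · rw [h.zero_of_le ha0 h'.ge] at hle; linarith
      have hx2' : x < gb a + η := by
        rcases hx2.lt_or_eq with h' | h'
        · exact h'
        · have e : U a x = E := by
            simp only [hU]; rw [h']; field_simp; ring
          have := hsm a (hst a ha) x hx1 (by linarith)
          linarith
      have haT : T < a := by
        rcases ha.1.lt_or_eq with h' | h'
        · exact h'
        · rw [← h'] at hx1' hx2'
          simp only [hgb] at hx2'; linarith
      refine ⟨haT, hx1', hx2', ?_, fun h0 => ⟨locSol_zero h.fb.zero a x,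
        h.fb.sol a (hT.trans_lt haT) x hx1', ?_, ?_⟩⟩
      · have hgbd : HasDerivAt gb (-s) a := by
          refine ((((hasDerivAt_id a).sub_const T).const_mul s).const_sub (g T - η)).congr_deriv ?_
          ring
        have h1 : HasDerivAt (fun b => (x - gb b) / η) (s / η) a := by
          refine ((hgbd.const_sub x).div_const η).congr_deriv ?_
          ring
        refine (((h1.const_mul 2).sub (h1.pow 2)).const_mul E).congr_deriv ?_
        simp
      · exact h.fb.lip _ _ _ _ le_rfl h.fb.hM.le (h.nonneg ha0) (h.leM ha0)
      · rw [abs_of_pos hUp]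
        have a2 : (x - gb a) / η ≤ 1 := by rw [div_le_one hη]; linarith
        have e1 : 0 ≤ E * (2 * (s / η) - 2 * ((x - gb a) / η) * (s / η)) := by
          have : 0 ≤ (1 - (x - gb a) / η) * (s / η) := mul_nonneg (by linarith) (by positivity)
          exact mul_nonneg hE.le (by linarith)
        have e2 : d * (E * (-2 * (1 / η) * (1 / η))) = - (E * (2 * d / η ^ 2)) := by
          field_simp
        rw [e2]
        have e3 := mul_lt_mul_of_pos_left hη2 hE
        have e4 := mul_le_mul_of_nonneg_left (hUle a x) h.fb.hK.le
        linarith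
  have hfin : ∀ x, g r < x → x < gb r + η → u r x ≤ U r x := by
    intro x hx1 hx2
    have cu : ContinuousWithinAt (fun a => u a x - U a x) (Iio r) r := by
      have : ContinuousAt (fun q : ℝ × ℝ => u q.1 q.2) (r, x) := by
        refine h.cont.continuousAt ?_
        have : Ioi (0:ℝ) ×ˢ (univ : Set ℝ) ∈ 𝓝 (r, x) :=
          prod_mem_nhds (Ioi_mem_nhds hr0) univ_mem
        filter_upwards [this] with q hq using le_of_lt hq.1
      have c2 : ContinuousAt (fun a : ℝ => ((a, x) : ℝ × ℝ)) r := by fun_prop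
      have c3 := ContinuousAt.comp (f := fun a : ℝ => ((a, x) : ℝ × ℝ)) (x := r) this c2
      have c4 : Continuous fun a => U a x := hUc.comp (by fun_prop : Continuous fun a : ℝ => ((a, x) : ℝ × ℝ))
      exact (c3.sub c4.continuousAt).continuousWithinAt
    have : u r x - U r x ≤ 0 := by
      refine le_of_tendsto cu ?_
      have e1 : ∀ᶠ a in 𝓝[<] r, g a < x :=
        ((h.fb.st r hr0).continuousAt.eventually (gt_mem_nhds hx1)).filter_mono nhdsWithin_le_nhds
      have e2 : ∀ᶠ a in 𝓝[<] r, x < gb a + η :=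
        (((gbc.add continuous_const).continuousAt (x := r)).eventually (lt_mem_nhds hx2)).filter_mono
          nhdsWithin_le_nhds
      filter_upwards [Ioo_mem_nhdsLT hrT, e1, e2] with a ha h1 h2
      have := hcmp a ha.2 ha.1 a ⟨ha.1.le, le_rfl⟩ x h1.le h2.le
      linarith
    linarith
  have hD := h.hasD hr0.le
  have hDle : derivWithin (u r) (Ici (g r)) (g r) ≤ 2 * E / η := by
    refine le_of_tendsto (slope_tendsto hD) ?_
    filter_upwards [Ioo_mem_nhdsGT (show g r < gb r + η by linarith)] with x hx
    rw [slope_def_field, h.fb.bc r hr0.le, sub_zero, div_le_iff₀ (by linarith [hx.1])]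
    refine (hfin x hx.1 hx.2).trans ?_
    simp only [hU]
    rw [← hre]
    have := mul_nonneg hE.le (sq_nonneg ((x - g r) / η))
    have e : 2 * E / η * (x - g r) = E * (2 * ((x - g r) / η)) := by ring
    rw [e]; linarith
  have hgbd : HasDerivAt gb (-s) r := by
    refine ((((hasDerivAt_id r).sub_const T).const_mul s).const_sub (g T - η)).congr_deriv ?_
    ring
  have := deriv_nonpos_of_past ((h.fb.st r hr0).sub hgbd) (by
    filter_upwards [Ioo_mem_nhdsLT hrT] with a ha
    have := hlt a ha.1.le ha.2
    simp only [Pi.sub_apply]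
    linarith)
  have h5 := mul_le_mul_of_nonneg_left hDle h.fb.hμ.le
  have h6 : s = μ * (2 * E / η) + μ * E / η := by rw [hs]; ring
  have h7 : 0 < μ * E / η := by have := h.fb.hμ; positivity
  linarith
end
end

noncomputable section
section
variable {d μ ω L M K m : ℝ} {f : ℝ → ℝ → ℝ → ℝ} {p : ℝ → ℝ → ℝ} {u : ℝ → ℝ → ℝ}
  {g : ℝ → ℝ}

lemma Nice.unif (h : Nice d μ M K f p u g) {T0 τ X ε : ℝ} (hT0 : 0 ≤ T0) (hε : 0 < ε) :
    ∃ r > 0, ∀ t ∈ Icc T0 (T0 + τ), ∀ x ∈ Icc (-X) X, ∀ y ∈ Icc (-X) X, |x - y| < r →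
      |u t x - u t y| < ε := by
  have hc : ContinuousOn (fun q : ℝ × ℝ => u q.1 q.2) (Icc T0 (T0 + τ) ×ˢ Icc (-X) X) :=
    h.cont.mono fun q hq => hT0.trans hq.1.1
  have := (isCompact_Icc.prod isCompact_Icc).uniformContinuousOn_of_continuous hc
  rw [Metric.uniformContinuousOn_iff] at this
  obtain ⟨r, hr, H⟩ := this ε hε
  refine ⟨r, hr, fun t ht x hx y hy hxy => ?_⟩
  have := H (t, x) ⟨ht, hx⟩ (t, y) ⟨ht, hy⟩ (by
    rw [Prod.dist_eq, dist_self, max_eq_right dist_nonneg]; exact hxy)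
  exact this

lemma rho_deriv {κ T0 t : ℝ} (hκ : 0 < κ) (ht : T0 < t) :
    HasDerivAt (fun t => √(κ * (t - T0))) (κ / (2 * √(κ * (t - T0)))) t := by
  have h1 : HasDerivAt (fun t => κ * (t - T0)) κ t := by
    simpa using ((hasDerivAt_id t).sub_const T0).const_mul κ
  exact h1.sqrt (mul_pos hκ (by linarith)).ne'

lemma bl_lip (h : Nice d μ M K f p u g) {T0 τ κ : ℝ} (hT0 : 0 ≤ T0) (hκ : 0 < κ)
    (hκd : κ * (1 + 4 * K * τ) ≤ d) {t x : ℝ} (ht : t ∈ Ioc T0 (T0 + τ)) (hx1 : g t ≤ x)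
    (hx2 : x ≤ g t + √(κ * (t - T0))) :
    u t x ≤ M * (2 * ((x - g t) / √(κ * (t - T0))) - ((x - g t) / √(κ * (t - T0))) ^ 2) := by
  have hM := h.fb.hM
  have hK := h.fb.hK
  have hd := h.fb.hd
  set ρ : ℝ → ℝ := fun t => √(κ * (t - T0)) with hρ
  change u t x ≤ M * (2 * ((x - g t) / ρ t) - ((x - g t) / ρ t) ^ 2)
  change x ≤ g t + ρ t at hx2
  have ρc : Continuous ρ := by simp only [hρ]; fun_prop
  have ρpos : ∀ t > T0, 0 < ρ t := fun t ht => Real.sqrt_pos.2 (mul_pos hκ (by linarith))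
  have ρsq : ∀ t ≥ T0, ρ t ^ 2 = κ * (t - T0) := fun t ht =>
    Real.sq_sqrt (mul_nonneg hκ.le (by linarith))
  refine le_of_forall_pos_le_add fun ε₀ hε₀ => ?_
  set ε := min ε₀ M with hε
  have hεp : 0 < ε := lt_min hε₀ hM
  have hεM : ε ≤ M := min_le_right _ _
  refine le_trans ?_ (add_le_add_right (min_le_left ε₀ M) _)
  -- initial time
  obtain ⟨T, hTT0, hTt, hTs⟩ : ∃ T > T0, T ≤ t ∧ ∀ x, g T ≤ x → x ≤ g T + ρ T → u T x < ε := by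
    obtain ⟨Y, hY⟩ := (isCompact_Icc (a := T0) (b := T0 + τ)).exists_bound_of_continuousOn
      (h.fb.gc.mono fun a ha => hT0.trans ha.1)
    obtain ⟨r, hr, H⟩ := h.unif (T0 := T0) (τ := τ) (X := Y + 1) hT0 hεp
    have : ∀ᶠ a in 𝓝[>] T0, ρ a < min r 1 := by
      have h1 : Tendsto ρ (𝓝[>] T0) (𝓝 (ρ T0)) := (ρc.tendsto T0).mono_left nhdsWithin_le_nhds
      have h2 : ρ T0 = 0 := by simp [hρ]
      rw [h2] at h1
      exact h1.eventually (gt_mem_nhds (lt_min hr one_pos))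
    obtain ⟨T, hT1, hT2⟩ := (this.and (Ioc_mem_nhdsGT ht.1)).exists
    refine ⟨T, hT2.1, hT2.2, fun x h1 h2 => ?_⟩
    have hTI : T ∈ Icc T0 (T0 + τ) := ⟨hT2.1.le, hT2.2.trans ht.2⟩
    have hTg := abs_le.1 (hY T hTI)
    have m1 := min_le_left r 1
    have m2 := min_le_right r 1
    have := H T hTI x ⟨by linarith [hTg.1], by linarith [hTg.2]⟩ (g T)
      ⟨by linarith [hTg.1], by linarith [hTg.2]⟩ (by
        rw [abs_of_nonneg (by linarith)]; linarith)
    rw [h.fb.bc T (hT0.trans hTI.1), sub_zero] at this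
    exact (abs_lt.1 this).2
  set U : ℝ → ℝ → ℝ := fun t x =>
    M * (2 * ((x - g t) / ρ t) - ((x - g t) / ρ t) ^ 2) + ε with hU
  have hz : ∀ a ≥ T, ∀ x, g a ≤ x → x ≤ g a + ρ a →
      0 ≤ (x - g a) / ρ a ∧ (x - g a) / ρ a ≤ 1 := by
    intro a ha x h1 h2
    have := ρpos a (by linarith)
    exact ⟨div_nonneg (by linarith) this.le, by rw [div_le_one this]; linarith⟩
  have hUpos : ∀ a ≥ T, ∀ x, g a ≤ x → x ≤ g a + ρ a → ε ≤ U a x ∧ U a x ≤ 2 * M := by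
    intro a ha x h1 h2
    obtain ⟨z0, z1⟩ := hz a ha x h1 h2
    set z := (x - g a) / ρ a
    have e1 : 0 ≤ M * (2 * z - z ^ 2) := mul_nonneg hM.le (by nlinarith)
    have e2 : M * (2 * z - z ^ 2) ≤ M * 1 := mul_le_mul_of_nonneg_left (by nlinarith [sq_nonneg (z-1)]) hM.le
    simp only [hU]
    change ε ≤ M * (2 * z - z ^ 2) + ε ∧ M * (2 * z - z ^ 2) + ε ≤ 2 * M
    constructor <;> linarith
  have hsub : Icc T t ⊆ Ici 0 := fun a ha => by simp only [mem_Ici]; linarith [ha.1]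
  have key := comp_strip (K := K) (f := f) (u := fun _ _ => 0) (v := u) (E := U)
      (T := T) (T' := t)
      (Ex := fun t x => M * (2 * (1 / ρ t) - 2 * ((x - g t) / ρ t) * (1 / ρ t)))
      (Exx := fun t x => M * (- 2 * (1 / ρ t) * (1 / ρ t)))
      (Et := fun t x => M * (2 * ((μ * derivWithin (u t) (Ici (g t)) (g t) * ρ t -
        (x - g t) * (κ / (2 * ρ t))) / ρ t ^ 2) - 2 * ((x - g t) / ρ t) * ((μ * derivWithin (u t) (Ici (g t)) (g t) * ρ t -
        (x - g t) * (κ / (2 * ρ t))) / ρ t ^ 2)))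
      (γ₁ := g) (γ₂ := fun t => g t + ρ t) hd
      (h.fb.gc.mono hsub) ((h.fb.gc.mono hsub).add ρc.continuousOn) ?_ ?_ ?_ ?_
      t ⟨hTt, le_rfl⟩ x hx1 hx2
  · simp only [hU] at key; linarith
  · refine (continuousOn_const.sub (h.cont.mono fun q hq => hsub hq.1)).add ?_
    have c1 : ContinuousOn (fun q : ℝ × ℝ => g q.1)
        {q : ℝ × ℝ | q.1 ∈ Icc T t ∧ g q.1 ≤ q.2 ∧ q.2 ≤ g q.1 + ρ q.1} :=
      h.fb.gc.comp continuousOn_fst fun q hq => hsub hq.1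
    have c2 : ContinuousOn (fun q : ℝ × ℝ => (q.2 - g q.1) / ρ q.1)
        {q : ℝ × ℝ | q.1 ∈ Icc T t ∧ g q.1 ≤ q.2 ∧ q.2 ≤ g q.1 + ρ q.1} :=
      (continuousOn_snd.sub c1).div (ρc.comp continuous_fst).continuousOn fun q hq =>
        (ρpos _ (by linarith [hq.1.1])).ne'
    exact (continuousOn_const.mul ((continuousOn_const.mul c2).sub (c2.pow 2))).add continuousOn_const
  · intro t y
    have h1 : HasDerivAt (fun x => (x - g t) / ρ t) (1 / ρ t) y :=
      ((hasDerivAt_id y).sub_const _).div_const _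
    refine ((((h1.const_mul 2).sub (h1.pow 2)).const_mul M).add_const ε).congr_deriv ?_
    simp
  · intro t y
    have h1 : HasDerivAt (fun x => (x - g t) / ρ t) (1 / ρ t) y :=
      ((hasDerivAt_id y).sub_const _).div_const _
    refine ((((h1.const_mul 2).mul_const (1 / ρ t)).const_sub (2 * (1 / ρ t))).const_mul M).congr_deriv ?_
    ring
  · intro a ha y hy1 hy2 hle
    have ha0 : 0 ≤ a := hsub ha
    have haT0 : T0 < a := by linarith [ha.1]
    obtain ⟨hU1, hU2⟩ := hUpos a ha.1 y hy1 hy2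
    have hρa := ρpos a haT0
    have hy1' : g a < y := by
      rcases hy1.lt_or_eq with h' | h'
      · exact h'
      · rw [h.zero_of_le ha0 h'.ge] at hle; linarith
    have hy2' : y < g a + ρ a := by
      rcases hy2.lt_or_eq with h' | h'
      · exact h'
      · have e : U a y = M + ε := by
          simp only [hU]; rw [h']; field_simp; ring
        have := h.leM (x := y) ha0
        linarith
    have haT : T < a := by
      rcases ha.1.lt_or_eq with h' | h'
      · exact h'
      · rw [← h'] at hy1 hy2 hle hU1
        have := hTs y hy1 hy2; linarith
    refine ⟨haT, hy1', hy2', ?_, fun h0 => ⟨locSol_zero h.fb.zero a y,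
      h.fb.sol a (by linarith) y hy1', ?_, ?_⟩⟩
    · have h1 := ((h.fb.st a (by linarith)).const_sub y).div (rho_deriv hκ haT0) hρa.ne'
      have h1' : HasDerivAt (fun b => (y - g b) / ρ b) ((μ * derivWithin (u a) (Ici (g a)) (g a) * ρ a -
        (y - g a) * (κ / (2 * ρ a))) / ρ a ^ 2) a := by
        refine h1.congr_deriv ?_
        simp only [hρ]; ring
      refine ((((h1'.const_mul 2).sub (h1'.pow 2)).const_mul M).add_const ε).congr_deriv ?_
      simp
    · exact h.fb.lip _ _ _ _ le_rfl hM.le (h.nonneg ha0) (h.leM ha0)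
    · rw [abs_of_pos (hεp.trans_le hU1)]
      obtain ⟨z0, z1⟩ := hz a ha.1 y hy1 hy2
      have hD := h.dpos a ha0
      have hs := ρsq a haT0.le
      have hb : a - T0 ≤ τ := by linarith [ha.2, ht.2]
      set z := (y - g a) / ρ a with hzd
      set D := derivWithin (u a) (Ici (g a)) (g a)
      have e0 : (μ * D * ρ a - (y - g a) * (κ / (2 * ρ a))) / ρ a ^ 2 =
          μ * D / ρ a - z * κ / 2 / ρ a ^ 2 := by
        rw [hzd]; field_simp
      rw [e0]
      have e1 : 0 ≤ μ * D / ρ a := by have := h.fb.hμ; positivity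
      set R := 1 / ρ a ^ 2 with hR
      have hRp : 0 < R := by positivity
      have e2 : M * (2 * (μ * D / ρ a - z * κ / 2 / ρ a ^ 2) - 2 * z * (μ * D / ρ a - z * κ / 2 / ρ a ^ 2)) -
          d * (M * (-2 * (1 / ρ a) * (1 / ρ a))) =
          2 * (M * (1 - z) * (μ * D / ρ a)) + M * R * (2 * d - κ * (z * (1 - z))) := by
        rw [hR]; field_simp; ring
      rw [e2]
      have e3 : 0 ≤ M * (1 - z) * (μ * D / ρ a) := mul_nonneg (mul_nonneg hM.le (by linarith)) e1
      have e4 : κ * (z * (1 - z)) ≤ κ * 1 := mul_le_mul_of_nonneg_left (by nlinarith) hκ.le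
      have e5 : R * ρ a ^ 2 = 1 := by rw [hR]; field_simp
      have e6 : 4 * K * ρ a ^ 2 ≤ 4 * K * (κ * τ) := by
        rw [hs]; exact mul_le_mul_of_nonneg_left (mul_le_mul_of_nonneg_left hb hκ.le) (by positivity)
      have e7 : κ + 4 * K * (κ * τ) ≤ d := by
        have : κ + 4 * K * (κ * τ) = κ * (1 + 4 * K * τ) := by ring
        rw [this]; exact hκd
      have e8 : 2 * K * ρ a ^ 2 < 2 * d - κ * (z * (1 - z)) := by
        have : 0 < K * ρ a ^ 2 := by positivity
        linarith
      have e9 := mul_lt_mul_of_pos_left e8 (mul_pos hM hRp)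
      have e10 : M * R * (2 * K * ρ a ^ 2) = K * (2 * M) := by
        linear_combination (2 * K * M) * e5
      have e11 := mul_le_mul_of_nonneg_left hU2 hK.le
      linarith

end
end

noncomputable section
section
variable {d μ ω L M K m : ℝ} {f : ℝ → ℝ → ℝ → ℝ} {p : ℝ → ℝ → ℝ} {u : ℝ → ℝ → ℝ}
  {g : ℝ → ℝ}

/-- no contact in the doubled problem -/
lemma dbl_contact (h : Nice d μ M K f p u g) {τ κ ε e t x y ρ : ℝ} {T0 : ℝ} (hκ : 0 < κ)
    (hκd : κ * (1 + 4 * K * τ) ≤ d) (hε : 0 < ε) (hε2 : 2 * ε * (κ * τ) ≤ M) (he : e ^ 2 = 1)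
    (ht0 : 0 < t) (hT0 : T0 < t) (ht : t ≤ T0 + τ) (hρe : ρ = √(κ * (t - T0)))
    (hy : g t < y) (hxy : y < x) (hxr : x < y + ρ)
    (hmin : ∀ᶠ z in 𝓝 (x, y), 0 ≤ M * (2 * ((z.1 - z.2) / ρ) - ((z.1 - z.2) / ρ) ^ 2) +
      ε * (1 + z.1 ^ 2) - e * (u t z.1 - u t z.2))
    (h0 : M * (2 * ((x - y) / ρ) - ((x - y) / ρ) ^ 2) + ε * (1 + x ^ 2) - e * (u t x - u t y) = 0)
    (hpast : ∀ᶠ s in 𝓝[<] t, 0 < M * (2 * ((x - y) / √(κ * (s - T0))) -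
      ((x - y) / √(κ * (s - T0))) ^ 2) + ε * (1 + x ^ 2) - e * (u s x - u s y)) : False := by
  have hM := h.fb.hM
  have hK := h.fb.hK
  have hd := h.fb.hd
  have hρ : 0 < ρ := by rw [hρe]; exact Real.sqrt_pos.2 (mul_pos hκ (by linarith))
  have hρ2 : ρ ^ 2 = κ * (t - T0) := by
    rw [hρe]; exact Real.sq_sqrt (mul_nonneg hκ.le (by linarith))
  obtain ⟨x1, x2, x3⟩ := h.fb.sol t ht0 x (hy.trans hxy)
  obtain ⟨y1, y2, y3⟩ := h.fb.sol t ht0 y hy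
  -- space
  have cx : Tendsto (fun s : ℝ => x + s) (𝓝 0) (𝓝 x) := by
    have : Continuous fun s : ℝ => x + s := by fun_prop
    simpa using this.tendsto 0
  have cy : Tendsto (fun s : ℝ => y - s) (𝓝 0) (𝓝 y) := by
    have : Continuous fun s : ℝ => y - s := by fun_prop
    simpa using this.tendsto 0
  have hz : ∀ s, HasDerivAt (fun s => (x + s - (y - s)) / ρ) (2 / ρ) s := by
    intro s
    refine ((((hasDerivAt_id s).const_add x).sub ((hasDerivAt_id s).const_sub y)).div_const ρ).congr_deriv ?_
    norm_num
  have sp := second_deriv_nonneg (x := 0)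
    (φ := fun s => M * (2 * ((x + s - (y - s)) / ρ) - ((x + s - (y - s)) / ρ) ^ 2) +
      ε * (1 + (x + s) ^ 2) - e * (u t (x + s) - u t (y - s)))
    (φ1 := fun s => M * (2 * (2 / ρ) - 2 * ((x + s - (y - s)) / ρ) * (2 / ρ)) +
      ε * (2 * (x + s)) - e * (deriv (u t) (x + s) + deriv (u t) (y - s)))
    (φ2 := M * (- 8 / ρ ^ 2) + ε * 2 - e * (deriv (deriv (u t)) x - deriv (deriv (u t)) y))
    (by
      filter_upwards [cx.eventually x1, cy.eventually y1] with s a b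
      have a' : HasDerivAt (fun s => u t (x + s)) (deriv (u t) (x + s)) s :=
        a.hasDerivAt.comp_const_add x s
      have b' : HasDerivAt (fun s => u t (y - s)) (-deriv (u t) (y - s)) s :=
        b.hasDerivAt.comp_const_sub y s
      have q : HasDerivAt (fun s : ℝ => (x + s)) 1 s := (hasDerivAt_id s).const_add x
      refine (((((hz s).const_mul 2).sub ((hz s).pow 2)).const_mul M).add
        (((q.pow 2).const_add 1).const_mul ε)).sub ((a'.sub b').const_mul e) |>.congr_deriv ?_
      simp)
    (by
      have a' : HasDerivAt (fun s => deriv (u t) (x + s)) (deriv (deriv (u t)) x) 0 := by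
        have := HasDerivAt.comp_const_add x 0 (f := deriv (u t)) (f' := deriv (deriv (u t)) x)
          (by simpa using x2.hasDerivAt)
        exact this
      have b' : HasDerivAt (fun s => deriv (u t) (y - s)) (-deriv (deriv (u t)) y) 0 :=
        HasDerivAt.comp_const_sub y 0 (f := deriv (u t)) (by simpa using y2.hasDerivAt)
      have q : HasDerivAt (fun s : ℝ => (x + s)) 1 0 := (hasDerivAt_id 0).const_add x
      refine ((((((hz 0).const_mul 2).mul_const (2 / ρ)).const_sub (2 * (2 / ρ))).const_mul M).add
        ((q.const_mul 2).const_mul ε)).sub ((a'.add b').const_mul e) |>.congr_deriv ?_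
      field_simp
      ring)
    (by
      have cc : Tendsto (fun s : ℝ => ((x + s, y - s) : ℝ × ℝ)) (𝓝 0) (𝓝 (x, y)) := cx.prodMk_nhds cy
      filter_upwards [cc.eventually hmin] with s hs
      simp only [add_zero, sub_zero]
      rw [h0]; exact hs)
  -- time
  have rd := rho_deriv hκ hT0
  rw [← hρe] at rd
  have hzt : HasDerivAt (fun s => (x - y) / √(κ * (s - T0))) (-((x - y) * (κ / (2 * ρ))) / ρ ^ 2) t := by
    have := (hasDerivAt_const t (x - y)).div rd (by rw [← hρe]; exact hρ.ne')
    refine this.congr_deriv ?_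
    rw [← hρe]; ring
  have tm := deriv_nonpos_of_past (((((hzt.const_mul 2).sub (hzt.pow 2)).const_mul M).add_const
    (ε * (1 + x ^ 2))).sub ((x3.sub y3).const_mul e)) (by
      filter_upwards [hpast] with s hs
      simp only [Pi.sub_apply, Pi.pow_apply]
      rw [← hρe, h0]; exact hs.le)
  rw [← hρe] at tm
  -- conclusion
  set z := (x - y) / ρ with hzd
  have z0 : 0 ≤ z := div_nonneg (by linarith) hρ.le
  have z1 : z ≤ 1 := by rw [hzd, div_le_one hρ]; linarith
  set R := 1 / ρ ^ 2 with hR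
  have hRp : 0 < R := by positivity
  have hzt' : -((x - y) * (κ / (2 * ρ))) / ρ ^ 2 = - (z * κ / 2 * R) := by
    rw [hzd, hR]; field_simp
  rw [hzt'] at tm
  have e1 : M * (-8 / ρ ^ 2) = -8 * M * R := by rw [hR]; ring
  rw [e1] at sp
  set A := deriv (deriv (u t)) x
  set B := deriv (deriv (u t)) y
  have hlipx := h.fb.lip t x (u t x) 0 (h.nonneg ht0.le) (h.leM ht0.le) le_rfl hM.le
  have hlipy := h.fb.lip t y (u t y) 0 (h.nonneg ht0.le) (h.leM ht0.le) le_rfl hM.le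
  rw [h.fb.zero, sub_zero, sub_zero, abs_of_nonneg (h.nonneg ht0.le)] at hlipx hlipy
  have hkx := mul_le_mul_of_nonneg_left (h.leM (x := x) ht0.le) hK.le
  have hky := mul_le_mul_of_nonneg_left (h.leM (x := y) ht0.le) hK.le
  set F := f t x (u t x)
  set G := f t y (u t y)
  have hFG : e * (F - G) ≤ 2 * (K * M) := by
    have hF := abs_le.1 (hlipx.trans hkx)
    have hG := abs_le.1 (hlipy.trans hky)
    have : (e - 1) * (e + 1) = 0 := by linear_combination he
    rcases mul_eq_zero.1 this with h1 | h1
    · rw [show e = 1 by linarith]; linarith [hF.2, hG.1]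
    · rw [show e = -1 by linarith]; linarith [hF.1, hG.2]
  have e5 : R * ρ ^ 2 = 1 := by rw [hR]; field_simp
  have s1 := mul_nonneg hd.le sp
  have q1 : M * R * κ * (z * (1 - z)) ≤ M * R * κ * 1 :=
    mul_le_mul_of_nonneg_left (by nlinarith) (by positivity)
  simp only [Nat.cast_ofNat, Nat.add_one_sub_one, pow_one] at tm
  have tm' : -(M * R * κ * (z * (1 - z))) - d * (e * (A - B)) - e * (F - G) ≤ 0 := by
    refine le_trans (le_of_eq ?_) tm
    ring
  have fin : 8 * d * M * R ≤ M * R * κ + 2 * d * ε + 2 * (K * M) := by linarith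
  have fin2 := mul_le_mul_of_nonneg_right fin (sq_nonneg ρ)
  have l1 : 8 * d * M * R * ρ ^ 2 = 8 * d * M := by linear_combination (8 * d * M) * e5
  have l2 : (M * R * κ + 2 * d * ε + 2 * (K * M)) * ρ ^ 2 =
      M * κ + 2 * d * ε * ρ ^ 2 + 2 * K * M * ρ ^ 2 := by linear_combination (M * κ) * e5
  rw [l1, l2] at fin2
  have hρτ : ρ ^ 2 ≤ κ * τ := by
    rw [hρ2]; exact mul_le_mul_of_nonneg_left (by linarith) hκ.le
  have l3 : 2 * d * ε * ρ ^ 2 ≤ d * M := by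
    have a := mul_le_mul_of_nonneg_left hρτ (show 0 ≤ 2 * d * ε by positivity)
    have b := mul_le_mul_of_nonneg_left hε2 hd.le
    linarith
  have l4 : 2 * K * M * ρ ^ 2 + M * κ ≤ d * M := by
    have a := mul_le_mul_of_nonneg_left hρτ (show 0 ≤ 4 * K * M by positivity)
    have b := mul_le_mul_of_nonneg_left hκd hM.le
    have c : 0 ≤ K * M * ρ ^ 2 := by positivity
    linarith
  have := mul_pos hd hM
  linarith

end
end

noncomputable section
section
variable {d μ ω L M K m : ℝ} {f : ℝ → ℝ → ℝ → ℝ} {p : ℝ → ℝ → ℝ} {u : ℝ → ℝ → ℝ}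
  {g : ℝ → ℝ}

lemma dbl (h : Nice d μ M K f p u g) {T0 τ κ e : ℝ} (hT0 : 0 ≤ T0) (hτ : 0 < τ) (hκ : 0 < κ)
    (hκd : κ * (1 + 4 * K * τ) ≤ d) (he : e ^ 2 = 1) {t x y : ℝ} (ht : t ∈ Ioc T0 (T0 + τ))
    (hy : g t ≤ y) (hxy : y ≤ x) (hx2 : x ≤ y + √(κ * (t - T0))) :
    e * (u t x - u t y) ≤
      M * (2 * ((x - y) / √(κ * (t - T0))) - ((x - y) / √(κ * (t - T0))) ^ 2) := by
  have hM := h.fb.hM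
  set ρ : ℝ → ℝ := fun t => √(κ * (t - T0)) with hρ
  change e * (u t x - u t y) ≤ M * (2 * ((x - y) / ρ t) - ((x - y) / ρ t) ^ 2)
  change x ≤ y + ρ t at hx2
  have ρc : Continuous ρ := by simp only [hρ]; fun_prop
  have ρpos : ∀ t > T0, 0 < ρ t := fun t ht => Real.sqrt_pos.2 (mul_pos hκ (by linarith))
  have hew : ∀ a b, |e * (a - b)| = |a - b| := fun a b => by
    have : |e| = 1 := by
      have : |e| ^ 2 = 1 := by rw [sq_abs, he]
      exact (pow_eq_one_iff_of_nonneg (abs_nonneg e) two_ne_zero).1 this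
    rw [abs_mul, this, one_mul]
  refine le_of_forall_pos_le_add fun ε₀ hε₀ => ?_
  set ε := min (ε₀ / (1 + x ^ 2)) (M / (2 * (κ * τ))) with hε
  have hx20 : 0 < 1 + x ^ 2 := by positivity
  have hεp : 0 < ε := lt_min (by positivity) (by positivity)
  have hε1 : ε * (1 + x ^ 2) ≤ ε₀ := by
    have := min_le_left (ε₀ / (1 + x ^ 2)) (M / (2 * (κ * τ)))
    rwa [← hε, le_div_iff₀ hx20] at this
  have hε2 : 2 * ε * (κ * τ) ≤ M := by
    have := min_le_right (ε₀ / (1 + x ^ 2)) (M / (2 * (κ * τ)))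
    rw [← hε, le_div_iff₀ (by positivity)] at this
    linarith
  refine le_trans ?_ (add_le_add_right hε1 _)
  obtain ⟨Y, hY⟩ := (isCompact_Icc (a := T0) (b := T0 + τ)).exists_bound_of_continuousOn
      (h.fb.gc.mono fun a ha => hT0.trans ha.1)
  have hY0 : 0 ≤ Y := (norm_nonneg _).trans (hY T0 ⟨le_rfl, by linarith⟩)
  set X := |x| + Y + M / ε + 1 with hX
  have hMε : 0 < M / ε := by positivity
  have hX1 : 1 ≤ X := by linarith [abs_nonneg x]
  have hXM : M < ε * (1 + X ^ 2) := by
    have e1 : M = ε * (M / ε) := by field_simp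
    have e2 : M / ε < 1 + X ^ 2 := by nlinarith [abs_nonneg x]
    calc M = ε * (M / ε) := e1
      _ < _ := mul_lt_mul_of_pos_left e2 hεp
  have hxX : x < X := by linarith [le_abs_self x]
  obtain ⟨r, hr, H⟩ := h.unif (T0 := T0) (τ := τ) (X := X) hT0 hεp
  obtain ⟨T, hTr, hTT0, hTt⟩ : ∃ T, ρ T < r ∧ T0 < T ∧ T ≤ t := by
    have : ∀ᶠ a in 𝓝[>] T0, ρ a < r := by
      have h1 : Tendsto ρ (𝓝[>] T0) (𝓝 (ρ T0)) := (ρc.tendsto T0).mono_left nhdsWithin_le_nhds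
      have h2 : ρ T0 = 0 := by simp [hρ]
      rw [h2] at h1
      exact h1.eventually (gt_mem_nhds hr)
    obtain ⟨T, hT1, hT2⟩ := (this.and (Ioc_mem_nhdsGT ht.1)).exists
    exact ⟨T, hT1, hT2⟩
  set gt : ℝ → ℝ := fun a => g (max a 0) with hgt
  have gtc : Continuous gt := h.fb.gc.comp_continuous (by fun_prop) fun a => mem_Ici.2 (le_max_right _ _)
  have gte : ∀ a ≥ 0, gt a = g a := fun a ha => by simp only [hgt]; rw [max_eq_left ha]
  set S : Set (ℝ × (ℝ × ℝ)) := {q | q.1 ∈ Icc T t ∧ gt q.1 ≤ q.2.2 ∧ q.2.2 ≤ q.2.1 ∧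
    q.2.1 ≤ q.2.2 + ρ q.1 ∧ q.2.1 ≤ X} with hS
  have hSI : ∀ a b c, (a, (b, c)) ∈ S → 0 < a ∧ a ∈ Icc T0 (T0 + τ) ∧ b ∈ Icc (-X) X ∧ c ∈ Icc (-X) X := by
    rintro a b c ⟨h1, h2, h3, h4, h5⟩
    simp only at h1 h2 h3 h4 h5
    have ha : a ∈ Icc T0 (T0 + τ) := ⟨by linarith [h1.1], by linarith [h1.2, ht.2]⟩
    have := (abs_le.1 (hY a ha)).1
    rw [gte a (hT0.trans ha.1)] at h2
    have := abs_nonneg x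
    refine ⟨by linarith [h1.1], ha, ⟨by linarith, h5⟩, ⟨by linarith, by linarith⟩⟩
  have hSc : IsCompact S := by
    refine (isCompact_Icc.prod (isCompact_Icc.prod isCompact_Icc) :
      IsCompact (Icc T0 (T0 + τ) ×ˢ (Icc (-X) X ×ˢ Icc (-X) X))).of_isClosed_subset ?_ ?_
    · have c1 : Continuous fun q : ℝ × (ℝ × ℝ) => gt q.1 := gtc.comp continuous_fst
      have c2 : Continuous fun q : ℝ × (ℝ × ℝ) => ρ q.1 := ρc.comp continuous_fst
      refine IsClosed.inter (isClosed_Icc.preimage continuous_fst) ?_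
      refine IsClosed.inter (isClosed_le c1 (g := fun q : ℝ × (ℝ × ℝ) => q.2.2) (by fun_prop)) ?_
      refine IsClosed.inter (isClosed_le (f := fun q : ℝ × (ℝ × ℝ) => q.2.2)
        (g := fun q : ℝ × (ℝ × ℝ) => q.2.1) (by fun_prop) (by fun_prop)) ?_
      exact IsClosed.inter (isClosed_le (f := fun q : ℝ × (ℝ × ℝ) => q.2.1)
        (g := fun q : ℝ × (ℝ × ℝ) => q.2.2 + ρ q.1) (by fun_prop) (by fun_prop))
        (isClosed_le (f := fun q : ℝ × (ℝ × ℝ) => q.2.1) (g := fun _ => X) (by fun_prop) (by fun_prop))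
    · rintro ⟨a, b, c⟩ hq
      obtain ⟨-, h1, h2, h3⟩ := hSI a b c hq
      exact ⟨h1, h2, h3⟩
  have key := master hSc (h := fun a z => M * (2 * ((z.1 - z.2) / ρ a) - ((z.1 - z.2) / ρ a) ^ 2) +
      ε * (1 + z.1 ^ 2) - e * (u a z.1 - u a z.2)) ?_ ?_ t (x, y)
      ⟨⟨hTt, le_rfl⟩, by simp only; rw [gte t (by linarith)]; exact hy, hxy, hx2, hxX.le⟩
  · simp only at key; linarith
  · have c1 : ContinuousOn (fun q : ℝ × (ℝ × ℝ) => u q.1 q.2.1) S :=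
      h.cont.comp (f := fun q : ℝ × (ℝ × ℝ) => ((q.1, q.2.1) : ℝ × ℝ)) (by fun_prop)
        fun q hq => (hSI _ _ _ hq).1.le
    have c2 : ContinuousOn (fun q : ℝ × (ℝ × ℝ) => u q.1 q.2.2) S :=
      h.cont.comp (f := fun q : ℝ × (ℝ × ℝ) => ((q.1, q.2.2) : ℝ × ℝ)) (by fun_prop)
        fun q hq => (hSI _ _ _ hq).1.le
    have c3 : ContinuousOn (fun q : ℝ × (ℝ × ℝ) => (q.2.1 - q.2.2) / ρ q.1) S :=
      ContinuousOn.div (by fun_prop) (ρc.comp continuous_fst).continuousOn fun q hq =>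
        (ρpos _ (lt_of_lt_of_le hTT0 hq.1.1)).ne'
    have c4 : ContinuousOn (fun q : ℝ × (ℝ × ℝ) => ε * (1 + q.2.1 ^ 2)) S := by fun_prop
    exact ((continuousOn_const.mul ((continuousOn_const.mul c3).sub (c3.pow 2))).add c4).sub
      (continuousOn_const.mul (c1.sub c2))
  · rintro a ⟨b, c⟩ hq hle
    obtain ⟨ha0, haI, hb, hc⟩ := hSI a b c hq
    obtain ⟨h1, h2, h3, h4, h5⟩ := hq
    simp only at h1 h2 h3 h4 h5 hle
    have haT0 : T0 < a := lt_of_lt_of_le hTT0 h1.1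
    have hρa := ρpos a haT0
    have z0 : 0 ≤ (b - c) / ρ a := div_nonneg (by linarith) hρa.le
    have z1 : (b - c) / ρ a ≤ 1 := by rw [div_le_one hρa]; linarith
    have hz : 0 ≤ M * (2 * ((b - c) / ρ a) - ((b - c) / ρ a) ^ 2) :=
      mul_nonneg hM.le (by nlinarith)
    have hεb : ε ≤ ε * (1 + b ^ 2) := by nlinarith [sq_nonneg b]
    have hwM : e * (u a b - u a c) ≤ M := by
      refine (le_abs_self _).trans ?_
      rw [hew, abs_le]
      have := h.nonneg (x := b) ha0.le
      have := h.nonneg (x := c) ha0.le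
      have := h.leM (x := b) ha0.le
      have := h.leM (x := c) ha0.le
      constructor <;> linarith
    have k3 : c < b := by
      rcases h3.lt_or_eq with h' | h'
      · exact h'
      · rw [h'] at hz hle; rw [sub_self (u a b), mul_zero] at hle; linarith
    have k4 : b < c + ρ a := by
      rcases h4.lt_or_eq with h' | h'
      · exact h'
      · have : (b - c) / ρ a = 1 := by rw [h']; field_simp; ring
        rw [this] at hle; linarith
    have k5 : b < X := by
      rcases h5.lt_or_eq with h' | h'
      · exact h'
      · rw [h'] at hle hwM hz; linarith
    have k1 : T < a := by
      rcases h1.1.lt_or_eq with h' | h'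
      · exact h'
      · have := H a haI b hb c hc (by
          rw [abs_of_nonneg (by linarith)]
          have : ρ a = ρ T := by rw [h']
          linarith)
        rw [← hew] at this
        linarith [le_abs_self (e * (u a b - u a c))]
    have k2 : g a < c := by
      rw [gte a ha0.le] at h2
      rcases h2.lt_or_eq with h' | h'
      · exact h'
      · exfalso
        have uc0 : u a c = 0 := h.zero_of_le ha0.le h'.ge
        have hb' := bl_lip h hT0 hκ hκd (t := a) (x := b) ⟨haT0, haI.2⟩ (by linarith) (by rw [h']; exact h4)
        rw [h'] at hb'
        change u a b ≤ M * (2 * ((b - c) / ρ a) - ((b - c) / ρ a) ^ 2) at hb'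
        have hb0 := h.nonneg (x := b) ha0.le
        have : e * (u a b - u a c) ≤ u a b := by
          refine (le_abs_self _).trans ?_
          rw [hew, uc0, sub_zero, abs_of_nonneg hb0]
        linarith
    have k2' : gt a < c := by rw [gte a ha0.le]; exact k2
    refine ⟨?_, ?_, fun h0 hm hp => ?_⟩
    · have o1 : ∀ᶠ z : ℝ × ℝ in 𝓝 (b, c), gt a < z.2 :=
        continuous_snd.continuousAt.eventually (lt_mem_nhds k2')
      have o2 : ∀ᶠ z : ℝ × ℝ in 𝓝 (b, c), z.2 < z.1 :=
        continuousAt_snd.eventually_lt continuousAt_fst k3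
      have o3 : ∀ᶠ z : ℝ × ℝ in 𝓝 (b, c), z.1 < z.2 + ρ a :=
        continuousAt_fst.eventually_lt (continuousAt_snd.add continuousAt_const) k4
      have o4 : ∀ᶠ z : ℝ × ℝ in 𝓝 (b, c), z.1 < X :=
        continuousAt_fst.eventually_lt continuousAt_const k5
      filter_upwards [o1, o2, o3, o4] with z q1 q2 q3 q4
      exact ⟨h1, q1.le, q2.le, q3.le, q4.le⟩
    · have o1 : ∀ᶠ s in 𝓝[<] a, gt s < c :=
        (gtc.continuousAt.eventually_lt continuousAt_const k2').filter_mono nhdsWithin_le_nhds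
      have o3 : ∀ᶠ s in 𝓝[<] a, b < c + ρ s :=
        (continuousAt_const.eventually_lt (continuousAt_const.add ρc.continuousAt) k4).filter_mono
          nhdsWithin_le_nhds
      filter_upwards [o1, o3, Ioo_mem_nhdsLT k1] with s q1 q3 q4
      exact ⟨⟨q4.1.le, q4.2.le.trans h1.2⟩, q1.le, h3, q3.le, h5⟩
    · exact dbl_contact h (T0 := T0) (τ := τ) (ρ := ρ a) hκ hκd hεp hε2 he ha0 haT0 haI.2 rfl k2 k3 k4
        hm h0 hp

/-- uniform Lipschitz bound -/
lemma Lip (hd : 0 < d) (hK : 0 < K) (hM : 0 < M) {τ : ℝ} (hτ : 0 < τ) : ∃ A > 0, ∀ (μ : ℝ) (f : ℝ → ℝ → ℝ → ℝ)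
    (p u : ℝ → ℝ → ℝ) (g : ℝ → ℝ), Nice d μ M K f p u g → ∀ t ≥ τ, ∀ x y, |u t x - u t y| ≤ A * |x - y| := by
  set κ := d / (1 + 4 * K * τ) with hκd
  have hκ : 0 < κ := by positivity
  have hκd' : κ * (1 + 4 * K * τ) ≤ d := by rw [hκd]; field_simp; exact le_rfl
  set ρ := √(κ * τ) with hρ
  have hρp : 0 < ρ := Real.sqrt_pos.2 (by positivity)
  refine ⟨2 * M / ρ, by positivity, fun μ f p u g h t ht => ?_⟩
  have ht0 : 0 ≤ t := hτ.le.trans ht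
  have s1 : ∀ x y, g t ≤ y → y ≤ x → |u t x - u t y| ≤ 2 * M / ρ * (x - y) := by
    intro x y hy hxy
    rcases le_total x (y + ρ) with h1 | h1
    · have aux : ∀ e : ℝ, e ^ 2 = 1 → e * (u t x - u t y) ≤ 2 * M / ρ * (x - y) := by
        intro e he
        have := dbl h (T0 := t - τ) (τ := τ) (by linarith) hτ hκ hκd' he (t := t) (x := x) (y := y)
          ⟨by linarith, by linarith⟩ hy hxy (by rw [sub_sub_cancel]; exact h1)
        rw [sub_sub_cancel, ← hρ] at this
        refine this.trans ?_
        have e1 := mul_nonneg hM.le (sq_nonneg ((x - y) / ρ))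
        have e2 : 2 * M / ρ * (x - y) = M * (2 * ((x - y) / ρ)) := by ring
        rw [e2]; linarith
      have a1 := aux 1 (by norm_num)
      have a2 := aux (-1) (by norm_num)
      rw [abs_le]; constructor <;> linarith
    · have e1 : M * 2 ≤ 2 * M / ρ * (x - y) := by
        rw [div_mul_eq_mul_div, le_div_iff₀ hρp]
        have := mul_le_mul_of_nonneg_left (show ρ ≤ x - y by linarith) hM.le
        linarith
      have := h.nonneg (x := x) ht0
      have := h.nonneg (x := y) ht0
      have := h.leM (x := x) ht0
      have := h.leM (x := y) ht0
      rw [abs_le]; constructor <;> linarith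
  have s2 : ∀ x y, y ≤ x → |u t x - u t y| ≤ 2 * M / ρ * (x - y) := by
    intro x y hxy
    have hA : 0 ≤ 2 * M / ρ := by positivity
    rcases le_total (g t) y with h1 | h1
    · exact s1 x y h1 hxy
    · rw [h.zero_of_le ht0 h1]
      rcases le_total x (g t) with h2 | h2
      · rw [h.zero_of_le ht0 h2]; simp only [sub_self, abs_zero]
        exact mul_nonneg hA (by linarith)
      · have := s1 x (g t) le_rfl h2
        rw [h.fb.bc t ht0] at this
        exact this.trans (mul_le_mul_of_nonneg_left (by linarith) hA)
  intro x y
  rcases le_total y x with h1 | h1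
  · rw [abs_of_nonneg (show 0 ≤ x - y by linarith)]; exact s2 x y h1
  · rw [abs_sub_comm, abs_sub_comm x y, abs_of_nonneg (show 0 ≤ y - x by linarith)]; exact s2 y x h1
end
end

noncomputable section
section
variable {d μ ω L M K m : ℝ} {f : ℝ → ℝ → ℝ → ℝ} {p : ℝ → ℝ → ℝ} {u : ℝ → ℝ → ℝ}
  {g : ℝ → ℝ}

lemma FB.zero_of_le (h : FB d μ M K f u g) {t x : ℝ} (ht : 0 ≤ t) (hx : x ≤ g t) :
    u t x = 0 := by
  rcases hx.lt_or_eq with h1 | h1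
  · exact h.ext t ht x h1
  · rw [h1, h.bc t ht]

lemma FB.gt_of_pos (h : FB d μ M K f u g) {t x : ℝ} (ht : 0 ≤ t) (hx : 0 < u t x) : g t < x := by
  by_contra! hle
  rw [h.zero_of_le ht hle] at hx
  exact lt_irrefl _ hx

lemma FB.cont (h : FB d μ M K f u g) :
    ContinuousOn (fun q : ℝ × ℝ => u q.1 q.2) {q : ℝ × ℝ | 0 ≤ q.1} := by
  have e : ∀ q ∈ {q : ℝ × ℝ | 0 ≤ q.1}, u q.1 q.2 = u q.1 (max q.2 (g q.1)) := by
    intro q hq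
    rcases le_total q.2 (g q.1) with h1 | h1
    · rw [max_eq_right h1, h.bc _ hq, h.zero_of_le hq h1]
    · rw [max_eq_left h1]
  refine ContinuousOn.congr ?_ e
  have hg : ContinuousOn (fun q : ℝ × ℝ => g q.1) {q : ℝ × ℝ | 0 ≤ q.1} :=
    h.gc.comp continuousOn_fst fun q hq => hq
  have : ContinuousOn (fun q : ℝ × ℝ => (q.1, max q.2 (g q.1))) {q : ℝ × ℝ | 0 ≤ q.1} :=
    continuousOn_fst.prodMk (continuous_max.comp_continuousOn (continuousOn_snd.prodMk hg))
  exact h.uc.comp this fun q hq => ⟨hq, le_max_right _ _⟩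

/-- `u ≤ p` propagates -/
lemma FB.lep (h : FB d μ M K f u g) (hm : 0 < m) (pc : Continuous fun q : ℝ × ℝ => p q.1 q.2)
    (pm : ∀ t x, m ≤ p t x) (pM : ∀ t x, p t x ≤ M) (psol : ∀ t x, LocSol d f p t x)
    (h0 : ∀ x ≥ g 0, u 0 x ≤ p 0 x) : ∀ t ≥ 0, ∀ x, u t x ≤ p t x := by
  intro t ht x
  rcases le_total x (g t) with hx | hx
  · rw [h.zero_of_le ht hx]; linarith [pm t x]
  have := bar_right (u := p) (v := u) (f := f) (T := 0) (T' := t) (x1 := 0) (a := 0) (c := 0)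
    (η := 0) (C := M) (γ := g) h.hd h.hK.le rfl le_rfl le_rfl le_rfl
    (h.gc.mono fun a ha => ha.1)
    (pc.continuousOn.sub (h.uc.mono fun q hq => ⟨hq.1.1, hq.2⟩)) ?_ ?_ ?_ t ⟨ht, le_rfl⟩ x hx
  · simp only [bar] at this; linarith
  · intro t ht x hx
    have := (abs_le.1 (h.le t ht.1 x)).2
    linarith [pm t x]
  · intro t ht x hx hh
    simp only [bar]
    rcases hh with rfl | rfl
    · linarith [h0 x hx]
    · rw [h.bc t ht.1]; linarith [pm t (g t)]
  · intro t ht x hx hneg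
    simp only [bar] at hneg
    refine ⟨psol t x, h.sol t ht.1 x hx, ?_⟩
    have h1 := pm t x
    have h2 := (abs_le.1 (h.le t ht.1.le x)).2
    exact h.lip t x _ _ (by linarith) (pM t x) (by linarith) h2

lemma FB.gap (h : FB d μ M K f u g) (hm : 0 < m) (pc : Continuous fun q : ℝ × ℝ => p q.1 q.2)
    (pm : ∀ t x, m ≤ p t x) (pM : ∀ t x, p t x ≤ M) (psol : ∀ t x, LocSol d f p t x)
    (lep : ∀ t ≥ 0, ∀ x, u t x ≤ p t x) {ε X : ℝ} (hε : 0 < ε) (hgap : ∀ x ≥ X, ε ≤ p 0 x - u 0 x)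
    {T : ℝ} (hT : 0 < T) : ∃ δ > 0, ∀ x, u T x ≤ p T x - δ := by
  set e := min ε m with he
  have he0 : 0 < e := lt_min hε hm
  have heε : e ≤ ε := min_le_left _ _
  have hem : e ≤ m := min_le_right _ _
  -- contact information
  have hcon : ∀ t > 0, ∀ x, p t x - u t x < e → LocSol d f p t x ∧ LocSol d f u t x ∧
      |f t x (p t x) - f t x (u t x)| ≤ K * |p t x - u t x| := by
    intro t ht x hlt
    have h1 := pm t x
    have h0 : 0 < u t x := by linarith
    have h2 := (abs_le.1 (h.le t ht.le x)).2
    exact ⟨psol t x, h.sol t ht x (h.gt_of_pos ht.le h0), h.lip t x _ _ (by linarith) (pM t x) h0.le h2⟩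
  have wc : ContinuousOn (fun q : ℝ × ℝ => p q.1 q.2 - u q.1 q.2) {q : ℝ × ℝ | 0 ≤ q.1} :=
    pc.continuousOn.sub h.cont
  set Λ := K + d + 1 with hΛ
  -- far field
  have far : ∀ x ≥ X, e * Real.exp (-(Λ * T)) - e * Real.exp (-(x - X)) * Real.exp (Λ * T) ≤
      p T x - u T x := by
    intro x hx
    have := bar_right (u := p) (v := u) (f := f) (T := 0) (T' := T) (x1 := X) (a := 0) (c := e)
      (η := e) (C := 0) (γ := fun _ => X) h.hd h.hK.le hΛ le_rfl he0.le he0.le continuousOn_const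
      (wc.mono fun q hq => hq.1.1) ?_ ?_ ?_ T ⟨hT.le, le_rfl⟩ x hx
    · simp only [bar, sub_zero] at this; linarith
    · intro t ht x hx; linarith [lep t ht.1 x]
    · intro t ht x hx hh
      have hl := lep t ht.1 x
      simp only [bar]
      rcases hh with rfl | rfl
      · have h1 := hgap x hx
        have h2 := mul_pos he0 (Real.exp_pos (-(x - X)))
        simp only [sub_self, mul_zero, neg_zero, Real.exp_zero]
        linarith
      · have hL0 : 0 ≤ Λ * (t - 0) := mul_nonneg (by linarith [h.hK, h.hd]) (by linarith [ht.1])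
        have h1 : Real.exp (-(Λ * (t - 0))) ≤ Real.exp (Λ * (t - 0)) := Real.exp_le_exp.2 (by linarith)
        have h2 := mul_le_mul_of_nonneg_left h1 he0.le
        simp only [sub_self, neg_zero, Real.exp_zero]
        linarith
    · intro t ht x hx hneg
      refine hcon t ht.1 x ?_
      simp only [bar] at hneg
      have h1 : 0 < e * Real.exp (-(x - X)) * Real.exp (Λ * (t - 0)) := by positivity
      have hL0 : 0 ≤ Λ * (t - 0) := mul_nonneg (by linarith [h.hK, h.hd]) (by linarith [ht.1])
      have h2 : Real.exp (-(Λ * (t - 0))) ≤ 1 := Real.exp_le_one_iff.2 (by linarith)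
      have h3 := mul_le_mul_of_nonneg_left h2 he0.le
      linarith
  obtain ⟨X2, hX2X, hX2⟩ : ∃ X2 ≥ X, ∀ x ≥ X2, e * Real.exp (-(Λ * T)) / 2 ≤ p T x - u T x := by
    set r := Real.exp (-(Λ * T)) / 2 / Real.exp (Λ * T) with hr
    have hr0 : 0 < r := by positivity
    refine ⟨max X (X - Real.log r), le_max_left _ _, fun x hx => ?_⟩
    have h1 := far x ((le_max_left _ _).trans hx)
    have h2 : X - Real.log r ≤ x := (le_max_right _ _).trans hx
    have h3 : Real.exp (-(x - X)) ≤ r := by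
      rw [← Real.log_le_log_iff (Real.exp_pos _) hr0, Real.log_exp]; linarith
    have h4 : Real.exp (-(x - X)) * Real.exp (Λ * T) ≤ Real.exp (-(Λ * T)) / 2 := by
      have := mul_le_mul_of_nonneg_right h3 (Real.exp_pos (Λ * T)).le
      rw [hr, div_mul_cancel₀ _ (Real.exp_pos _).ne'] at this
      exact this
    have h5 := mul_le_mul_of_nonneg_left h4 he0.le
    linarith
  -- compact part
  set A := g T - 1 with hA
  set l := max (X2 - A) 1 + 1 with hl
  have hl0 : 0 < l := by linarith [le_max_right (X2 - A) 1]
  have hlX : X2 + 1 ≤ A + l := by linarith [le_max_left (X2 - A) 1]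
  set s := (A - X) / T with hs
  obtain ⟨c, hc, H⟩ := hopf (d := d) (K := K) (B := |s|) (l := l) (τ := T) h.hd h.hK.le (abs_nonneg _) hl0
  have hsT : X + s * T = A := by rw [hs]; field_simp; ring
  have H' := H f p u 0 T e (fun t => X + s * t) (fun _ => s) (by linarith) he0 (by fun_prop)
    (fun t _ => by simpa using ((hasDerivAt_id t).const_mul s).const_add X) (fun _ _ => le_rfl)
    (wc.mono fun q hq => hq.1.1) (fun t ht x _ _ => lep t ht.1 x)
    (fun x hx _ => heε.trans (hgap x (by simpa using hx)))
    (fun t ht x _ _ hlt => hcon t ht.1 x hlt) T ⟨hT.le, le_rfl⟩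
  simp only [hsT] at H'
  refine ⟨min (c * e) (min (e * Real.exp (-(Λ * T)) / 2) m), lt_min (by positivity)
    (lt_min (by positivity) hm), fun x => ?_⟩
  have i1 := min_le_left (c * e) (min (e * Real.exp (-(Λ * T)) / 2) m)
  have i2 := min_le_right (c * e) (min (e * Real.exp (-(Λ * T)) / 2) m)
  have i3 := min_le_left (e * Real.exp (-(Λ * T)) / 2) m
  have i4 := min_le_right (e * Real.exp (-(Λ * T)) / 2) m
  rcases le_total x (g T) with hx | hx
  · rw [h.zero_of_le hT.le hx]; linarith [pm T x]
  rcases le_total X2 x with hx2 | hx2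
  · linarith [hX2 x hx2]
  · have := H' x (by linarith) (by linarith)
    have h1 : 1 ≤ (x - A) * (A + l - x) := one_le_mul_of_one_le_of_one_le (by linarith) (by linarith)
    have h2 := mul_le_mul_of_nonneg_left h1 (show 0 ≤ c * e by positivity)
    linarith

lemma nice_exists (c : Ctx d μ ω L M K m f p) (hf : BasicAssumptions ω L f) {g₀ : ℝ} {u₀ : ℝ → ℝ}
    (hu₀ : memHminus g₀ u₀) (hle : ∀ x ≥ g₀, u₀ x ≤ p 0 x)
    (hgap : ∃ ε > (0:ℝ), ∃ X : ℝ, ∀ x ≥ X, ε ≤ p 0 x - u₀ x)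
    (h : IsHalfFBPSolutionLeft d μ f g₀ u₀ u g)
    (hconv : ∀ C : ℝ, ∀ ε > 0, ∃ N : ℕ, ∀ n : ℕ, N ≤ n → ∀ x ≥ C,
        |u ((n : ℝ) * ω) x - p 0 x| ≤ ε) :
    ∃ n : ℕ, Nice d μ M K f p (fun t x => u (t + n * ω) x) (fun t => g (t + n * ω)) ∧
      ∃ δ > 0, ∀ x, u (n * ω) x ≤ p 0 x - δ := by
  have hω := c.hω
  obtain ⟨C, hC⟩ := h.bdd
  set M' := max M C with hM'
  obtain ⟨K', hK', hlip'⟩ := f_lip c.hω c.hL hf M'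
  have F : FB d μ M' K' f u g := by
    refine ⟨c.hd, c.hμ, hK', lt_max_of_lt_left c.hM, c.zero, hlip', h.g_smooth.continuousOn, h.u_cont,
      ?_, fun t ht x => (hC t ht x).trans (le_max_right _ _), ?_, h.stefan, ?_, h.ext⟩
    · intro t ht
      rcases ht.lt_or_eq with h1 | h1
      · exact h.bc t h1
      · rw [← h1, h.g_init, h.init _ le_rfl, hu₀.2.2.1]
    · intro t ht x hx
      exact h.pde.locSol ((lt_mem_nhds hx).mono fun y hy => ⟨ht, hy⟩)
    · have h1 : ContinuousOn (derivWithin g (Ici 0)) (Ici 0) :=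
        h.g_smooth.continuousOn_derivWithin (uniqueDiffOn_Ici 0) le_rfl
      refine (h1.mono Ioi_subset_Ici_self).congr fun t ht => ?_
      exact ((h.stefan t ht).hasDerivWithinAt.derivWithin (uniqueDiffOn_Ici 0 t (mem_Ici.2 (le_of_lt (mem_Ioi.1 ht))))).symm
  have hnat : ∀ (t : ℝ) (N : ℕ), ∃ n : ℕ, N ≤ n ∧ 1 ≤ n ∧ t ≤ n * ω := by
    intro t N
    obtain ⟨k, hk⟩ := exists_nat_ge (t / ω)
    refine ⟨max k (max N 1), (le_max_left _ _).trans (le_max_right _ _),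
      (le_max_right _ _).trans (le_max_right _ _), ?_⟩
    rw [div_le_iff₀ hω] at hk
    refine hk.trans (mul_le_mul_of_nonneg_right ?_ hω.le)
    exact_mod_cast le_max_left _ _
  have hlate : ∀ C t, ∃ n : ℕ, 1 ≤ n ∧ t ≤ n * ω ∧ ∀ x ≥ C, m / 2 ≤ u (n * ω) x := by
    intro C t
    obtain ⟨N, hN⟩ := hconv C (m / 2) (half_pos c.hm)
    obtain ⟨n, h1, h2, h3⟩ := hnat t N
    refine ⟨n, h2, h3, fun x hx => ?_⟩
    have := (abs_le.1 (hN n h1 x hx)).1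
    linarith [c.pm 0 x]
  have hm2 := half_pos c.hm
  obtain ⟨s0, hs0, hpos⟩ := F.positive
    (fun t => by
      obtain ⟨n, -, h2, h3⟩ := hlate 0 t
      exact ⟨n * ω, h2, m / 2, hm2, 0, h3⟩)
    (fun x hx => by
      rw [h.g_init] at hx
      rw [h.init x hx.le]; exact hu₀.2.2.2 x hx)
    (by
      obtain ⟨n, h1, h2, h3⟩ := hlate (g 0 - 1) 0
      have hn : (0:ℝ) < n := by exact_mod_cast h1
      refine ⟨n * ω, by positivity, ?_⟩
      have := F.gt_of_pos (t := n * ω) (by positivity) (lt_of_lt_of_le hm2 (h3 (g 0 - 1) le_rfl))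
      linarith)
  have pM' : ∀ t x, p t x ≤ M' := fun t x => (c.pM t x).trans (le_max_left _ _)
  have lep := F.lep c.hm c.pc c.pm pM' c.psol (fun x hx => by
    rw [h.g_init] at hx; rw [h.init x hx]; exact hle x hx)
  obtain ⟨n, -, hn1, hns⟩ := hnat s0 0
  have hn : (0:ℝ) < n * ω := by
    have : (0:ℝ) < n := by exact_mod_cast hn1
    positivity
  have ppt0 : ∀ t x, p (t + n * ω) x = p t x := fun t x => by exact_mod_cast c.ppt n t x
  obtain ⟨ε, hε, X, hX⟩ := hgap
  obtain ⟨δ, hδ, hδ'⟩ := F.gap c.hm c.pc c.pm pM' c.psol lep (ε := ε) (X := max X g₀) hε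
    (fun x hx => by
      rw [h.init x ((le_max_right _ _).trans hx)]
      exact hX x ((le_max_left _ _).trans hx)) hn
  have nonneg : ∀ t ≥ 0, ∀ x, 0 ≤ u (t + n * ω) x := by
    intro t ht x
    rcases le_or_gt x (g (t + n * ω)) with h1 | h1
    · rw [F.zero_of_le (by linarith) h1]
    · exact ((hpos (t + n * ω) (by linarith)).1 x h1).le
  refine ⟨n, ?_, δ, hδ, fun x => ?_⟩
  swap
  · have := hδ' x
    have e := ppt0 0 x
    rw [zero_add] at e
    rwa [e] at this
  have hcs : ContinuousOn (fun t : ℝ => t + n * ω) (Ici 0) := by fun_prop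
  have hm : MapsTo (fun t : ℝ => t + n * ω) (Ici 0) (Ici 0) := fun t ht => by
    simp only [mem_Ici] at ht ⊢; linarith
  have hm1 : MapsTo (fun t : ℝ => t + n * ω) (Ici 0) (Ioi 0) := fun t ht => by
    simp only [mem_Ici, mem_Ioi] at ht ⊢; linarith
  have gc0 := F.gc1.comp hcs hm1
  have lep' : ∀ t ≥ 0, ∀ x, u (t + n * ω) x ≤ p t x := fun t ht x => by
    have := lep (t + n * ω) (by linarith) x
    rwa [ppt0] at this
  refine ⟨⟨c.hd, c.hμ, c.hK, c.hM, c.zero, c.lip, F.gc.comp hcs hm, ?_, ?_, ?_, ?_, ?_, ?_, ?_⟩,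
    ?_, ?_, gc0, lep'⟩
  · refine F.uc.comp (f := fun q : ℝ × ℝ => ((q.1 + n * ω, q.2) : ℝ × ℝ)) (by fun_prop) ?_
    rintro q ⟨h1, h2⟩
    exact ⟨by simp only; linarith, h2⟩
  · intro t ht; exact F.bc _ (by linarith)
  · intro t ht x
    have h1 := nonneg t ht x
    rw [abs_of_nonneg h1]
    exact (lep' t ht x).trans (c.pM t x)
  · intro t ht x hx
    have h1 := LocSol.shift (t := t) (x := x) (a := n * ω) (b := 0) (u := u) (d := d) (f := f)
      (by rw [add_zero]; exact F.sol (t + n * ω) (by linarith) x hx) (by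
        rw [add_zero]
        have h0 := nonneg t ht.le x
        exact_mod_cast c.per_t n t x _ h0)
    simpa only [add_zero] using h1
  · intro t ht
    exact (F.st (t + n * ω) (by linarith)).comp_add_const t _
  · exact gc0.mono Ioi_subset_Ici_self
  · intro t ht x hx; exact F.ext _ (by linarith) x hx
  · intro t ht x hx; exact (hpos (t + n * ω) (by linarith)).1 x hx
  · intro t ht; exact (hpos (t + n * ω) (by linarith)).2
end
end

noncomputable section

lemma tendsto_div_of_bounds {a : ℕ → ℝ} {c : ℝ} (h1 : ∀ c' < c, ∃ D, ∀ n ≥ 1, c' * n - D ≤ a n)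
    (h2 : ∀ c' > c, ∃ D, ∀ n ≥ 1, a n ≤ c' * n + D) : Tendsto (fun n => a n / n) atTop (𝓝 c) := by
  rw [tendsto_order]
  constructor
  · intro l hl
    obtain ⟨c', hc1, hc2⟩ := exists_between hl
    obtain ⟨D, hD⟩ := h1 c' hc2
    filter_upwards [eventually_ge_atTop 1,
      (tendsto_natCast_atTop_atTop (R := ℝ)).eventually (eventually_gt_atTop (D / (c' - l)))] with n hn h3
    have hn0 : (0:ℝ) < n := by exact_mod_cast hn
    rw [lt_div_iff₀ hn0]
    rw [div_lt_iff₀ (by linarith)] at h3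
    have := hD n hn
    linarith
  · intro l hl
    obtain ⟨c', hc1, hc2⟩ := exists_between hl
    obtain ⟨D, hD⟩ := h2 c' hc1
    filter_upwards [eventually_ge_atTop 1,
      (tendsto_natCast_atTop_atTop (R := ℝ)).eventually (eventually_gt_atTop (D / (l - c')))] with n hn h3
    have hn0 : (0:ℝ) < n := by exact_mod_cast hn
    rw [div_lt_iff₀ hn0]
    rw [div_lt_iff₀ (by linarith)] at h3
    have := hD n hn
    linarith

lemma seq_speed {a : ℕ → ℝ} {Q : ℕ → ℝ → Prop} {C₁ : ℝ} (mono : Monotone a)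
    (hQ : ∀ P b, Q P b → ∀ n, a n + b ≤ a (n + P)) (hC : 0 ≤ C₁)
    (hstep : ∀ n, a (n + 1) ≤ a n + C₁)
    (hpos : ∃ P ≥ 1, ∃ b > 0, Q P b)
    (hd : ∀ θ > 0, ∃ J : ℕ, ∃ R : ℝ, ∀ m ≥ 1, a (m + 1) ≤ a m + θ ∨ Q (m + J) (a m - R)) :
    ∃ c > 0, Tendsto (fun n => a n / n) atTop (𝓝 c) ∧
      ∀ c' < c, ∃ P ≥ 1, ∃ b, Q P b ∧ c' * P ≤ b := by
  set S : Set ℝ := {c | ∃ P ≥ 1, ∃ b, Q P b ∧ c * P ≤ b} with hS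
  have iter : ∀ P b, Q P b → ∀ r j : ℕ, a r + j * b ≤ a (r + j * P) := by
    intro P b h r j
    induction j with
    | zero => simp
    | succ j ih =>
      have := hQ P b h (r + j * P)
      rw [show r + (j + 1) * P = r + j * P + P by ring]
      push_cast; linarith
  have up : ∀ n : ℕ, a n ≤ a 0 + n * C₁ := by
    intro n
    induction n with
    | zero => simp
    | succ n ih => push_cast; linarith [hstep n]
  have bS : ∀ c ∈ S, c ≤ C₁ := by
    rintro c ⟨P, hP, b, hb, hcb⟩
    have hP0 : (0:ℝ) < P := by exact_mod_cast hP
    have h1 := hQ P b hb 0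
    rw [zero_add] at h1
    have h2 := up P
    have : c * P ≤ C₁ * P := by linarith
    exact le_of_mul_le_mul_right this hP0
  have bdd : BddAbove S := ⟨C₁, fun c hc => bS c hc⟩
  obtain ⟨P0, hP0, b0, hb0, hQ0⟩ := hpos
  have hP0' : (0:ℝ) < P0 := by exact_mod_cast hP0
  have hmem : b0 / P0 ∈ S := ⟨P0, hP0, b0, hQ0, by rw [div_mul_cancel₀ _ hP0'.ne']⟩
  have hcpos : 0 < sSup S := lt_of_lt_of_le (by positivity) (le_csSup bdd hmem)
  have third : ∀ c' < sSup S, ∃ P ≥ 1, ∃ b, Q P b ∧ c' * P ≤ b := by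
    intro c' hc'
    obtain ⟨s, ⟨P, hP, b, hb, hsb⟩, hs⟩ := exists_lt_of_lt_csSup ⟨_, hmem⟩ hc'
    exact ⟨P, hP, b, hb, (mul_le_mul_of_nonneg_right hs.le P.cast_nonneg).trans hsb⟩
  refine ⟨sSup S, hcpos, tendsto_div_of_bounds ?_ ?_, third⟩
  · intro c' hc'
    obtain ⟨P, hP, b, hb, hcb⟩ := third c' hc'
    refine ⟨|c'| * P - a 0, fun n _ => ?_⟩
    have h1 := iter P b hb (n % P) (n / P)
    have h2 : n % P + n / P * P = n := by rw [mul_comm]; exact Nat.mod_add_div n P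
    rw [h2] at h1
    have h3 := mono (Nat.zero_le (n % P))
    have h4 : ((n % P : ℕ) : ℝ) + ((n / P : ℕ) : ℝ) * P = n := by exact_mod_cast h2
    have h5 : ((n % P : ℕ) : ℝ) ≤ P := by exact_mod_cast (Nat.mod_lt n hP).le
    have h6 := mul_le_mul_of_nonneg_left hcb (n / P : ℕ).cast_nonneg (α := ℝ)
    have h7 : c' * ((n % P : ℕ) : ℝ) ≤ |c'| * P :=
      (mul_le_mul_of_nonneg_right (le_abs_self c') (Nat.cast_nonneg _)).trans
        (mul_le_mul_of_nonneg_left h5 (abs_nonneg _))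
    have h8 : c' * n = c' * ((n % P : ℕ) : ℝ) + ((n / P : ℕ) : ℝ) * (c' * P) := by rw [← h4]; ring
    linarith
  · intro c' hc'
    have hc0 : 0 < c' := hcpos.trans hc'
    obtain ⟨J, R, hJR⟩ := hd c' hc0
    refine ⟨max (a 1) (R + c' * J + C₁), fun n hn => ?_⟩
    induction n, hn using Nat.le_induction with
    | base => push_cast; linarith [le_max_left (a 1) (R + c' * J + C₁)]
    | succ n hn ih =>
      rcases hJR n hn with h | h
      · push_cast; linarith
      · have h1 : a n - R < c' * ((n + J : ℕ) : ℝ) := by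
          by_contra! hle
          exact absurd (le_csSup bdd (show c' ∈ S from ⟨n + J, by omega, _, h, hle⟩)) (not_le.2 hc')
        have := hstep n
        have := le_max_right (a 1) (R + c' * J + C₁)
        push_cast at *
        linarith
end

noncomputable section

structure Good (d μ ω M K δ : ℝ) (f : ℝ → ℝ → ℝ → ℝ) (p : ℝ → ℝ → ℝ) (u : ℝ → ℝ → ℝ) (g : ℝ → ℝ) :
    Prop where
  nice : Nice d μ M K f p u g
  hδ : 0 < δ
  gap : ∀ x, u 0 x ≤ p 0 x - δ
  conv : ∀ C : ℝ, ∀ ε > 0, ∃ N : ℕ, ∀ n : ℕ, N ≤ n → ∀ x ≥ C, |u ((n : ℝ) * ω) x - p 0 x| ≤ ε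

section
variable {d μ ω L M K m δ : ℝ} {f : ℝ → ℝ → ℝ → ℝ} {p : ℝ → ℝ → ℝ} {u : ℝ → ℝ → ℝ}
  {g : ℝ → ℝ}

lemma star {u' : ℝ → ℝ → ℝ} {g' : ℝ → ℝ} (c : Ctx d μ ω L M K m f p) (h : Nice d μ M K f p u g)
    (h' : Nice d μ M K f p u' g') (hδ : 0 < δ) (gap : ∀ x, u' 0 x ≤ p 0 x - δ) (k : ℤ) (n : ℕ)
    (h0 : ∀ x ≥ g' 0 - k * L, p 0 x - δ / 2 ≤ u (n * ω) x) :
    ∀ s ≥ 0, g (s + n * ω) ≤ g' s - k * L ∧ ∀ x, u' s (x + k * L) ≤ u (s + n * ω) x := by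
  have h1 := h'.shift c 0 k
  have h2 := h.shift c n 0
  simp only [Nat.cast_zero, zero_mul, add_zero, Int.cast_zero, sub_zero] at h1 h2
  refine CMP h1 h2 (half_pos hδ) fun x hx => ?_
  simp only [zero_add]
  have e1 := gap (x + k * L)
  rw [c.ppx] at e1
  linarith [h0 x hx]

/-- the ordering relation `u(s + P ω, x) ≥ u (s, x + b)` -/
def QQ (ω L : ℝ) (u : ℝ → ℝ → ℝ) (P : ℕ) (b : ℝ) : Prop :=
  ∃ k : ℤ, b ≤ k * L ∧ ∀ s ≥ 0, ∀ x, u s (x + k * L) ≤ u (s + P * ω) x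

lemma Good.QQ_of (G : Good d μ ω M K δ f p u g) (c : Ctx d μ ω L M K m f p) {P : ℕ} {C : ℝ}
    (h0 : ∀ x ≥ C, p 0 x - δ / 2 ≤ u (P * ω) x) : QQ ω L u P (g 0 - C - L) := by
  have hL := c.hL
  set k := ⌊(g 0 - C) / L⌋ with hk
  have h1 : (k : ℝ) * L ≤ g 0 - C := by
    rw [← le_div_iff₀ hL]; exact Int.floor_le _
  have h2 : g 0 - C - L ≤ k * L := by
    have := (Int.lt_floor_add_one ((g 0 - C) / L)).le
    rw [div_le_iff₀ hL] at this
    linarith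
  exact ⟨k, h2, fun s hs x => (star c G.nice G.nice G.hδ G.gap k P
    (fun x hx => h0 x (by linarith)) s hs).2 x⟩

lemma QQ_g (h : Nice d μ M K f p u g) (c : Ctx d μ ω L M K m f p) {P : ℕ} {b : ℝ} (hQ : QQ ω L u P b)
    (n : ℕ) : g 0 - g (n * ω) + b ≤ g 0 - g ((n + P : ℕ) * ω) := by
  obtain ⟨k, hb, H⟩ := hQ
  have hω := c.hω
  have hn : (0:ℝ) ≤ n * ω := by positivity
  have hP : (0:ℝ) ≤ P * ω := by positivity
  have h1 := H (n * ω) hn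
  have e : ((n + P : ℕ) : ℝ) * ω = n * ω + P * ω := by push_cast; ring
  rw [e]
  have : g (n * ω + P * ω) ≤ g (n * ω) - k * L := by
    refine le_of_forall_gt_imp_ge_of_dense fun x hx => ?_
    exact (h.gt_of_pos (by linarith) (lt_of_lt_of_le (h.pos _ hn _ (by linarith)) (h1 x))).le
  linarith

lemma Good.QQ_pos (G : Good d μ ω M K δ f p u g) (c : Ctx d μ ω L M K m f p) :
    ∃ P ≥ 1, ∃ b > 0, QQ ω L u P b := by
  have hL := c.hL
  obtain ⟨N, hN⟩ := G.conv (g 0 - 2 * L) (δ / 2) (half_pos G.hδ)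
  refine ⟨max N 1, le_max_right _ _, _, ?_, G.QQ_of c (C := g 0 - 2 * L) fun x hx => ?_⟩
  · linarith
  · have := (abs_le.1 (hN _ (le_max_left N 1) x hx)).1
    linarith

lemma Good.right (G : Good d μ ω M K δ f p u g) (c : Ctx d μ ω L M K m f p) :
    ∃ N : ℕ, ∀ k : ℕ, ∀ s ≥ 0, ∀ x, u s (x - k * L) ≤ u (s + N * ω) x := by
  have hL := c.hL
  obtain ⟨N, hN⟩ := G.conv (g 0) (δ / 2) (half_pos G.hδ)
  refine ⟨N, fun k s hs x => ?_⟩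
  have := (star c G.nice G.nice G.hδ G.gap (-k) N (fun x hx => ?_) s hs).2 x
  · push_cast at this; rwa [neg_mul, ← sub_eq_add_neg] at this
  · push_cast at hx
    have h1 : (0:ℝ) ≤ k * L := by positivity
    have := (abs_le.1 (hN _ le_rfl x (by linarith))).1
    linarith

/-- once `u` is large at a point, it is close to `p` far to the right somewhat later -/
lemma Good.spread (G : Good d μ ω M K δ f p u g) (c : Ctx d μ ω L M K m f p) {E : ℝ} (hE : 0 < E) :
    ∃ (J : ℕ) (R : ℝ), ∀ n : ℕ, 1 ≤ n → ∀ t ∈ Icc (n * ω) ((n + 1) * ω), ∀ x1, E ≤ u t x1 →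
      ∀ x ≥ x1 + R, p 0 x - δ / 2 ≤ u ((n + J : ℕ) * ω) x := by
  have hL := c.hL
  have hω := c.hω
  have hM := c.hM
  have hδ := G.hδ
  have h := G.nice
  obtain ⟨A, hA, hlip⟩ := Lip c.hd c.hK c.hM hω
  obtain ⟨N, hN⟩ := G.right c
  set ρ := E / (2 * A) with hρ
  have hρ0 : 0 < ρ := by positivity
  have hAρ : A * ρ = E / 2 := by rw [hρ]; field_simp
  obtain ⟨κ, hκ, H⟩ := hopf (d := d) (K := K) (B := L / ω) (l := 2 * ρ) (τ := 2 * ω) c.hd c.hK.le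
    (by positivity) (by positivity)
  set e := min (κ * (E / 2) * (ρ * ρ)) M with he
  have he0 : 0 < e := lt_min (by positivity) hM
  obtain ⟨v, vc, v0, vb, vl, vconv⟩ := c.conv e he0 (min_le_right _ _)
  obtain ⟨S, hS⟩ := vconv (δ / 4) (by linarith)
  obtain ⟨J0, hJ0⟩ := exists_nat_ge (S / ω)
  rw [div_le_iff₀ hω] at hJ0
  set Λ := K + d + 1 with hΛ
  set R := Real.log (M * Real.exp (Λ * (J0 * ω)) / (δ / 4)) with hR
  refine ⟨2 + N + J0, max R 0, fun n hn t ht x1 hx1 => ?_⟩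
  have hn1 : ω ≤ n * ω := by
    have : (1:ℝ) ≤ n := by exact_mod_cast hn
    nlinarith
  have htω : ω ≤ t := hn1.trans ht.1
  have ht0 : 0 ≤ t := hω.le.trans htω
  have hN0 : (0:ℝ) ≤ N * ω := by positivity
  have hJ00 : (0:ℝ) ≤ J0 * ω := by positivity
  have ball : ∀ x, x1 - ρ ≤ x → x ≤ x1 + ρ → E / 2 ≤ u t x := by
    intro x h1 h2
    have h3 := hlip μ f p u g h t htω x x1
    have h4 : |x - x1| ≤ ρ := abs_le.2 ⟨by linarith, by linarith⟩
    have h5 := mul_le_mul_of_nonneg_left h4 hA.le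
    have h6 := (abs_le.1 h3).1
    linarith
  have hgt : g t < x1 - ρ :=
    h.gt_of_pos ht0 (lt_of_lt_of_le (by positivity) (ball (x1 - ρ) le_rfl (by linarith)))
  have hgs : ∀ s ≥ t, g s < x1 - ρ := fun s hs =>
    lt_of_le_of_lt (h.anti (mem_Ici.2 ht0) (mem_Ici.2 (ht0.trans hs)) hs) hgt
  set T1 := t + N * ω with hT1
  set T := ((n + 2 + N : ℕ) : ℝ) * ω with hT
  have hT' : T = n * ω + 2 * ω + N * ω := by rw [hT]; push_cast; ring
  have hTd1 : ω ≤ T - T1 := by linarith [ht.2]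
  have hTd2 : T ≤ T1 + 2 * ω := by linarith [ht.1]
  have hT1t : t ≤ T1 := by linarith
  have hTt : t ≤ T := by linarith
  -- lower bound at time `T`
  have low : ∀ y ≥ x1, e ≤ u T y := by
    intro y hy
    obtain ⟨k, hk1, hk2⟩ : ∃ k : ℕ, x1 + k * L ≤ y ∧ y ≤ x1 + k * L + L := by
      refine ⟨⌊(y - x1) / L⌋₊, ?_, ?_⟩
      · have := Nat.floor_le (show 0 ≤ (y - x1) / L from div_nonneg (by linarith) hL.le)
        rw [le_div_iff₀ hL] at this; linarith
      · have := (Nat.lt_floor_add_one ((y - x1) / L)).le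
        rw [div_le_iff₀ hL] at this; linarith
    set s := (y - x1 - k * L) / (T - T1) with hs
    have hs0 : 0 ≤ s := div_nonneg (by linarith) (by linarith)
    have hsB : |s| ≤ L / ω := by
      rw [abs_of_nonneg hs0, hs]
      exact div_le_div₀ hL.le (by linarith) hω hTd1
    have hsT : x1 + k * L - ρ + s * (T - T1) = y - ρ := by
      rw [hs, div_mul_cancel₀ _ (by linarith)]; ring
    have hk0 : (0:ℝ) ≤ k * L := by positivity
    have inR : ∀ a ∈ Icc T1 T, ∀ x, x1 + k * L - ρ + s * (a - T1) ≤ x → g a < x := by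
      intro a ha x hx
      have := mul_nonneg hs0 (show 0 ≤ a - T1 by linarith [ha.1])
      have := hgs a (hT1t.trans ha.1)
      linarith
    have key := H f u (fun _ _ => 0) T1 T (E / 2) (fun a => x1 + k * L - ρ + s * (a - T1)) (fun _ => s)
      hTd2 (by positivity) (by fun_prop)
      (fun a _ => by simpa using (((hasDerivAt_id a).sub_const T1).const_mul s).const_add (x1 + k * L - ρ))
      (fun _ _ => hsB)
      ((h.cont.mono fun q hq => le_trans (by linarith) hq.1.1).sub continuousOn_const)
      (fun a ha x _ _ => h.nonneg (by linarith [ha.1]))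
      (fun x hx1 hx2 => by
        simp only [sub_self, mul_zero, add_zero] at hx1 hx2
        have h1 := hN k t ht0 x
        have h2 := ball (x - k * L) (by linarith) (by linarith)
        rw [sub_zero]; linarith)
      (fun a ha x hx _ _ => ⟨h.fb.sol a (by linarith [ha.1]) x (inR a ⟨ha.1.le, ha.2⟩ x hx.le),
        locSol_zero c.zero a x, c.lip a x _ _ (h.nonneg (by linarith [ha.1]))
          (h.leM (by linarith [ha.1])) le_rfl hM.le⟩)
      T ⟨by linarith, le_rfl⟩ y (by linarith) (by linarith)
    simp only [hsT, sub_zero] at key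
    refine (min_le_left _ _).trans (le_of_eq_of_le ?_ key)
    ring
  -- convergence
  intro x hx
  have hx' : x1 ≤ x := by linarith [le_max_right R 0]
  have hxR : R ≤ x - x1 := by linarith [le_max_left R 0]
  have key := HL (u := u) (v := fun a y => v (a - T) y) (T := T) (T' := T + J0 * ω) (x1 := x1) (δ := 0)
    c hΛ le_rfl (h.cont.mono fun q hq => le_trans (by linarith) hq.1.1)
    ((vc.comp (show Continuous fun q : ℝ × ℝ => ((q.1 - T, q.2) : ℝ × ℝ) by fun_prop)).continuousOn)
    (fun a ha y => ⟨h.nonneg (by linarith [ha.1]), h.leM (by linarith [ha.1])⟩)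
    (fun a ha y => vb _ (by linarith [ha.1]) y)
    (fun y hy => by simp only [sub_self, v0, sub_zero]; exact low y hy)
    (fun a ha y hy => h.fb.sol a (by linarith [ha.1]) y (by
      have := hgs a (by linarith [ha.1]); linarith))
    (fun a ha y hy => by
      have h1 := vl (a - T) (by linarith [ha.1]) y
      have h2 := LocSol.shift (t := a) (x := y) (a := -T) (b := 0) (u := v) (d := d) (f := f)
        (by rw [add_zero, ← sub_eq_add_neg]; exact h1) (by
          rw [add_zero, ← sub_eq_add_neg]
          have h3 := c.per_t (-((n + 2 + N : ℕ) : ℤ)) a y (v (a - T) y) (vb _ (by linarith [ha.1]) y).1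
          rw [← h3]; congr 1; rw [hT]; push_cast; ring)
      simpa only [add_zero, ← sub_eq_add_neg] using h2)
    (T + J0 * ω) ⟨by linarith, le_rfl⟩ x hx'
  simp only [add_sub_cancel_left, zero_add] at key
  have hv := (abs_le.1 (hS (J0 * ω) hJ0 x)).1
  have hp : p (J0 * ω) x = p 0 x := by
    have := c.ppt J0 0 x
    push_cast at this
    rwa [zero_add] at this
  rw [hp] at hv
  have hexp : M * Real.exp (-(x - x1)) * Real.exp (Λ * (J0 * ω)) ≤ δ / 4 := by
    have h1 : Real.exp R ≤ Real.exp (x - x1) := Real.exp_le_exp.2 hxR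
    rw [hR, Real.exp_log (by positivity), div_le_iff₀ (by positivity)] at h1
    rw [Real.exp_neg]
    have h2 := Real.exp_pos (x - x1)
    rw [show M * (Real.exp (x - x1))⁻¹ * Real.exp (Λ * (J0 * ω)) =
      M * Real.exp (Λ * (J0 * ω)) / Real.exp (x - x1) by field_simp, div_le_iff₀ h2]
    linarith
  have hfin : ((n + (2 + N + J0) : ℕ) : ℝ) * ω = T + J0 * ω := by rw [hT]; push_cast; ring
  rw [hfin]
  linarith

lemma Good.speed (G : Good d μ ω M K δ f p u g) (c : Ctx d μ ω L M K m f p) :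
    ∃ cs > 0, Tendsto (fun n : ℕ => (g 0 - g (n * ω)) / n) atTop (𝓝 cs) ∧
      ∀ c' < cs, ∃ P ≥ 1, ∃ b, QQ ω L u P b ∧ c' * P ≤ b := by
  have hL := c.hL
  have hω := c.hω
  have hM := c.hM
  have hμ := c.hμ
  have hd := c.hd
  have hK := c.hK
  have h := G.nice
  have heta : ∀ θ > 0, ∃ η > 0, η ≤ θ ∧ K < 2 * d / η ^ 2 := by
    intro θ hθ
    set η0 := √(d / K) with hη0
    have h0 : 0 < η0 := Real.sqrt_pos.2 (by positivity)
    refine ⟨min θ η0, lt_min hθ h0, min_le_left _ _, ?_⟩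
    have hη : 0 < min θ η0 := lt_min hθ h0
    rw [lt_div_iff₀ (by positivity)]
    have h1 : (min θ η0) ^ 2 ≤ η0 ^ 2 := pow_le_pow_left₀ hη.le (min_le_right _ _) 2
    rw [hη0, Real.sq_sqrt (by positivity), ← hη0] at h1
    have h2 := mul_le_mul_of_nonneg_left h1 hK.le
    rw [mul_div_cancel₀ _ hK.ne'] at h2
    linarith
  have step : ∀ n : ℕ, ∀ η > 0, ∀ E > 0, K < 2 * d / η ^ 2 →
      (∀ t ∈ Icc (n * ω) ((n + 1) * ω), ∀ x, g t ≤ x → x ≤ g t + η → u t x < E) →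
      g 0 - g ((n + 1 : ℕ) * ω) ≤ g 0 - g (n * ω) + (η + 3 * μ * E / η * ω) := by
    intro n η hη E hE hηK hs
    have e : n * ω + ω = ((n:ℝ) + 1) * ω := by ring
    have := UB h (T := n * ω) (τ := ω) hE hη hηK (by positivity) (by rw [e]; exact hs) (n * ω + ω)
      ⟨by linarith, le_rfl⟩
    rw [e] at this
    push_cast
    rw [show ((n:ℝ) + 1) * ω - n * ω = ω by ring] at this
    linarith
  obtain ⟨η1, hη1, -, hη1K⟩ := heta 1 one_pos
  refine seq_speed (a := fun n : ℕ => g 0 - g (n * ω)) (Q := QQ ω L u)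
    (C₁ := η1 + 3 * μ * (M + 1) / η1 * ω) ?_ (fun P b hQ n => QQ_g h c hQ n) (by positivity) ?_
    (G.QQ_pos c) ?_
  · refine monotone_nat_of_le_succ fun n => ?_
    have h1 : (0:ℝ) ≤ n * ω := by positivity
    have h2 : (n:ℝ) * ω ≤ ((n + 1 : ℕ) : ℝ) * ω := by push_cast; linarith
    have := h.anti (mem_Ici.2 h1) (mem_Ici.2 (h1.trans h2)) h2
    linarith
  · intro n
    refine step n η1 hη1 (M + 1) (by linarith) hη1K fun t ht x _ _ => ?_
    have : (0:ℝ) ≤ n * ω := by positivity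
    have := h.leM (x := x) (this.trans ht.1)
    linarith
  · intro θ hθ
    obtain ⟨η, hη, hηθ, hηK⟩ := heta (θ / 2) (half_pos hθ)
    set E := θ * η / (6 * μ * ω) with hE
    have hE0 : 0 < E := by positivity
    have hEe : 3 * μ * E / η * ω = θ / 2 := by rw [hE]; field_simp; ring
    obtain ⟨J, R, HJ⟩ := G.spread c hE0
    refine ⟨J, R + η + L, fun n hn => ?_⟩
    by_cases hs : ∀ t ∈ Icc (n * ω) ((n + 1) * ω), ∀ x, g t ≤ x → x ≤ g t + η → u t x < E
    · left
      have := step n η hη E hE0 hηK hs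
      rw [hEe] at this
      linarith
    · right
      push Not at hs
      obtain ⟨t, ht, x1, h1, h2, h3⟩ := hs
      have hn0 : (0:ℝ) ≤ n * ω := by positivity
      have hg := h.anti (mem_Ici.2 hn0) (mem_Ici.2 (hn0.trans ht.1)) ht.1
      have := G.QQ_of c (P := n + J) (C := g (n * ω) + η + R) fun x hx =>
        HJ n hn t ht x1 h3 x (by linarith)
      convert this using 1
      ring
end
end

noncomputable section

lemma tendsto_div_shift {G : ℝ → ℝ} {l τ : ℝ} (h : Tendsto (fun t => G (t + τ) / t) atTop (𝓝 l)) :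
    Tendsto (fun t => G t / t) atTop (𝓝 l) := by
  have h1 : Tendsto (fun t : ℝ => t - τ) atTop atTop := tendsto_atTop_add_const_right _ _ tendsto_id
  have h2 := h.comp h1
  have h3 : Tendsto (fun t : ℝ => 1 - τ / t) atTop (𝓝 (1 - 0)) :=
    tendsto_const_nhds.sub (tendsto_const_nhds.div_atTop tendsto_id)
  have h4 := h2.mul h3
  rw [sub_zero, mul_one] at h4
  refine h4.congr' ?_
  filter_upwards [eventually_gt_atTop 0, eventually_gt_atTop τ] with t ht1 ht2
  have : t - τ ≠ 0 := by linarith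
  simp only [Function.comp, sub_add_cancel]
  field_simp

lemma tendsto_div_shift' {G : ℝ → ℝ} {l τ : ℝ} (h : Tendsto (fun t => G t / t) atTop (𝓝 l)) :
    Tendsto (fun t => G (t + τ) / t) atTop (𝓝 l) := by
  apply tendsto_div_shift (G := fun t => G (t + τ)) (τ := -τ)
  refine (tendsto_div_shift (G := G) (τ := 0) (by simpa using h) |>.congr fun t => ?_)
  simp

lemma tendsto_div_of_nat {g : ℝ → ℝ} {ω cs : ℝ} (hω : 0 < ω) (hg : AntitoneOn g (Ici 0))
    (h : Tendsto (fun n : ℕ => (g 0 - g (n * ω)) / n) atTop (𝓝 cs)) :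
    Tendsto (fun t => g t / t) atTop (𝓝 (-(cs / ω))) := by
  -- limits along the grid
  have hn : Tendsto (fun n : ℕ => g (n * ω) / n) atTop (𝓝 (-cs)) := by
    have h0 : Tendsto (fun n : ℕ => g 0 / (n : ℝ)) atTop (𝓝 0) := tendsto_const_div_atTop_nhds_zero_nat _
    have := h0.sub h
    rw [zero_sub] at this
    refine this.congr fun n => ?_
    ring
  have hfl : Tendsto (fun t : ℝ => ⌊t / ω⌋₊) atTop atTop :=
    tendsto_nat_floor_atTop.comp (tendsto_id.atTop_div_const hω)
  have hr : Tendsto (fun t : ℝ => (⌊t / ω⌋₊ : ℝ) / t) atTop (𝓝 (1 / ω)) := by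
    have h1 := (tendsto_nat_floor_div_atTop (R := ℝ)).comp (tendsto_id.atTop_div_const hω)
    have h2 := h1.div_const ω
    refine h2.congr' ?_
    filter_upwards [eventually_gt_atTop 0] with t ht
    simp only [Function.comp, id]
    field_simp
  have hr1 : Tendsto (fun t : ℝ => ((⌊t / ω⌋₊ + 1 : ℕ) : ℝ) / t) atTop (𝓝 (1 / ω)) := by
    have h1 : Tendsto (fun t : ℝ => 1 / t) atTop (𝓝 0) := tendsto_const_nhds.div_atTop tendsto_id
    have := hr.add h1
    rw [add_zero] at this
    refine this.congr fun t => ?_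
    push_cast; ring
  have up := (hn.comp hfl).mul hr
  have lo := (hn.comp ((tendsto_add_atTop_nat 1).comp hfl)).mul hr1
  have e : -cs * (1 / ω) = -(cs / ω) := by ring
  rw [e] at up lo
  refine tendsto_of_tendsto_of_tendsto_of_le_of_le' lo up ?_ ?_
  · filter_upwards [eventually_gt_atTop 0] with t ht
    have h1 := (Nat.lt_floor_add_one (t / ω)).le
    rw [div_le_iff₀ hω] at h1
    have h2 : t ≤ ((⌊t / ω⌋₊ + 1 : ℕ) : ℝ) * ω := by push_cast; exact h1
    have h3 := hg (mem_Ici.2 ht.le) (mem_Ici.2 (ht.le.trans h2)) h2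
    have h4 : ((⌊t / ω⌋₊ + 1 : ℕ) : ℝ) ≠ 0 := by positivity
    simp only [Function.comp]
    rw [div_mul_div_cancel₀ h4]
    exact div_le_div_of_nonneg_right h3 ht.le
  · filter_upwards [eventually_ge_atTop ω] with t ht
    have ht0 : 0 < t := hω.trans_le ht
    have h0 : 1 ≤ ⌊t / ω⌋₊ := by
      rw [Nat.one_le_floor_iff, le_div_iff₀ hω]; linarith
    have h1 := Nat.floor_le (show 0 ≤ t / ω by positivity)
    rw [le_div_iff₀ hω] at h1
    have h3 := hg (mem_Ici.2 (by positivity)) (mem_Ici.2 ht0.le) h1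
    have h4 : ((⌊t / ω⌋₊ : ℕ) : ℝ) ≠ 0 := by
      have : ⌊t / ω⌋₊ ≠ 0 := by omega
      exact_mod_cast this
    simp only [Function.comp]
    rw [div_mul_div_cancel₀ h4]
    exact div_le_div_of_nonneg_right h3 ht0.le

section
variable {d μ ω L M K m δ : ℝ} {f : ℝ → ℝ → ℝ → ℝ} {p : ℝ → ℝ → ℝ} {u : ℝ → ℝ → ℝ}
  {g : ℝ → ℝ}

lemma Good.near (G : Good d μ ω M K δ f p u g) (c : Ctx d μ ω L M K m f p) (P : ℕ) {ε : ℝ}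
    (hε : 0 < ε) : ∃ N : ℕ, ∀ t ∈ Icc (N * ω) (N * ω + P * ω), ∀ x ≥ 0, p t x - ε ≤ u t x := by
  have hω := c.hω
  have hM := c.hM
  have h := G.nice
  set Λ := K + d + 1 with hΛ
  set B := Real.exp (Λ * (P * ω)) with hB
  have hB0 : 0 < B := Real.exp_pos _
  set R := Real.log (M * B / (ε / 2)) with hR
  obtain ⟨N, hN⟩ := G.conv (-(max R 0)) (min (ε / 2 / B) (m / 2)) (lt_min (by positivity) (half_pos c.hm))
  refine ⟨N, fun t ht x hx => ?_⟩
  set x1 := -(max R 0) with hx1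
  have hN0 : (0:ℝ) ≤ N * ω := by positivity
  have hpN : ∀ y, p (N * ω) y = p 0 y := fun y => by
    have := c.ppt N 0 y
    push_cast at this
    rwa [zero_add] at this
  have hgN : g (N * ω) < x1 := by
    refine h.gt_of_pos hN0 ?_
    have := (abs_le.1 (hN N le_rfl x1 le_rfl)).1
    have := min_le_right (ε / 2 / B) (m / 2)
    linarith [c.pm 0 x1, c.hm]
  have key := HL (u := u) (v := p) (T := N * ω) (T' := N * ω + P * ω) (x1 := x1) (δ := ε / 2 / B)
    c hΛ (by positivity) (h.cont.mono fun q hq => le_trans hN0 hq.1.1) c.pc.continuousOn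
    (fun a ha y => ⟨h.nonneg (hN0.trans ha.1), h.leM (hN0.trans ha.1)⟩)
    (fun a ha y => ⟨c.hm.le.trans (c.pm a y), c.pM a y⟩)
    (fun y hy => by
      have := (abs_le.1 (hN N le_rfl y hy)).1
      have := min_le_left (ε / 2 / B) (m / 2)
      rw [hpN]; linarith)
    (fun a ha y hy => h.fb.sol a (lt_of_le_of_lt hN0 ha.1) y (by
      have := h.anti (mem_Ici.2 hN0) (mem_Ici.2 (hN0.trans ha.1.le)) ha.1.le
      linarith))
    (fun a ha y hy => c.psol a y) t ht x (by linarith [le_max_right R 0])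
  have hxR : R ≤ x - x1 := by linarith [le_max_left R 0]
  have e1 : Real.exp (Λ * (t - N * ω)) ≤ B := by
    refine Real.exp_le_exp.2 (mul_le_mul_of_nonneg_left (by linarith [ht.2]) ?_)
    linarith [c.hK, c.hd]
  have e2 : M * Real.exp (-(x - x1)) * B ≤ ε / 2 := by
    have h1 : Real.exp R ≤ Real.exp (x - x1) := Real.exp_le_exp.2 hxR
    rw [hR, Real.exp_log (by positivity), div_le_iff₀ (by positivity)] at h1
    rw [Real.exp_neg]
    have h2 := Real.exp_pos (x - x1)
    rw [show M * (Real.exp (x - x1))⁻¹ * B = M * B / Real.exp (x - x1) by field_simp, div_le_iff₀ h2]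
    linarith
  have e3 : (ε / 2 / B + M * Real.exp (-(x - x1))) * Real.exp (Λ * (t - N * ω)) ≤ ε := by
    refine (mul_le_mul_of_nonneg_left e1 (by positivity)).trans ?_
    rw [add_mul, div_mul_cancel₀ _ hB0.ne']
    linarith
  linarith

lemma Good.concl (G : Good d μ ω M K δ f p u g) (c : Ctx d μ ω L M K m f p) :
    ∃ cs > 0, (∀ c < cs, ∀ ε > 0, ∃ T, ∀ t ≥ T, ∀ x : ℝ, -(c * t) ≤ x → |u t x - p t x| ≤ ε) ∧
      Tendsto (fun t => g t / t) atTop (𝓝 (-cs)) := by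
  have hω := c.hω
  have h := G.nice
  obtain ⟨c0, hc0, hlim, hQ⟩ := G.speed c
  refine ⟨c0 / ω, by positivity, ?_, tendsto_div_of_nat hω h.anti hlim⟩
  intro c1 hc1 ε hε
  rw [lt_div_iff₀ hω] at hc1
  obtain ⟨c', hc', hc'0⟩ := exists_between (max_lt hc1 hc0)
  have hcp : 0 < c' := (le_max_right _ _).trans_lt hc'
  have hcc : c1 * ω < c' := (le_max_left _ _).trans_lt hc'
  obtain ⟨P, hP, b, ⟨k, hbk, Hk⟩, hcb⟩ := hQ c' hc'0
  have hP0 : (0:ℝ) < P := by exact_mod_cast hP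
  have hPω : 0 < P * ω := by positivity
  obtain ⟨N, hN⟩ := G.near c P hε
  have hN0 : (0:ℝ) ≤ N * ω := by positivity
  have iter : ∀ j : ℕ, ∀ s ≥ 0, ∀ x, u s (x + j * (k * L)) ≤ u (s + j * (P * ω)) x := by
    intro j
    induction j with
    | zero => intro s hs x; simp
    | succ j ih =>
      intro s hs x
      have h1 := ih s hs (x + k * L)
      have h2 := Hk (s + j * (P * ω)) (by positivity) x
      have e1 : x + ((j + 1 : ℕ) : ℝ) * (k * L) = x + k * L + j * (k * L) := by push_cast; ring
      have e2 : s + ((j + 1 : ℕ) : ℝ) * (P * ω) = s + j * (P * ω) + P * ω := by push_cast; ring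
      rw [e1, e2]; exact h1.trans h2
  refine ⟨max (N * ω) (c' * (N * ω + P * ω) / (c' - c1 * ω)), fun t ht x hx => ?_⟩
  have ht1 : N * ω ≤ t := (le_max_left _ _).trans ht
  have ht2 := (le_max_right _ _).trans ht
  rw [div_le_iff₀ (by linarith)] at ht2
  have ht0 : 0 ≤ t := hN0.trans ht1
  have hup := h.lep t ht0 x
  set j := ⌊(t - N * ω) / (P * ω)⌋₊ with hj
  have hj1 : j * (P * ω) ≤ t - N * ω := by
    have := Nat.floor_le (show 0 ≤ (t - N * ω) / (P * ω) from div_nonneg (by linarith) hPω.le)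
    rwa [le_div_iff₀ hPω] at this
  have hj2 : t - N * ω ≤ (j + 1) * (P * ω) := by
    have := (Nat.lt_floor_add_one ((t - N * ω) / (P * ω))).le
    rwa [div_le_iff₀ hPω] at this
  set s := t - j * (P * ω) with hs
  have hsN : s ∈ Icc (N * ω) (N * ω + P * ω) := ⟨by linarith, by linarith⟩
  have hst : s + j * (P * ω) = t := by rw [hs]; ring
  have hkc : c' * P ≤ k * L := hcb.trans hbk
  have hj0 : (0:ℝ) ≤ j := Nat.cast_nonneg _
  have hjk : c1 * t ≤ j * (k * L) := by
    have a1 := mul_le_mul_of_nonneg_left hkc hj0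
    refine le_trans ?_ a1
    refine le_of_mul_le_mul_right ?_ hω
    have a2 := mul_le_mul_of_nonneg_left hj2 hcp.le
    nlinarith
  have low := hN s hsN (x + j * (k * L)) (by linarith)
  have h1 := iter j s (hN0.trans hsN.1) x
  rw [hst] at h1
  have e1 : p s (x + j * (k * L)) = p t x := by
    have a1 := c.ppx (j * k) s x
    have a2 := c.ppt (j * P) s x
    push_cast at a1 a2
    rw [← mul_assoc, a1, ← a2, mul_assoc, hst]
  rw [e1] at low
  rw [abs_le]
  constructor <;> linarith

lemma speed_le {u' : ℝ → ℝ → ℝ} {g' : ℝ → ℝ} {δ' c1 c2 : ℝ} (c : Ctx d μ ω L M K m f p)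
    (G : Good d μ ω M K δ f p u g) (G' : Good d μ ω M K δ' f p u' g')
    (h : Tendsto (fun t => g t / t) atTop (𝓝 (-c1)))
    (h' : Tendsto (fun t => g' t / t) atTop (𝓝 (-c2))) : c2 ≤ c1 := by
  obtain ⟨N, hN⟩ := G.conv (g' 0) (δ' / 2) (half_pos G'.hδ)
  have key := star c G.nice G'.nice G'.hδ G'.gap 0 N fun x hx => by
    simp only [Int.cast_zero, zero_mul, sub_zero] at hx
    have := (abs_le.1 (hN N le_rfl x hx)).1
    linarith
  have h1 := tendsto_div_shift' (τ := N * ω) h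
  have := le_of_tendsto_of_tendsto h1 h' (by
    filter_upwards [eventually_gt_atTop 0] with t ht
    have := (key t ht.le).1
    simp only [Int.cast_zero, zero_mul, sub_zero] at this
    exact div_le_div_of_nonneg_right this ht.le)
  linarith
end

lemma good_of_sol {d μ ω L M K m : ℝ} {f : ℝ → ℝ → ℝ → ℝ} {p : ℝ → ℝ → ℝ} {u : ℝ → ℝ → ℝ}
    {g : ℝ → ℝ} (c : Ctx d μ ω L M K m f p) (hf : BasicAssumptions ω L f) {g₀ : ℝ} {u₀ : ℝ → ℝ}
    (hu₀ : memHminus g₀ u₀) (hle : ∀ x ≥ g₀, u₀ x ≤ p 0 x)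
    (hgap : ∃ ε > (0:ℝ), ∃ X : ℝ, ∀ x ≥ X, ε ≤ p 0 x - u₀ x)
    (h : IsHalfFBPSolutionLeft d μ f g₀ u₀ u g)
    (hconv : ∀ C : ℝ, ∀ ε > 0, ∃ N : ℕ, ∀ n : ℕ, N ≤ n → ∀ x ≥ C,
        |u ((n : ℝ) * ω) x - p 0 x| ≤ ε) :
    ∃ (n : ℕ) (δ : ℝ), Good d μ ω M K δ f p (fun t x => u (t + n * ω) x) (fun t => g (t + n * ω)) := by
  obtain ⟨n, hn, δ, hδ, hg⟩ := nice_exists c hf hu₀ hle hgap h hconv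
  refine ⟨n, δ, hn, hδ, fun x => by simpa only [zero_add] using hg x, fun C ε hε => ?_⟩
  obtain ⟨N, hN⟩ := hconv C ε hε
  refine ⟨N, fun k hk x hx => ?_⟩
  have := hN (k + n) (by omega) x hx
  push_cast at this
  rwa [add_mul] at this

theorem half_line_leftward_spreading_speed
    (d μ ω L : ℝ) (hd : 0 < d) (hμ : 0 < μ) (hω : 0 < ω) (hL : 0 < L)
    (f : ℝ → ℝ → ℝ → ℝ) (hf : BasicAssumptions ω L f)
    (p : ℝ → ℝ → ℝ) (hp : HypH d ω L f p) :
    ∃ cstar > (0:ℝ),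
      ∀ (g₀ : ℝ) (u₀ : ℝ → ℝ), memHminus g₀ u₀ →
      (∀ x ≥ g₀, u₀ x ≤ p 0 x) →
      (∃ ε > (0:ℝ), ∃ X : ℝ, ∀ x ≥ X, ε ≤ p 0 x - u₀ x) →
      ∀ (u : ℝ → ℝ → ℝ) (g : ℝ → ℝ), IsHalfFBPSolutionLeft d μ f g₀ u₀ u g →
      (∀ C : ℝ, ∀ ε > 0, ∃ N : ℕ, ∀ n : ℕ, N ≤ n → ∀ x ≥ C,
        |u ((n : ℝ) * ω) x - p 0 x| ≤ ε) →
      (∀ c < cstar, ∀ ε > 0, ∃ T, ∀ t ≥ T, ∀ x : ℝ, -(c * t) ≤ x →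
        |u t x - p t x| ≤ ε) ∧
      Tendsto (fun t => g t / t) atTop (𝓝 (-cstar)) := by
  obtain ⟨M, K, m, c⟩ := ctx_exists hd hμ hω hL hf hp
  by_cases hex : ∃ (u : ℝ → ℝ → ℝ) (g : ℝ → ℝ) (δ : ℝ), Good d μ ω M K δ f p u g
  · obtain ⟨u1, g1, δ1, G1⟩ := hex
    obtain ⟨cs, hcs, -, hl1⟩ := G1.concl c
    refine ⟨cs, hcs, ?_⟩
    intro g₀ u₀ hu₀ hle hgap u g h hconv
    obtain ⟨n, δ, G⟩ := good_of_sol c hf hu₀ hle hgap h hconv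
    obtain ⟨cs', hcs', hA, hB⟩ := G.concl c
    have e : cs' = cs := le_antisymm (speed_le c G1 G hl1 hB) (speed_le c G G1 hB hl1)
    subst e
    refine ⟨?_, tendsto_div_shift hB⟩
    intro c1 hc1 ε hε
    obtain ⟨c2, hc12, hc2⟩ := exists_between hc1
    obtain ⟨T, hT⟩ := hA c2 hc2 ε hε
    refine ⟨max (T + n * ω) (c2 * (n * ω) / (c2 - c1)), fun t ht x hx => ?_⟩
    have ht1 := (le_max_left _ _).trans ht
    have ht2 := (le_max_right _ _).trans ht
    rw [div_le_iff₀ (by linarith)] at ht2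
    have key := hT (t - n * ω) (by linarith) x (by linarith)
    simp only [sub_add_cancel] at key
    have := c.ppt n (t - n * ω) x
    push_cast at this
    rw [sub_add_cancel] at this
    rwa [← this] at key
  · refine ⟨1, one_pos, ?_⟩
    intro g₀ u₀ hu₀ hle hgap u g h hconv
    obtain ⟨n, δ, G⟩ := good_of_sol c hf hu₀ hle hgap h hconv
    exact absurd ⟨_, _, _, G⟩ hex
end
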